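/- arXiv:2103.15961 — 2 statements merged into one kernel-verified Lean document; each statement's English description precedes it below -/
import Mathlib

section
/- Consider the operator 𝒜 = σ d²/dx² on L²(0,π) with domain {f ∈ H²(0,π) : f'(0) + k f(0) = 0, f(π) = 0}, where σ > 0 and k ≥ 0. Then 𝒜 generates a positive C₀-semigroup, namely the semigroup solving the mixed Robin–Dirichlet heat equation, and this semigroup is uniformly exponentially stable if and only if k < 1/π (equivalently r(M D_0) = kπ < 1). -/
open Filter MeasureTheory Set Real

/-- Lebesgue measure on `[0,π]`. -/
noncomputable def mu0pi : Measure ℝ := volume.restrict (Icc (0 : ℝ) π)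

/-- `HeatGen σ k f g` says `f ∈ D(𝒜)` and `𝒜 f = g` for `𝒜 = σ d²/dx²` on
`L²(0,π)` with domain `{f ∈ H²(0,π) : f'(0) + k f(0) = 0, f(π) = 0}`: there are
representatives `F` of `f`, `G` of `g` and a derivative `F₁` with
`F' = F₁`, `σ F₁' = G`, `F₁(0) + k F(0) = 0` and `F(π) = 0`. -/
def HeatGen (σ k : ℝ) (f g : Lp ℝ 2 mu0pi) : Prop :=
  ∃ F F₁ G : ℝ → ℝ, (f : ℝ → ℝ) =ᵐ[mu0pi] F ∧ (g : ℝ → ℝ) =ᵐ[mu0pi] G ∧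
    (∀ x ∈ Icc (0 : ℝ) π, F x = F 0 + ∫ s in (0 : ℝ)..x, F₁ s) ∧
    (∀ x ∈ Icc (0 : ℝ) π, F₁ x = F₁ 0 + ∫ s in (0 : ℝ)..x, σ⁻¹ * G s) ∧
    F₁ 0 + k * F 0 = 0 ∧ F π = 0

section Semigroup

variable {X : Type*} [NormedAddCommGroup X] [NormedSpace ℝ X]

lemma norm_pow_apply_le (B : X →L[ℝ] X) (n : ℕ) (x : X) : ‖(B ^ n) x‖ ≤ ‖B‖ ^ n * ‖x‖ := by
  induction n with
  | zero => simp
  | succ n ih =>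
    rw [pow_succ', pow_succ', mul_assoc]
    exact (B.le_opNorm _).trans (mul_le_mul_of_nonneg_left ih (norm_nonneg _))

lemma exp_smul_one_clm (c : ℝ) :
    NormedSpace.exp (c • (1 : X →L[ℝ] X)) = Real.exp c • (1 : X →L[ℝ] X) := by
  have h := NormedSpace.algebraMap_exp_comm (𝔸 := X →L[ℝ] X) c
  rw [← Real.exp_eq_exp_ℝ, Algebra.algebraMap_eq_smul_one, Algebra.algebraMap_eq_smul_one] at h
  exact h.symm

variable [CompleteSpace X]

lemma hasSum_exp_apply (B : X →L[ℝ] X) (x : X) :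
    HasSum (fun n : ℕ => ((n.factorial : ℝ)⁻¹) • (B ^ n) x) (NormedSpace.exp B x) := by
  have h := NormedSpace.exp_series_hasSum_exp' (𝕂 := ℝ) B
  simpa using h.mapL (ContinuousLinearMap.apply ℝ X x)

lemma norm_exp_apply_le (B : X →L[ℝ] X) (x : X) :
    ‖NormedSpace.exp B x‖ ≤ Real.exp ‖B‖ * ‖x‖ := by
  have hs : HasSum (fun n : ℕ => ‖B‖ ^ n / n.factorial * ‖x‖) (Real.exp ‖B‖ * ‖x‖) := by
    have h := NormedSpace.expSeries_div_hasSum_exp ‖B‖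
    rw [← Real.exp_eq_exp_ℝ] at h
    exact h.mul_right _
  refine (hasSum_exp_apply B x).norm_le_of_bounded hs fun n => ?_
  rw [norm_smul, norm_inv, RCLike.norm_natCast, div_eq_inv_mul, mul_assoc]
  gcongr
  exact norm_pow_apply_le B n x

lemma exp_add_of_commute_clm {B C : X →L[ℝ] X} (h : Commute B C) :
    NormedSpace.exp (B + C) = NormedSpace.exp B * NormedSpace.exp C := by
  let _ := NormedAlgebra.restrictScalars ℚ ℝ (X →L[ℝ] X)
  exact NormedSpace.exp_add_of_commute h

lemma hasDerivAt_exp_smul_apply (B : X →L[ℝ] X) (x : X) (t : ℝ) :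
    HasDerivAt (fun s : ℝ => NormedSpace.exp (s • B) x) (NormedSpace.exp (t • B) (B x)) t := by
  simpa using (hasDerivAt_exp_smul_const B t).clm_apply (hasDerivAt_const t x)

/-- Two commuting generators of contraction semigroups. -/
lemma norm_exp_sub_exp_apply_le {B C : X →L[ℝ] X} (h : Commute B C)
    (hB : ∀ t : ℝ, 0 ≤ t → ∀ x, ‖NormedSpace.exp (t • B) x‖ ≤ ‖x‖)
    (hC : ∀ t : ℝ, 0 ≤ t → ∀ x, ‖NormedSpace.exp (t • C) x‖ ≤ ‖x‖)
    {t : ℝ} (ht : 0 ≤ t) (x : X) :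
    ‖NormedSpace.exp (t • B) x - NormedSpace.exp (t • C) x‖ ≤ t * ‖B x - C x‖ := by
  have hfac : ∀ (s : ℝ) (y : X), NormedSpace.exp (t • C) (NormedSpace.exp (s • (B - C)) y)
      = NormedSpace.exp ((t - s) • C) (NormedSpace.exp (s • B) y) := by
    intro s
    suffices NormedSpace.exp (t • C) * NormedSpace.exp (s • (B - C))
      = NormedSpace.exp ((t - s) • C) * NormedSpace.exp (s • B) from DFunLike.congr_fun this
    rw [← exp_add_of_commute_clm, ← exp_add_of_commute_clm]
    · congr 1
      module
    · exact (h.symm.smul_left _).smul_right _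
    · exact ((h.symm.sub_right (Commute.refl C)).smul_left _).smul_right _
  have hd : ∀ s ∈ Icc 0 t, HasDerivWithinAt
      (fun s : ℝ => NormedSpace.exp (t • C) (NormedSpace.exp (s • (B - C)) x))
      (NormedSpace.exp (t • C) (NormedSpace.exp (s • (B - C)) ((B - C) x))) (Icc 0 t) s :=
    fun s _ => ((NormedSpace.exp (t • C)).hasFDerivAt.comp_hasDerivAt s
      (hasDerivAt_exp_smul_apply (B - C) x s)).hasDerivWithinAt
  have hb : ∀ s ∈ Ico 0 t,
      ‖NormedSpace.exp (t • C) (NormedSpace.exp (s • (B - C)) ((B - C) x))‖ ≤ ‖B x - C x‖ := by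
    intro s hs
    rw [hfac]
    exact (hC _ (by linarith [hs.2]) _).trans (hB _ hs.1 _)
  have key := norm_image_sub_le_of_norm_deriv_le_segment' hd hb t (right_mem_Icc.2 ht)
  simp only [hfac] at key
  simpa [mul_comm] using key

lemma norm_exp_smul_sub_sub_le {B : X →L[ℝ] X}
    (hB : ∀ t : ℝ, 0 ≤ t → ∀ x, ‖NormedSpace.exp (t • B) x‖ ≤ ‖x‖)
    {t : ℝ} (ht : 0 ≤ t) (f g h : X) :
    ‖NormedSpace.exp (t • B) f - f - t • g‖ ≤
      (‖B f - g‖ + (2 * ‖g - h‖ + t * ‖B h‖)) * t := by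
  have hlip : ∀ s ∈ Icc 0 t, ‖NormedSpace.exp (s • B) h - h‖ ≤ s * ‖B h‖ := by
    intro s hs
    simpa using norm_exp_sub_exp_apply_le (Commute.zero_right B) hB
      (by simp [NormedSpace.exp_zero]) hs.1 h
  have hd : ∀ s ∈ Icc 0 t, HasDerivWithinAt
      (fun s : ℝ => NormedSpace.exp (s • B) f - s • g)
      (NormedSpace.exp (s • B) (B f) - g) (Icc 0 t) s := fun s _ => by
    have := (hasDerivAt_exp_smul_apply B f s).sub ((hasDerivAt_id s).smul_const g)
    simpa using! this.hasDerivWithinAt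
  have hb : ∀ s ∈ Ico 0 t, ‖NormedSpace.exp (s • B) (B f) - g‖ ≤
      ‖B f - g‖ + (2 * ‖g - h‖ + t * ‖B h‖) := by
    intro s hs
    have e : NormedSpace.exp (s • B) (B f) - g = NormedSpace.exp (s • B) (B f - g)
        + NormedSpace.exp (s • B) (g - h) + (NormedSpace.exp (s • B) h - h) + (h - g) := by
      simp only [map_sub]; abel
    rw [e]
    have h1 := hB s hs.1 (B f - g)
    have h2 := hB s hs.1 (g - h)
    have h3 := hlip s ⟨hs.1, hs.2.le⟩
    have h4 : s * ‖B h‖ ≤ t * ‖B h‖ := by gcongr; exact hs.2.le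
    have h5 := norm_sub_rev h g
    have h6 := norm_add₃_le (a := NormedSpace.exp (s • B) (B f - g))
      (b := NormedSpace.exp (s • B) (g - h)) (c := NormedSpace.exp (s • B) h - h)
    have h7 := norm_add_le (NormedSpace.exp (s • B) (B f - g)
        + NormedSpace.exp (s • B) (g - h) + (NormedSpace.exp (s • B) h - h)) (h - g)
    linarith
  have key := norm_image_sub_le_of_norm_deriv_le_segment' hd hb t (right_mem_Icc.2 ht)
  simpa [sub_right_comm] using key

/-- Commuting uniformly continuous contraction semigroups whose generators converge on a dense set
converge strongly to a contraction semigroup, and its generator extends the limit. -/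
theorem exists_semigroup_of_tendsto_generators (Y : ℕ → X →L[ℝ] X)
    (hcomm : ∀ n m, Commute (Y n) (Y m))
    (hcontr : ∀ n, ∀ t : ℝ, 0 ≤ t → ∀ x, ‖NormedSpace.exp (t • Y n) x‖ ≤ ‖x‖)
    (hdense : Dense {f : X | ∃ g, Tendsto (fun n => Y n f) atTop (nhds g)}) :
    ∃ T : ℝ → X →L[ℝ] X,
      (∀ t, 0 ≤ t → ∀ f,
        Tendsto (fun n => NormedSpace.exp (t • Y n) f) atTop (nhds (T t f))) ∧
      T 0 = 1 ∧ (∀ t s : ℝ, 0 ≤ t → 0 ≤ s → T (t + s) = (T t).comp (T s)) ∧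
      (∀ f, ContinuousOn (fun t => T t f) (Ici (0 : ℝ))) ∧
      (∀ t, 0 ≤ t → ∀ f, ‖T t f‖ ≤ ‖f‖) ∧
      (∀ f g, Tendsto (fun n => Y n f) atTop (nhds g) →
        Tendsto (fun t : ℝ => t⁻¹ • (T t f - f)) (nhdsWithin 0 (Ioi 0)) (nhds g)) := by
  have hcauchy : ∀ t : ℝ, 0 ≤ t → ∀ f, CauchySeq (fun n => NormedSpace.exp (t • Y n) f) := by
    intro t ht f
    rw [Metric.cauchySeq_iff]
    intro ε hε
    obtain ⟨h, hfh, ⟨g, hg⟩⟩ := Metric.dense_iff.1 hdense f (ε / 4) (by positivity)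
    rw [Metric.mem_ball, dist_eq_norm, norm_sub_rev] at hfh
    obtain ⟨N, hN⟩ := Metric.cauchySeq_iff.1 hg.cauchySeq (ε / (4 * (t + 1))) (by positivity)
    refine ⟨N, fun m hm n hn => ?_⟩
    have h1 := hcontr m t ht (f - h)
    have h2 := hcontr n t ht (f - h)
    have h3 := norm_exp_sub_exp_apply_le (hcomm m n) (hcontr m) (hcontr n) ht h
    have h4 := (hN m hm n hn).le
    rw [dist_eq_norm, le_div_iff₀ (by positivity)] at h4
    have h5 : t * ‖Y m h - Y n h‖ ≤ (t + 1) * ‖Y m h - Y n h‖ := by gcongr; linarith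
    rw [dist_eq_norm]
    have e : NormedSpace.exp (t • Y m) f - NormedSpace.exp (t • Y n) f =
        NormedSpace.exp (t • Y m) (f - h)
        + (NormedSpace.exp (t • Y m) h - NormedSpace.exp (t • Y n) h)
        + -NormedSpace.exp (t • Y n) (f - h) := by
      simp only [map_sub]; abel
    rw [e]
    refine norm_add₃_le.trans_lt ?_
    rw [norm_neg]
    linarith
  choose! L hL using fun t (ht : 0 ≤ t) f => cauchySeq_tendsto_of_complete (hcauchy t ht f)
  have hlim : ∀ t : ℝ, ∃ S : X →L[ℝ] X, 0 ≤ t → ∀ f,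
      Tendsto (fun n => NormedSpace.exp (t • Y n) f) atTop (nhds (S f)) := by
    intro t
    by_cases ht : 0 ≤ t
    · exact ⟨continuousLinearMapOfTendsto (fun n => NormedSpace.exp (t • Y n))
        (tendsto_pi_nhds.2 (hL t ht)), fun _ f => hL t ht f⟩
    · exact ⟨0, fun h => absurd h ht⟩
  choose T hT using hlim
  have hTc : ∀ t, 0 ≤ t → ∀ f, ‖T t f‖ ≤ ‖f‖ := fun t ht f =>
    le_of_tendsto (hT t ht f).norm (Eventually.of_forall fun n => hcontr n t ht f)
  have hsemi : ∀ t s : ℝ, 0 ≤ t → 0 ≤ s → T (t + s) = (T t).comp (T s) := by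
    intro t s ht hs
    ext f
    refine tendsto_nhds_unique (hT (t + s) (add_nonneg ht hs) f) ?_
    have h1 : Tendsto (fun n => NormedSpace.exp (t • Y n) (NormedSpace.exp (s • Y n) f - T s f))
        atTop (nhds 0) := by
      refine squeeze_zero_norm (fun n => hcontr n t ht _) ?_
      simpa using ((hT s hs f).sub_const (T s f)).norm
    have h2 := h1.add (hT t ht (T s f))
    rw [zero_add] at h2
    refine h2.congr fun n => ?_
    rw [add_smul, exp_add_of_commute_clm (((Commute.refl (Y n)).smul_left t).smul_right s)]
    simp
  have hquot : ∀ f g, Tendsto (fun n => Y n f) atTop (nhds g) → ∀ h e,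
      Tendsto (fun n => Y n h) atTop (nhds e) → ∀ t, 0 ≤ t →
      ‖T t f - f - t • g‖ ≤ (2 * ‖g - h‖ + t * ‖e‖) * t := by
    intro f g hf h e hh t ht
    have h1 := (((hT t ht f).sub_const f).sub_const (t • g)).norm
    have h2 := (((hf.sub_const g).norm).add
      ((hh.norm.const_mul t).const_add (2 * ‖g - h‖))).mul_const t
    simpa using le_of_tendsto_of_tendsto' h1 h2
      fun n => norm_exp_smul_sub_sub_le (hcontr n) ht f g h
  have hgen : ∀ f g, Tendsto (fun n => Y n f) atTop (nhds g) →
      Tendsto (fun t : ℝ => t⁻¹ • (T t f - f)) (nhdsWithin 0 (Ioi 0)) (nhds g) := by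
    intro f g hf
    rw [Metric.tendsto_nhds]
    intro ε hε
    obtain ⟨h, hgh, ⟨e, he⟩⟩ := Metric.dense_iff.1 hdense g (ε / 4) (by positivity)
    rw [Metric.mem_ball, dist_eq_norm, norm_sub_rev] at hgh
    have hsmall : ∀ᶠ t : ℝ in nhdsWithin 0 (Ioi 0), t * ‖e‖ < ε / 2 := by
      have : Tendsto (fun t : ℝ => t * ‖e‖) (nhdsWithin 0 (Ioi 0)) (nhds (0 * ‖e‖)) :=
        (tendsto_id.mul_const _).mono_left nhdsWithin_le_nhds
      exact this.eventually (gt_mem_nhds (by simpa using hε))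
    filter_upwards [hsmall, self_mem_nhdsWithin] with t hte (ht : 0 < t)
    have h1 := hquot f g hf h e he t ht.le
    have e1 : t⁻¹ • (T t f - f) - g = t⁻¹ • (T t f - f - t • g) := by
      rw [smul_sub t⁻¹ (T t f - f), smul_smul, inv_mul_cancel₀ ht.ne', one_smul]
    rw [dist_eq_norm, e1, norm_smul, norm_inv, Real.norm_of_nonneg ht.le, inv_mul_lt_iff₀ ht]
    nlinarith
  refine ⟨T, hT, ?_, hsemi, ?_, hTc, hgen⟩
  · ext f
    refine tendsto_nhds_unique (hT 0 le_rfl f) ?_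
    simp [NormedSpace.exp_zero]
  · intro f
    have hlip : ∀ h e, Tendsto (fun n => Y n h) atTop (nhds e) → ∀ t s : ℝ, 0 ≤ s → s ≤ t →
        ‖T t h - T s h‖ ≤ (t - s) * ‖e‖ := by
      intro h e he t s hs hst
      have h2 : ‖T (t - s) h - h‖ ≤ (t - s) * ‖e‖ := by
        have h1 := ((hT (t - s) (by linarith) h).sub_const h).norm
        refine le_of_tendsto_of_tendsto' h1 (he.norm.const_mul (t - s)) fun n => ?_
        simpa using norm_exp_sub_exp_apply_le (Commute.zero_right (Y n)) (hcontr n)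
          (by simp [NormedSpace.exp_zero]) (by linarith : 0 ≤ t - s) h
      have h3 : T t h - T s h = T s (T (t - s) h - h) := by
        rw [map_sub, ← ContinuousLinearMap.comp_apply, ← hsemi s (t - s) hs (by linarith)]
        simp
      rw [h3]
      exact (hTc s hs _).trans h2
    rw [Metric.continuousOn_iff]
    intro t ht ε hε
    obtain ⟨h, hfh, ⟨e, he⟩⟩ := Metric.dense_iff.1 hdense f (ε / 4) (by positivity)
    rw [Metric.mem_ball, dist_eq_norm, norm_sub_rev] at hfh
    refine ⟨ε / (2 * (‖e‖ + 1)), by positivity, fun s hs hst => ?_⟩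
    have hlip' : ‖T s h - T t h‖ ≤ |s - t| * ‖e‖ := by
      rcases le_total s t with hle | hle
      · rw [norm_sub_rev, abs_sub_comm, abs_of_nonneg (sub_nonneg.2 hle)]
        exact hlip h e he t s hs hle
      · rw [abs_of_nonneg (sub_nonneg.2 hle)]
        exact hlip h e he s t ht hle
    have h1 := hTc s hs (f - h)
    have h2 := hTc t ht (f - h)
    rw [Real.dist_eq, lt_div_iff₀ (by positivity)] at hst
    have h5 := abs_nonneg (s - t)
    have e1 : T s f - T t f = T s (f - h) + (T s h - T t h) + -T t (f - h) := by
      simp only [map_sub]; abel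
    rw [dist_eq_norm, e1]
    refine norm_add₃_le.trans_lt ?_
    rw [norm_neg]
    linarith
end Semigroup

section LumerPhillips

variable {H : Type*} [NormedAddCommGroup H] [InnerProductSpace ℝ H]

lemma norm_le_of_dissipative {A : Submodule ℝ (H × H)}
    (hdis : ∀ f g, (f, g) ∈ A → inner ℝ g f ≤ 0) {l : ℝ} (hl : 0 < l) {f h : H}
    (hf : (f, l • f - h) ∈ A) : ‖f‖ ≤ l⁻¹ * ‖h‖ := by
  have h1 := hdis _ _ hf
  rw [inner_sub_left, real_inner_smul_left, real_inner_self_eq_norm_sq] at h1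
  have h2 := real_inner_le_norm h f
  rw [← div_eq_inv_mul, le_div_iff₀ hl]
  rcases (norm_nonneg f).eq_or_lt with h0 | h0
  · rw [← h0, zero_mul]; exact norm_nonneg h
  · nlinarith

/-- The resolvent of an m-dissipative operator given by its graph. -/
lemma exists_resolvent_of_dissipative {A : Submodule ℝ (H × H)}
    (hdis : ∀ f g, (f, g) ∈ A → inner ℝ g f ≤ 0) {l : ℝ} (hl : 0 < l)
    (hrange : ∀ h, ∃ f, (f, l • f - h) ∈ A) :
    ∃ R : H →L[ℝ] H, ‖R‖ ≤ l⁻¹ ∧ ∀ f h, (f, l • f - h) ∈ A ↔ R h = f := by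
  choose r hr using hrange
  have huniq : ∀ f f' h, (f, l • f - h) ∈ A → (f', l • f' - h) ∈ A → f = f' := by
    intro f f' h hf hf'
    have h1 : (f - f', l • (f - f') - 0) ∈ A := by
      convert A.sub_mem hf hf' using 1
      ext <;> simp [smul_sub]
    have := norm_le_of_dissipative hdis hl h1
    simpa [sub_eq_zero] using this
  let R : H →ₗ[ℝ] H :=
    { toFun := r
      map_add' := fun x y => by
        refine huniq _ _ _ (hr _) ?_
        convert A.add_mem (hr x) (hr y) using 1
        ext
        · simp
        · simp only [Prod.mk_add_mk]; module
      map_smul' := fun c x => by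
        refine huniq _ _ _ (hr _) ?_
        convert A.smul_mem c (hr x) using 1
        ext
        · simp
        · simp only [Prod.smul_mk, RingHom.id_apply]; module }
  refine ⟨R.mkContinuous l⁻¹ fun h => norm_le_of_dissipative hdis hl (hr h),
    R.mkContinuous_norm_le (by positivity) _, fun f h => ⟨fun hf => ?_, ?_⟩⟩
  · exact huniq _ _ _ (hr h) hf
  · rintro rfl
    exact hr h

lemma dense_domain_of_dissipative [CompleteSpace H] {A : Submodule ℝ (H × H)}
    (hdis : ∀ f g, (f, g) ∈ A → inner ℝ g f ≤ 0) (hsv : ∀ g, ((0 : H), g) ∈ A → g = 0)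
    {l : ℝ} (hl : 0 < l) (hrange : ∀ h, ∃ f, (f, l • f - h) ∈ A) :
    Dense {f : H | ∃ g, (f, g) ∈ A} := by
  have hset : {f : H | ∃ g, (f, g) ∈ A} = (A.map (LinearMap.fst ℝ H H) : Submodule ℝ H) := by
    ext f; simp
  rw [hset, Submodule.dense_iff_topologicalClosure_eq_top,
    Submodule.topologicalClosure_eq_top_iff, Submodule.eq_bot_iff]
  intro v hv
  obtain ⟨f, hf⟩ := hrange v
  have h1 := hdis _ _ hf
  have h2 : inner ℝ f v = 0 := hv f ⟨_, hf, rfl⟩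
  rw [inner_sub_left, real_inner_smul_left, real_inner_self_eq_norm_sq, real_inner_comm, h2,
    sub_zero] at h1
  have h3 : f = 0 := by
    by_contra hne
    have : 0 < ‖f‖ := norm_pos_iff.2 hne
    have : 0 < l * ‖f‖ ^ 2 := by positivity
    linarith
  subst h3
  simpa using hsv _ hf

lemma exp_apply_mem_cone [CompleteSpace H] (K : PointedCone ℝ H) (hK : IsClosed (K : Set H))
    {B : H →L[ℝ] H} (hB : ∀ x ∈ K, B x ∈ K) {x : H} (hx : x ∈ K) :
    NormedSpace.exp B x ∈ K := by
  have hpow : ∀ n : ℕ, (B ^ n) x ∈ K := by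
    intro n
    induction n with
    | zero => simpa
    | succ n ih => rw [pow_succ']; exact hB _ ih
  refine hK.mem_of_tendsto (hasSum_exp_apply B x) (Eventually.of_forall fun s => ?_)
  exact K.sum_mem fun n _ => K.smul_mem (by positivity) (hpow n)

/-- The Lumer–Phillips theorem on a Hilbert space, for an operator given by its graph, together
with invariance of closed cones that are invariant under the resolvent. -/
theorem exists_contraction_semigroup_of_dissipative [CompleteSpace H] (A : Submodule ℝ (H × H))
    (hdis : ∀ f g, (f, g) ∈ A → inner ℝ g f ≤ 0) (hsv : ∀ g, ((0 : H), g) ∈ A → g = 0)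
    (l₀ : ℝ) (hl₀ : 0 ≤ l₀) (K : PointedCone ℝ H) (hK : IsClosed (K : Set H))
    (hrange : ∀ l, l₀ < l → ∀ h, ∃ f, (f, l • f - h) ∈ A ∧ (h ∈ K → f ∈ K)) :
    ∃ T : ℝ → H →L[ℝ] H,
      T 0 = 1 ∧ (∀ t s : ℝ, 0 ≤ t → 0 ≤ s → T (t + s) = (T t).comp (T s)) ∧
      (∀ f, ContinuousOn (fun t => T t f) (Ici (0 : ℝ))) ∧
      (∀ t, 0 ≤ t → ∀ f, ‖T t f‖ ≤ ‖f‖) ∧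
      (∀ f g, Tendsto (fun t : ℝ => t⁻¹ • (T t f - f)) (nhdsWithin 0 (Ioi 0)) (nhds g) ↔
        (f, g) ∈ A) ∧
      (∀ t, 0 ≤ t → ∀ f ∈ K, T t f ∈ K) := by
  let l : ℕ → ℝ := fun n => l₀ + 1 + n
  have hll₀ : ∀ n, l₀ < l n := fun n => by
    have : (0 : ℝ) ≤ n := n.cast_nonneg
    simp only [l]; linarith
  have hl : ∀ n, 0 < l n := fun n => hl₀.trans_lt (hll₀ n)
  have hltop : Tendsto l atTop atTop :=
    tendsto_atTop_add_const_left _ _ tendsto_natCast_atTop_atTop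
  have hrange' : ∀ n h, ∃ f, (f, l n • f - h) ∈ A := fun n h =>
    (hrange _ (hll₀ n) h).imp fun _ hf => hf.1
  choose R hRnorm hR using fun n => exists_resolvent_of_dissipative hdis (hl n) (hrange' n)
  have hR' : ∀ n f g, (f, g) ∈ A → R n (l n • f - g) = f := fun n f g h =>
    (hR n f _).1 (by simpa using h)
  have hdense := dense_domain_of_dissipative hdis hsv (hl 0) (hrange' 0)
  have hRid : ∀ n m h, R n h = R m h - (l n - l m) • R n (R m h) := by
    intro n m h
    have h1 := hR' n _ _ ((hR m (R m h) h).2 rfl)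
    rw [map_sub, map_sub, map_smul, map_smul] at h1
    have h2 : R m h - (l n - l m) • R n (R m h) - R n h = R m h - (l n • R n (R m h) -
        (l m • R n (R m h) - R n h)) := by module
    rw [eq_comm, ← sub_eq_zero, h2, h1, sub_self]
  have hRcomm : ∀ n m, Commute (R n) (R m) := by
    intro n m
    rcases eq_or_ne (l n) (l m) with h | h
    · have : R n = R m := by
        ext x
        rw [hRid n m, h, sub_self, zero_smul, sub_zero]
      rw [this]
    · ext x
      have h1 := hRid n m x
      have h2 := hRid m n x
      have h3 : (l n - l m) • (R n (R m x) - R m (R n x)) = 0 := by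
        have h4 : (l n - l m) • R n (R m x) = R m x - R n x := by rw [h1]; abel
        have h5 : (l m - l n) • R m (R n x) = R n x - R m x := by rw [h2]; abel
        have h6 : (l n - l m) • R m (R n x) = R m x - R n x := by
          rw [← neg_sub (l m), neg_smul, h5, neg_sub]
        rw [smul_sub, h4, h6, sub_self]
      exact sub_eq_zero.1 ((smul_eq_zero.1 h3).resolve_left (sub_ne_zero.2 h))
  let Y : ℕ → H →L[ℝ] H := fun n => (l n) ^ 2 • R n + (-l n) • (1 : H →L[ℝ] H)
  have hYexp : ∀ n (t : ℝ) x, NormedSpace.exp (t • Y n) x =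
      Real.exp (-(t * l n)) • NormedSpace.exp ((t * l n ^ 2) • R n) x := by
    intro n t x
    have h1 : t • Y n = (-(t * l n)) • (1 : H →L[ℝ] H) + (t * l n ^ 2) • R n := by
      simp only [Y]; module
    rw [h1, exp_add_of_commute_clm ((Commute.one_left _).smul_left _), exp_smul_one_clm]
    simp
  have hcontr : ∀ n, ∀ t : ℝ, 0 ≤ t → ∀ x, ‖NormedSpace.exp (t • Y n) x‖ ≤ ‖x‖ := by
    intro n t ht x
    rw [hYexp, norm_smul, Real.norm_of_nonneg (Real.exp_pos _).le]
    have h1 : ‖(t * l n ^ 2) • R n‖ ≤ t * l n := by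
      rw [norm_smul, Real.norm_of_nonneg (by positivity)]
      calc t * l n ^ 2 * ‖R n‖ ≤ t * l n ^ 2 * (l n)⁻¹ := by gcongr; exact hRnorm n
        _ = t * l n := by field_simp [(hl n).ne']
    calc Real.exp (-(t * l n)) * ‖NormedSpace.exp ((t * l n ^ 2) • R n) x‖
        ≤ Real.exp (-(t * l n)) * (Real.exp (t * l n) * ‖x‖) := by
          gcongr
          exact (norm_exp_apply_le _ _).trans (by gcongr)
      _ = ‖x‖ := by rw [← mul_assoc, ← Real.exp_add]; simp
  have hcomm : ∀ n m, Commute (Y n) (Y m) := fun n m =>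
    Commute.add_right
      (((hRcomm n m).smul_left _).add_left ((Commute.one_left _).smul_left _) |>.smul_right _)
      ((Commute.one_right _).smul_right _)
  have hJ : ∀ f, Tendsto (fun n => l n • R n f) atTop (nhds f) := by
    have hJc : ∀ n f, ‖l n • R n f‖ ≤ ‖f‖ := by
      intro n f
      rw [norm_smul, Real.norm_of_nonneg (hl n).le]
      calc l n * ‖R n f‖ ≤ l n * ((l n)⁻¹ * ‖f‖) := by
            gcongr
            exact (R n).le_of_opNorm_le (hRnorm n) f
        _ = ‖f‖ := by field_simp [(hl n).ne']
    have hJd : ∀ f g, (f, g) ∈ A → Tendsto (fun n => l n • R n f) atTop (nhds f) := by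
      intro f g hfg
      rw [tendsto_iff_norm_sub_tendsto_zero]
      have h1 : Tendsto (fun n => (l n)⁻¹ * ‖g‖) atTop (nhds 0) := by
        simpa using (tendsto_inv_atTop_zero.comp hltop).mul_const ‖g‖
      refine squeeze_zero (fun _ => norm_nonneg _) (fun n => ?_) h1
      have h2 := hR' n f g hfg
      rw [map_sub, map_smul] at h2
      have h3 : l n • R n f - f = R n g := by
        nth_rw 2 [← h2]; abel
      rw [h3]
      exact (R n).le_of_opNorm_le (hRnorm n) g
    intro f
    rw [Metric.tendsto_nhds]
    intro ε hε
    obtain ⟨h, hfh, ⟨g, hg⟩⟩ := Metric.dense_iff.1 hdense f (ε / 4) (by positivity)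
    rw [Metric.mem_ball, dist_eq_norm] at hfh
    filter_upwards [Metric.tendsto_nhds.1 (hJd h g hg) (ε / 4) (by positivity)] with n hn
    rw [dist_eq_norm] at hn ⊢
    have h1 := hJc n (f - h)
    rw [norm_sub_rev f h] at h1
    have e : l n • R n f - f = l n • R n (f - h) + (l n • R n h - h) + (h - f) := by
      rw [map_sub, smul_sub]; abel
    rw [e]
    refine norm_add₃_le.trans_lt ?_
    linarith
  have hYA : ∀ f g, (f, g) ∈ A → Tendsto (fun n => Y n f) atTop (nhds g) := by
    intro f g hfg
    refine (hJ g).congr fun n => ?_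
    have h2 := hR' n f g hfg
    rw [map_sub, map_smul] at h2
    have h3 : R n g = l n • R n f - f := by
      rw [eq_sub_iff_add_eq, ← sub_eq_iff_eq_add'.1 h2]
    rw [h3]
    simp only [Y, add_apply, smul_apply, one_apply_eq_self]
    module
  obtain ⟨T, hT, hT0, hsemi, hcont, hTc, hgen⟩ := exists_semigroup_of_tendsto_generators Y hcomm
    hcontr (hdense.mono (by rintro f ⟨g, hg⟩; exact ⟨g, hYA f g hg⟩))
  refine ⟨T, hT0, hsemi, hcont, hTc, fun f g => ⟨fun hfg => ?_, fun h => hgen f g (hYA f g h)⟩, ?_⟩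
  · -- the generator extends `A`, and it is dissipative, so it cannot be larger
    have hh := (hR 0 _ (l 0 • f - g)).2 rfl
    set h := R 0 (l 0 • f - g) with hdef
    have h1 := hfg.sub (hgen _ _ (hYA _ _ hh))
    have h2 : Tendsto (fun t : ℝ => t⁻¹ • (T t (f - h) - (f - h))) (nhdsWithin 0 (Ioi 0))
        (nhds (l 0 • (f - h))) := by
      convert h1 using 2
      · rw [map_sub]; module
      · module
    have h3 : inner ℝ (l 0 • (f - h)) (f - h) ≤ 0 := by
      refine le_of_tendsto (h2.inner tendsto_const_nhds) ?_
      filter_upwards [self_mem_nhdsWithin] with t (ht : 0 < t)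
      rw [real_inner_smul_left, inner_sub_left, real_inner_self_eq_norm_sq]
      have h4 := real_inner_le_norm (T t (f - h)) (f - h)
      have h5 := hTc t ht.le (f - h)
      refine mul_nonpos_of_nonneg_of_nonpos (by positivity) ?_
      nlinarith [norm_nonneg (f - h)]
    rw [real_inner_smul_left, real_inner_self_eq_norm_sq] at h3
    have h4 : f = h := by
      by_contra hne
      have : 0 < ‖f - h‖ := norm_pos_iff.2 (sub_ne_zero.2 hne)
      have : 0 < l 0 * ‖f - h‖ ^ 2 := mul_pos (hl 0) (by positivity)
      linarith
    rw [← h4] at hh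
    simpa using hh
  · intro t ht f hf
    refine hK.mem_of_tendsto (hT t ht f) (Eventually.of_forall fun n => ?_)
    rw [SetLike.mem_coe, hYexp]
    refine K.smul_mem (Real.exp_pos _).le (exp_apply_mem_cone K hK (fun x hx => ?_) hf)
    obtain ⟨y, hy, hyK⟩ := hrange _ (hll₀ n) x
    have hxy : R n x = y := (hR n y x).1 hy
    exact K.smul_mem (by positivity) (hxy ▸ hyK hx)

end LumerPhillips

section Primitive

variable {a c U V : ℝ → ℝ} {b : ℝ}

lemma continuousOn_of_eq_add_integral (ha : IntervalIntegrable a volume 0 b) (hb : 0 ≤ b)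
    (hU : ∀ x ∈ Icc 0 b, U x = U 0 + ∫ s in (0 : ℝ)..x, a s) : ContinuousOn U (Icc 0 b) := by
  have h := intervalIntegral.continuousOn_primitive_interval' ha left_mem_uIcc
  rw [uIcc_of_le hb] at h
  exact (continuousOn_const.add h).congr hU

/-- The product rule for primitives of integrable functions, in integrated form. -/
lemma mul_eq_add_integral (ha : IntervalIntegrable a volume 0 b)
    (hc : IntervalIntegrable c volume 0 b)
    (hU : ∀ x ∈ Icc 0 b, U x = U 0 + ∫ s in (0 : ℝ)..x, a s)
    (hV : ∀ x ∈ Icc 0 b, V x = V 0 + ∫ s in (0 : ℝ)..x, c s) :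
    ∀ x ∈ Icc 0 b, U x * V x = U 0 * V 0 + ∫ s in (0 : ℝ)..x, (a s * V s + U s * c s) := by
  intro x hx
  have hsub : uIcc 0 x ⊆ uIcc 0 b := by
    rw [uIcc_of_le hx.1, uIcc_of_le (hx.1.trans hx.2)]
    exact Icc_subset_Icc_right hx.2
  have hac : ∀ {d : ℝ → ℝ} (e : ℝ), IntervalIntegrable d volume 0 b →
      AbsolutelyContinuousOnInterval (fun y => e + ∫ s in (0 : ℝ)..y, d s) 0 x := by
    intro d e hd
    have h1 : AbsolutelyContinuousOnInterval (fun _ : ℝ => e) 0 x :=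
      ContDiffOn.absolutelyContinuousOnInterval contDiffOn_const
    exact h1.add ((hd.mono_set hsub).absolutelyContinuousOnInterval_intervalIntegral left_mem_uIcc)
  have key := (hac (U 0) ha).integral_deriv_mul_eq_sub (hac (V 0) hc)
  rw [← hU x hx, ← hV x hx] at key
  simp only [intervalIntegral.integral_same, add_zero] at key
  rw [eq_comm, ← eq_sub_iff_add_eq', ← key]
  refine intervalIntegral.integral_congr_ae ?_
  filter_upwards [(ha.mono_set hsub).ae_hasDerivAt_integral,
    (hc.mono_set hsub).ae_hasDerivAt_integral] with y h1 h2 hy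
  have hy' : y ∈ uIcc 0 x := uIoc_subset_uIcc hy
  have hyb : y ∈ Icc 0 b := by
    rw [← uIcc_of_le (hx.1.trans hx.2)]; exact hsub hy'
  rw [((h1 hy' 0 left_mem_uIcc).const_add (U 0)).deriv,
    ((h2 hy' 0 left_mem_uIcc).const_add (V 0)).deriv, ← hU y hyb, ← hV y hyb]

lemma eq_add_integral_of_hasDerivAt (hU : ∀ x, HasDerivAt U (a x) x) (ha : Continuous a) (x : ℝ) :
    U x = U 0 + ∫ s in (0 : ℝ)..x, a s := by
  rw [intervalIntegral.integral_eq_sub_of_hasDerivAt (fun y _ => hU y)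
    (ha.intervalIntegrable _ _)]
  ring

lemma ae_eq_zero_of_forall_integral_eq_zero (ha : IntervalIntegrable a volume 0 b)
    (h : ∀ x ∈ Icc 0 b, ∫ s in (0 : ℝ)..x, a s = 0) :
    ∀ᵐ x ∂volume.restrict (Icc 0 b), a x = 0 := by
  rw [ae_restrict_iff' measurableSet_Icc]
  have h0 : ∀ᵐ x : ℝ, x ≠ 0 := by simp [ae_iff, measure_singleton]
  have hb : ∀ᵐ x : ℝ, x ≠ b := by simp [ae_iff, measure_singleton]
  filter_upwards [ha.ae_hasDerivAt_integral, h0, hb] with x hx h0 hb hxb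
  have h1 := hx (by rwa [uIcc_of_le (hxb.1.trans hxb.2)]) 0 left_mem_uIcc
  have h2 : HasDerivAt (fun x => ∫ s in (0 : ℝ)..x, a s) 0 x := by
    refine (hasDerivAt_const x (0 : ℝ)).congr_of_eventuallyEq ?_
    filter_upwards [Icc_mem_nhds (lt_of_le_of_ne hxb.1 h0.symm) (lt_of_le_of_ne hxb.2 hb)]
      with y hy using h y hy
  exact h1.unique h2

end Primitive

section HeatGen

instance : IsFiniteMeasure mu0pi := by
  unfold mu0pi; infer_instance

lemma integral_mu0pi (φ : ℝ → ℝ) : ∫ x, φ x ∂mu0pi = ∫ x in (0 : ℝ)..π, φ x := by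
  rw [mu0pi, intervalIntegral.integral_of_le pi_pos.le, integral_Icc_eq_integral_Ioc]

lemma intervalIntegrable_of_integrable_mu0pi {φ : ℝ → ℝ} (h : Integrable φ mu0pi) :
    IntervalIntegrable φ volume 0 π :=
  (intervalIntegrable_iff_integrableOn_Icc_of_le pi_pos.le).2 h

lemma Lp.intervalIntegrable_mu0pi (g : Lp ℝ 2 mu0pi) : IntervalIntegrable g volume 0 π :=
  intervalIntegrable_of_integrable_mu0pi ((Lp.memLp g).integrable (by norm_num))

lemma intervalIntegrable_of_ae_eq_Lp {G : ℝ → ℝ} {g : Lp ℝ 2 mu0pi} (h : g =ᵐ[mu0pi] G) :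
    IntervalIntegrable G volume 0 π :=
  intervalIntegrable_of_integrable_mu0pi (((Lp.memLp g).integrable (by norm_num)).congr h)

lemma memLp_mu0pi_of_continuousOn {φ : ℝ → ℝ} (h : ContinuousOn φ (Icc 0 π)) :
    MemLp φ 2 mu0pi := by
  obtain ⟨C, hC⟩ := isCompact_Icc.exists_bound_of_continuousOn h
  refine MemLp.of_bound (h.aestronglyMeasurable measurableSet_Icc) C ?_
  exact (ae_restrict_iff' measurableSet_Icc).2 (Eventually.of_forall hC)

lemma inner_mu0pi {f g : Lp ℝ 2 mu0pi} {F G : ℝ → ℝ} (hf : f =ᵐ[mu0pi] F) (hg : g =ᵐ[mu0pi] G) :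
    inner ℝ g f = ∫ x in (0 : ℝ)..π, F x * G x := by
  rw [L2.inner_def, ← integral_mu0pi]
  refine integral_congr_ae ?_
  filter_upwards [hf, hg] with x h1 h2
  simp [h1, h2]

/-- Regularity of the representatives appearing in `HeatGen`. -/
lemma HeatGen.exists_regular {σ k : ℝ} {f g : Lp ℝ 2 mu0pi} (h : HeatGen σ k f g) :
    ∃ F F₁ G : ℝ → ℝ, (f : ℝ → ℝ) =ᵐ[mu0pi] F ∧ (g : ℝ → ℝ) =ᵐ[mu0pi] G ∧
      (∀ x ∈ Icc (0 : ℝ) π, F x = F 0 + ∫ s in (0 : ℝ)..x, F₁ s) ∧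
      (∀ x ∈ Icc (0 : ℝ) π, F₁ x = F₁ 0 + ∫ s in (0 : ℝ)..x, σ⁻¹ * G s) ∧
      F₁ 0 + k * F 0 = 0 ∧ F π = 0 ∧
      IntervalIntegrable G volume 0 π ∧ ContinuousOn F₁ (Icc 0 π) ∧ ContinuousOn F (Icc 0 π) := by
  obtain ⟨F, F₁, G, hf, hg, hF, hF₁, h0, hπ⟩ := h
  have hG := intervalIntegrable_of_ae_eq_Lp hg
  have hc₁ := continuousOn_of_eq_add_integral (hG.const_mul σ⁻¹) pi_pos.le hF₁
  have hc := continuousOn_of_eq_add_integral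
    (hc₁.intervalIntegrable_of_Icc pi_pos.le) pi_pos.le hF
  exact ⟨F, F₁, G, hf, hg, hF, hF₁, h0, hπ, hG, hc₁, hc⟩

lemma IntervalIntegrable.mono_zero_pi {φ : ℝ → ℝ} (h : IntervalIntegrable φ volume 0 π) {x : ℝ}
    (hx : x ∈ Icc 0 π) : IntervalIntegrable φ volume 0 x :=
  h.mono_set (by rw [uIcc_of_le hx.1, uIcc_of_le pi_pos.le]; exact Icc_subset_Icc_right hx.2)

lemma HeatGen.add {σ k : ℝ} {f g f' g' : Lp ℝ 2 mu0pi} (h : HeatGen σ k f g)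
    (h' : HeatGen σ k f' g') : HeatGen σ k (f + f') (g + g') := by
  obtain ⟨F, F₁, G, hf, hg, hF, hF₁, h0, hπ, hG, hc₁, -⟩ := h.exists_regular
  obtain ⟨F', F₁', G', hf', hg', hF', hF₁', h0', hπ', hG', hc₁', -⟩ := h'.exists_regular
  refine ⟨F + F', F₁ + F₁', G + G', (Lp.coeFn_add f f').trans (hf.add hf'),
    (Lp.coeFn_add g g').trans (hg.add hg'), fun x hx => ?_, fun x hx => ?_, ?_, ?_⟩
  · simp only [Pi.add_apply]
    rw [intervalIntegral.integral_add
      ((hc₁.intervalIntegrable_of_Icc pi_pos.le).mono_zero_pi hx)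
      ((hc₁'.intervalIntegrable_of_Icc pi_pos.le).mono_zero_pi hx), hF x hx, hF' x hx]
    ring
  · simp only [Pi.add_apply, mul_add]
    rw [intervalIntegral.integral_add ((hG.const_mul _).mono_zero_pi hx)
      ((hG'.const_mul _).mono_zero_pi hx), hF₁ x hx, hF₁' x hx]
    ring
  · simp only [Pi.add_apply]; linear_combination h0 + h0'
  · simp [hπ, hπ']

lemma HeatGen.smul {σ k : ℝ} (c : ℝ) {f g : Lp ℝ 2 mu0pi} (h : HeatGen σ k f g) :
    HeatGen σ k (c • f) (c • g) := by
  obtain ⟨F, F₁, G, hf, hg, hF, hF₁, h0, hπ⟩ := h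
  refine ⟨c • F, c • F₁, c • G, (Lp.coeFn_smul c f).trans (hf.const_smul c),
    (Lp.coeFn_smul c g).trans (hg.const_smul c), fun x hx => ?_, fun x hx => ?_, ?_, ?_⟩
  · simp only [Pi.smul_apply, smul_eq_mul, intervalIntegral.integral_const_mul]
    rw [hF x hx]; ring
  · simp only [Pi.smul_apply, smul_eq_mul, mul_left_comm _ c, intervalIntegral.integral_const_mul]
    simp only [intervalIntegral.integral_const_mul] at hF₁
    rw [hF₁ x hx]; ring
  · simp only [Pi.smul_apply, smul_eq_mul]; linear_combination c * h0
  · simp [hπ]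

lemma heatGen_zero (σ k : ℝ) : HeatGen σ k 0 0 :=
  ⟨0, 0, 0, Lp.coeFn_zero _ _ _, Lp.coeFn_zero _ _ _, by simp, by simp, by simp, by simp⟩

/-- The graph of `𝒜 - ω`. -/
def heatGraph (σ k ω : ℝ) : Submodule ℝ (Lp ℝ 2 mu0pi × Lp ℝ 2 mu0pi) where
  carrier := {p | HeatGen σ k p.1 (p.2 + ω • p.1)}
  add_mem' {p q} hp hq := by
    have := HeatGen.add hp hq
    simp only [mem_ofPred_eq, Prod.fst_add, Prod.snd_add]
    convert this using 1
    module
  zero_mem' := by simpa using heatGen_zero σ k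
  smul_mem' c p hp := by
    have := HeatGen.smul c hp
    simp only [mem_ofPred_eq, Prod.smul_fst, Prod.smul_snd]
    convert this using 1
    module

lemma mem_heatGraph {σ k ω : ℝ} {f g : Lp ℝ 2 mu0pi} :
    (f, g) ∈ heatGraph σ k ω ↔ HeatGen σ k f (g + ω • f) := Iff.rfl

lemma HeatGen.eq_zero {σ k : ℝ} (hσ : 0 < σ) {g : Lp ℝ 2 mu0pi} (h : HeatGen σ k 0 g) :
    g = 0 := by
  obtain ⟨F, F₁, G, hf, hg, hF, hF₁, h0, hπ, hG, hc₁, hc⟩ := h.exists_regular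
  have hzero : ∀ {φ : ℝ → ℝ}, ContinuousOn φ (Icc 0 π) →
      (∀ᵐ x ∂volume.restrict (Icc 0 π), φ x = 0) → ∀ x ∈ Icc 0 π, φ x = 0 := by
    intro φ hφ hae
    exact Measure.eqOn_Icc_of_ae_eq volume pi_pos.ne hae hφ continuousOn_const
  have hFz := hzero hc (by
    filter_upwards [hf, Lp.coeFn_zero ℝ 2 mu0pi] with x h1 h2
    rw [← h1, h2]; rfl)
  have hF₁z := hzero hc₁ (ae_eq_zero_of_forall_integral_eq_zero
    (hc₁.intervalIntegrable_of_Icc pi_pos.le) fun x hx => by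
      have := hF x hx
      rw [hFz x hx, hFz 0 (left_mem_Icc.2 pi_pos.le)] at this
      linarith)
  have hGz := ae_eq_zero_of_forall_integral_eq_zero (hG.const_mul σ⁻¹) fun x hx => by
      have := hF₁ x hx
      rw [hF₁z x hx, hF₁z 0 (left_mem_Icc.2 pi_pos.le)] at this
      linarith
  rw [Lp.eq_zero_iff_ae_eq_zero]
  filter_upwards [hg, hGz] with x h1 h2
  rw [h1]
  simpa [hσ.ne'] using h2

end HeatGen

section Dissipativity

/-- The Cauchy–Schwarz inequality against a constant on a subinterval of `[0,π]`. -/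
lemma sq_integral_le_pi_mul {φ : ℝ → ℝ} (hφ : ContinuousOn φ (Icc 0 π)) {x : ℝ}
    (hx : x ∈ Icc 0 π) :
    (∫ s in x..π, φ s) ^ 2 ≤ π * ∫ s in (0 : ℝ)..π, φ s ^ 2 := by
  have hsub : Icc x π ⊆ Icc 0 π := Icc_subset_Icc_left hx.1
  have hi : IntervalIntegrable φ volume x π := (hφ.mono hsub).intervalIntegrable_of_Icc hx.2
  have hi2 : IntervalIntegrable (fun s => φ s ^ 2) volume x π :=
    ((hφ.pow 2).mono hsub).intervalIntegrable_of_Icc hx.2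
  have hi2' : IntervalIntegrable (fun s => φ s ^ 2) volume 0 x :=
    ((hφ.pow 2).mono (Icc_subset_Icc_right hx.2)).intervalIntegrable_of_Icc hx.1
  set I := ∫ s in x..π, φ s with hI
  have h1 : 0 ≤ ∫ s in x..π, (π * φ s - I) ^ 2 :=
    intervalIntegral.integral_nonneg hx.2 fun s _ => sq_nonneg _
  have h2 : ∫ s in x..π, (π * φ s - I) ^ 2 =
      π ^ 2 * (∫ s in x..π, φ s ^ 2) - 2 * π * I * I + I ^ 2 * (π - x) := by
    have e : ∀ s, (π * φ s - I) ^ 2 = π ^ 2 * φ s ^ 2 - 2 * π * I * φ s + I ^ 2 := fun s => by ring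
    simp only [e]
    rw [intervalIntegral.integral_add ((hi2.const_mul _).sub (hi.const_mul _))
      intervalIntegrable_const, intervalIntegral.integral_sub (hi2.const_mul _) (hi.const_mul _),
      intervalIntegral.integral_const_mul, intervalIntegral.integral_const_mul,
      intervalIntegral.integral_const, ← hI, smul_eq_mul]
    ring
  have h3 : ∫ s in x..π, φ s ^ 2 ≤ ∫ s in (0 : ℝ)..π, φ s ^ 2 := by
    rw [← intervalIntegral.integral_add_adjacent_intervals hi2' hi2]
    have : 0 ≤ ∫ s in (0 : ℝ)..x, φ s ^ 2 :=
      intervalIntegral.integral_nonneg hx.1 fun s _ => sq_nonneg _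
    linarith
  rw [h2] at h1
  have h4 : 0 ≤ I ^ 2 * x := mul_nonneg (sq_nonneg _) hx.1
  have h5 : π * I ^ 2 ≤ π * (π * ∫ s in x..π, φ s ^ 2) := by nlinarith
  have h6 := le_of_mul_le_mul_left h5 pi_pos
  exact h6.trans (mul_le_mul_of_nonneg_left h3 pi_pos.le)

variable {σ k : ℝ} {f g : Lp ℝ 2 mu0pi}

lemma integral_mul_eq_energy (hσ : 0 < σ) {F F₁ G : ℝ → ℝ}
    (hF : ∀ x ∈ Icc (0 : ℝ) π, F x = F 0 + ∫ s in (0 : ℝ)..x, F₁ s)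
    (hF₁ : ∀ x ∈ Icc (0 : ℝ) π, F₁ x = F₁ 0 + ∫ s in (0 : ℝ)..x, σ⁻¹ * G s)
    (h0 : F₁ 0 + k * F 0 = 0) (hπ : F π = 0) (hG : IntervalIntegrable G volume 0 π)
    (hc₁ : ContinuousOn F₁ (Icc 0 π)) (hc : ContinuousOn F (Icc 0 π)) :
    ∫ x in (0 : ℝ)..π, F x * G x = σ * (k * F 0 ^ 2 - ∫ s in (0 : ℝ)..π, F₁ s ^ 2) := by
  have h1 := mul_eq_add_integral (hc₁.intervalIntegrable_of_Icc pi_pos.le) (hG.const_mul σ⁻¹)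
    hF hF₁ π (right_mem_Icc.2 pi_pos.le)
  have hFG : IntervalIntegrable (fun x => F x * G x) volume 0 π :=
    hG.continuousOn_mul (by rwa [uIcc_of_le pi_pos.le])
  have e : ∀ s, F₁ s * F₁ s + F s * (σ⁻¹ * G s) = F₁ s ^ 2 + σ⁻¹ * (F s * G s) := fun s => by ring
  have hi2 : IntervalIntegrable (fun s => F₁ s ^ 2) volume 0 π :=
    (hc₁.pow 2).intervalIntegrable_of_Icc pi_pos.le
  simp only [e] at h1
  rw [intervalIntegral.integral_add hi2
    (hFG.const_mul _), intervalIntegral.integral_const_mul, hπ,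
    eq_neg_of_add_eq_zero_left h0] at h1
  field_simp at h1
  linear_combination -h1

/-- The form bound `⟪𝒜 f, f⟫ ≤ ω ‖f‖²` with an `ω` that is negative if `k < 1/π`. -/
lemma HeatGen.inner_le_of_lt (hσ : 0 < σ) (hk : 0 ≤ k) (hkπ : k < 1 / π)
    (h : HeatGen σ k f g) : inner ℝ g f ≤ -(σ * (1 - k * π) / π ^ 2) * ‖f‖ ^ 2 := by
  obtain ⟨F, F₁, G, hf, hg, hF, hF₁, h0, hπ, hG, hc₁, hc⟩ := h.exists_regular
  have hi₁ := hc₁.intervalIntegrable_of_Icc (μ := volume) pi_pos.le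
  have hbd : ∀ x ∈ Icc 0 π, F x ^ 2 ≤ π * ∫ s in (0 : ℝ)..π, F₁ s ^ 2 := by
    intro x hx
    have h1 := intervalIntegral.integral_add_adjacent_intervals (hi₁.mono_zero_pi hx)
      ((hc₁.mono (Icc_subset_Icc_left hx.1)).intervalIntegrable_of_Icc (μ := volume) hx.2)
    have h2 : F x = -∫ s in x..π, F₁ s := by
      have h3 := hF π (right_mem_Icc.2 pi_pos.le)
      have h4 := hF x hx
      linarith
    rw [h2, neg_sq]
    exact sq_integral_le_pi_mul hc₁ hx
  rw [inner_mu0pi hf hg, integral_mul_eq_energy hσ hF hF₁ h0 hπ hG hc₁ hc,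
    ← real_inner_self_eq_norm_sq, inner_mu0pi hf hf]
  set E := ∫ s in (0 : ℝ)..π, F₁ s ^ 2
  have hN : ∫ x in (0 : ℝ)..π, F x * F x ≤ π ^ 2 * E := by
    have h1 : ∫ x in (0 : ℝ)..π, F x * F x ≤ ∫ _ in (0 : ℝ)..π, π * E := by
      refine intervalIntegral.integral_mono_on pi_pos.le
        ((hc.mul hc).intervalIntegrable_of_Icc pi_pos.le) intervalIntegrable_const fun x hx => ?_
      rw [← sq]
      exact hbd x hx
    rw [intervalIntegral.integral_const, smul_eq_mul] at h1
    linarith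
  have h1 := hbd 0 (left_mem_Icc.2 pi_pos.le)
  rw [lt_div_iff₀ pi_pos] at hkπ
  have h2 : σ * (k * F 0 ^ 2 - E) ≤ -(σ * (1 - k * π)) * E := by
    have := mul_le_mul_of_nonneg_left (mul_le_mul_of_nonneg_left h1 hk) hσ.le
    linarith
  have h3 : 0 ≤ σ * (1 - k * π) / π ^ 2 :=
    div_nonneg (mul_nonneg hσ.le (by linarith)) (by positivity)
  have h4 := mul_le_mul_of_nonneg_left hN h3
  have h5 : σ * (1 - k * π) / π ^ 2 * (π ^ 2 * E) = σ * (1 - k * π) * E := by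
    field_simp [pi_pos.ne']
  linarith

lemma HeatGen.inner_le (hσ : 0 < σ) (h : HeatGen σ k f g) :
    inner ℝ g f ≤ σ * k ^ 2 * ‖f‖ ^ 2 := by
  obtain ⟨F, F₁, G, hf, hg, hF, hF₁, h0, hπ, hG, hc₁, hc⟩ := h.exists_regular
  have hi₁ := hc₁.intervalIntegrable_of_Icc (μ := volume) pi_pos.le
  rw [inner_mu0pi hf hg, integral_mul_eq_energy hσ hF hF₁ h0 hπ hG hc₁ hc,
    ← real_inner_self_eq_norm_sq, inner_mu0pi hf hf]
  have h1 := mul_eq_add_integral hi₁ hi₁ hF hF π (right_mem_Icc.2 pi_pos.le)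
  have hi2 : IntervalIntegrable (fun s => F₁ s ^ 2) volume 0 π :=
    (hc₁.pow 2).intervalIntegrable_of_Icc pi_pos.le
  have hiF : IntervalIntegrable (fun s => F s * F s) volume 0 π :=
    (hc.mul hc).intervalIntegrable_of_Icc pi_pos.le
  have hiFF : IntervalIntegrable (fun s => F₁ s * F s + F s * F₁ s) volume 0 π :=
    ((hc₁.mul hc).add (hc.mul hc₁)).intervalIntegrable_of_Icc pi_pos.le
  have h2 : 0 ≤ ∫ s in (0 : ℝ)..π, (F₁ s + k * F s) ^ 2 :=
    intervalIntegral.integral_nonneg pi_pos.le fun s _ => sq_nonneg _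
  have e : ∀ s, (F₁ s + k * F s) ^ 2 =
      F₁ s ^ 2 + k * (F₁ s * F s + F s * F₁ s) + k ^ 2 * (F s * F s) := fun s => by ring
  simp only [e] at h2
  rw [intervalIntegral.integral_add (hi2.add (hiFF.const_mul _)) (hiF.const_mul _),
    intervalIntegral.integral_add hi2 (hiFF.const_mul _), intervalIntegral.integral_const_mul,
    intervalIntegral.integral_const_mul] at h2
  rw [hπ, zero_mul] at h1
  rw [mul_assoc]
  refine mul_le_mul_of_nonneg_left ?_ hσ.le
  linear_combination h2 - k * h1

end Dissipativity

section Resolvent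

lemma exists_heatGen_resolvent {σ k μ : ℝ} (hσ : 0 < σ) (hk : 0 ≤ k) (hμ : σ * k ^ 2 < μ)
    (h : Lp ℝ 2 mu0pi) : ∃ f, HeatGen σ k f (μ • f - h) ∧ (0 ≤ h → 0 ≤ f) := by
  obtain ⟨a, ha, rfl⟩ : ∃ a, k < a ∧ μ = σ * a ^ 2 := by
    have h1 : k ^ 2 < μ / σ := by rw [lt_div_iff₀ hσ]; linarith
    refine ⟨√(μ / σ), Real.lt_sqrt_of_sq_lt h1, ?_⟩
    rw [Real.sq_sqrt ((sq_nonneg k).trans h1.le)]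
    field_simp
  have ha0 : 0 < a := hk.trans_lt ha
  let p : ℝ → ℝ := fun x => sinh (a * (π - x))
  let p₁ : ℝ → ℝ := fun x => -(a * cosh (a * (π - x)))
  let q : ℝ → ℝ := fun x => a * cosh (a * x) - k * sinh (a * x)
  let q₁ : ℝ → ℝ := fun x => a * (a * sinh (a * x) - k * cosh (a * x))
  have hp : ∀ x, HasDerivAt p (p₁ x) x := fun x => by
    have h1 : HasDerivAt (fun x => a * (π - x)) (a * -1) x :=
      ((hasDerivAt_id x).const_sub π).const_mul a
    refine h1.sinh.congr_deriv ?_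
    simp only [p₁]; ring
  have hp₁ : ∀ x, HasDerivAt p₁ (a ^ 2 * p x) x := fun x => by
    have h1 : HasDerivAt (fun x => a * (π - x)) (a * -1) x :=
      ((hasDerivAt_id x).const_sub π).const_mul a
    refine (h1.cosh.const_mul a).neg.congr_deriv ?_
    simp only [p]; ring
  have hlin : ∀ x, HasDerivAt (fun x => a * x) a x := fun x => by
    simpa using (hasDerivAt_id x).const_mul a
  have hq : ∀ x, HasDerivAt q (q₁ x) x := fun x => by
    refine (((hlin x).cosh.const_mul a).sub ((hlin x).sinh.const_mul k)).congr_deriv ?_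
    simp only [q₁]; ring
  have hq₁ : ∀ x, HasDerivAt q₁ (a ^ 2 * q x) x := fun x => by
    refine HasDerivAt.congr_deriv
      ((((hlin x).sinh.const_mul a).sub ((hlin x).cosh.const_mul k)).const_mul a) ?_
    simp only [q]; ring
  have hpc : Continuous p := by fun_prop
  have hp₁c : Continuous p₁ := by fun_prop
  have hqc : Continuous q := by fun_prop
  have hq₁c : Continuous q₁ := by fun_prop
  have hsc : ∀ x, sinh x < cosh x := Real.sinh_lt_cosh
  have hq_pos : ∀ x, 0 ≤ x → 0 < q x := fun x hx => by
    have h1 : 0 ≤ sinh (a * x) := Real.sinh_nonneg_iff.2 (by positivity)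
    have h2 := hsc (a * x)
    simp only [q]
    nlinarith
  have hp_nonneg : ∀ x ∈ Icc 0 π, 0 ≤ p x := fun x hx =>
    Real.sinh_nonneg_iff.2 (mul_nonneg ha0.le (by linarith [hx.2]))
  -- the Wronskian
  let W : ℝ := a * q π
  have hW : 0 < W := mul_pos ha0 (hq_pos π pi_pos.le)
  have hWr : ∀ x, q₁ x * p x - q x * p₁ x = W := fun x => by
    have e : a * π = a * x + a * (π - x) := by ring
    simp only [W, q, q₁, p, p₁]
    rw [e, Real.cosh_add, Real.sinh_add]
    ring
  have hh := Lp.intervalIntegrable_mu0pi h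
  have hqh : IntervalIntegrable (fun s => q s * h s) volume 0 π :=
    hh.continuousOn_mul hqc.continuousOn
  have hph : IntervalIntegrable (fun s => p s * h s) volume 0 π :=
    hh.continuousOn_mul hpc.continuousOn
  let P : ℝ → ℝ := fun x => ∫ s in (0 : ℝ)..x, q s * h s
  let Q : ℝ → ℝ := fun x => (∫ s in (0 : ℝ)..π, p s * h s) - ∫ s in (0 : ℝ)..x, p s * h s
  have hP0 : P 0 = 0 := by simp [P]
  have hP : ∀ x ∈ Icc 0 π, P x = P 0 + ∫ s in (0 : ℝ)..x, q s * h s := fun x _ => by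
    rw [hP0, zero_add]
  have hQ : ∀ x ∈ Icc 0 π, Q x = Q 0 + ∫ s in (0 : ℝ)..x, -(p s * h s) := fun x _ => by
    simp [Q, sub_eq_add_neg]
  have hPc := continuousOn_of_eq_add_integral hqh pi_pos.le hP
  have hQc := continuousOn_of_eq_add_integral hph.neg pi_pos.le hQ
  let C : ℝ := (σ * W)⁻¹
  let u : ℝ → ℝ := fun x => C * (p x * P x + q x * Q x)
  let u₁ : ℝ → ℝ := fun x => C * (p₁ x * P x + q₁ x * Q x)
  have hprod : ∀ {v v' w w' : ℝ → ℝ}, (∀ x, HasDerivAt v (v' x) x) → Continuous v' →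
      (∀ x, HasDerivAt w (w' x) x) → Continuous w' → ∀ x ∈ Icc 0 π,
      C * (v x * P x + w x * Q x) = C * (v 0 * P 0 + w 0 * Q 0) + ∫ s in (0 : ℝ)..x,
        C * (v' s * P s + w' s * Q s + (v s * q s - w s * p s) * h s) := by
    intro v v' w w' hv hv' hw hw' x hx
    have hvc : Continuous v := continuous_iff_continuousAt.2 fun x => (hv x).continuousAt
    have hwc : Continuous w := continuous_iff_continuousAt.2 fun x => (hw x).continuousAt
    have h1 := mul_eq_add_integral (hv'.intervalIntegrable 0 π) hqh
      (fun x _ => eq_add_integral_of_hasDerivAt hv hv' x) hP x hx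
    have h2 := mul_eq_add_integral (hw'.intervalIntegrable 0 π) hph.neg
      (fun x _ => eq_add_integral_of_hasDerivAt hw hw' x) hQ x hx
    have i1 : IntervalIntegrable (fun s => v' s * P s + v s * (q s * h s)) volume 0 π :=
      ((hv'.continuousOn.mul hPc).intervalIntegrable_of_Icc pi_pos.le).add
        (hqh.continuousOn_mul hvc.continuousOn)
    have i2 : IntervalIntegrable (fun s => w' s * Q s + w s * -(p s * h s)) volume 0 π :=
      ((hw'.continuousOn.mul hQc).intervalIntegrable_of_Icc pi_pos.le).add
        (hph.neg.continuousOn_mul hwc.continuousOn)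
    rw [h1, h2]
    have h3 := intervalIntegral.integral_add (i1.mono_zero_pi hx) (i2.mono_zero_pi hx)
    rw [intervalIntegral.integral_const_mul]
    have e : ∀ s, v' s * P s + w' s * Q s + (v s * q s - w s * p s) * h s =
      (v' s * P s + v s * (q s * h s)) + (w' s * Q s + w s * -(p s * h s)) := fun s => by ring
    simp only [e]
    rw [h3]
    simp only [Pi.neg_apply]
    ring
  have huc : ContinuousOn u (Icc 0 π) :=
    continuousOn_const.mul ((hpc.continuousOn.mul hPc).add (hqc.continuousOn.mul hQc))
  have hmem := memLp_mu0pi_of_continuousOn huc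
  refine ⟨hmem.toLp u, ⟨u, u₁, fun x => σ * a ^ 2 * u x - h x, hmem.coeFn_toLp, ?_, ?_, ?_, ?_, ?_⟩,
    fun hh0 => ?_⟩
  · filter_upwards [Lp.coeFn_sub ((σ * a ^ 2) • hmem.toLp u) h,
      Lp.coeFn_smul (σ * a ^ 2) (hmem.toLp u), hmem.coeFn_toLp] with x h1 h2 h3
    rw [h1, Pi.sub_apply, h2, Pi.smul_apply, h3, smul_eq_mul]
  · intro x hx
    simp only [u, u₁]
    rw [hprod hp hp₁c hq hq₁c x hx]
    congr 1
    refine intervalIntegral.integral_congr fun s _ => ?_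
    ring
  · intro x hx
    simp only [u, u₁]
    rw [hprod hp₁ (hpc.const_mul _) hq₁ (hqc.const_mul _) x hx]
    congr 1
    refine intervalIntegral.integral_congr fun s _ => ?_
    have h1 : p₁ s * q s - q₁ s * p s = -W := by rw [← hWr s]; ring
    rw [h1]
    simp only [C]
    field_simp
    ring
  · simp only [u, u₁, hP0, q, q₁]
    simp
    ring
  · simp [u, p, Q]
  · rw [← Lp.coeFn_nonneg] at hh0 ⊢
    have hae : ∀ {v : ℝ → ℝ}, (∀ x ∈ Icc 0 π, 0 ≤ v x) →
        ∀ᵐ x ∂volume.restrict (Icc 0 π), 0 ≤ v x * h x := by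
      intro v hv
      filter_upwards [hh0, ae_restrict_mem measurableSet_Icc] with x h1 h2
      exact mul_nonneg (hv x h2) h1
    have hint : ∀ {v : ℝ → ℝ}, (∀ x ∈ Icc 0 π, 0 ≤ v x) → ∀ y ∈ Icc 0 π, ∀ z ∈ Icc 0 π, y ≤ z →
        0 ≤ ∫ s in y..z, v s * h s := by
      intro v hv y hy z hz hyz
      refine intervalIntegral.integral_nonneg_of_ae_restrict hyz ?_
      exact ae_restrict_of_ae_restrict_of_subset (Icc_subset_Icc hy.1 hz.2) (hae hv)
    filter_upwards [hmem.coeFn_toLp, ae_restrict_mem measurableSet_Icc] with x h1 hx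
    rw [h1]
    have hPx : 0 ≤ P x :=
      hint (fun x hx => (hq_pos x hx.1).le) 0 (left_mem_Icc.2 pi_pos.le) x hx hx.1
    have hQx : 0 ≤ Q x := by
      have h2 : Q x = ∫ s in x..π, p s * h s := by
        simp only [Q]
        exact intervalIntegral.integral_interval_sub_left hph (hph.mono_zero_pi hx)
      rw [h2]
      exact hint hp_nonneg x hx π (right_mem_Icc.2 pi_pos.le) hx.2
    have hC : 0 < C := inv_pos.2 (mul_pos hσ hW)
    exact mul_nonneg hC.le (add_nonneg (mul_nonneg (hp_nonneg x hx) hPx)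
      (mul_nonneg (hq_pos x hx.1).le hQx))

end Resolvent

section Eigenvector

lemma exists_heatGen_eigenvector_of_smooth {σ k c : ℝ} (hσ : 0 < σ) {F F₁ : ℝ → ℝ}
    (hF : ∀ x, HasDerivAt F (F₁ x) x) (hF₁ : ∀ x, HasDerivAt F₁ (c * F x) x)
    (h0 : F₁ 0 + k * F 0 = 0) (hπ : F π = 0) (hne : F 0 ≠ 0) :
    ∃ f : Lp ℝ 2 mu0pi, f ≠ 0 ∧ HeatGen σ k f ((σ * c) • f) := by
  have hc : Continuous F := continuous_iff_continuousAt.2 fun x => (hF x).continuousAt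
  have hc₁ : Continuous F₁ := continuous_iff_continuousAt.2 fun x => (hF₁ x).continuousAt
  have hmem := memLp_mu0pi_of_continuousOn hc.continuousOn
  refine ⟨hmem.toLp F, fun hf => hne ?_, F, F₁, fun x => σ * c * F x, hmem.coeFn_toLp, ?_,
    fun x _ => eq_add_integral_of_hasDerivAt hF hc₁ x, fun x _ => ?_, h0, hπ⟩
  · have h1 : F =ᵐ[volume.restrict (Icc 0 π)] fun _ => (0 : ℝ) := by
      have h2 := hmem.coeFn_toLp
      rw [hf] at h2
      exact h2.symm.trans (Lp.coeFn_zero ℝ 2 mu0pi)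
    exact Measure.eqOn_Icc_of_ae_eq volume pi_pos.ne h1 hc.continuousOn continuousOn_const
      (left_mem_Icc.2 pi_pos.le)
  · filter_upwards [Lp.coeFn_smul (σ * c) (hmem.toLp F), hmem.coeFn_toLp] with x h1 h2
    rw [h1, Pi.smul_apply, h2, smul_eq_mul]
  · rw [eq_add_integral_of_hasDerivAt hF₁ (hc.const_mul c) x]
    congr 1
    refine intervalIntegral.integral_congr fun s _ => ?_
    field_simp

lemma exists_mul_cosh_eq_mul_sinh {k : ℝ} (hk : 1 / π < k) :
    ∃ a, 0 < a ∧ a * cosh (a * π) = k * sinh (a * π) := by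
  have hk0 : 0 < k := (one_div_pos.2 pi_pos).trans hk
  have hkπ : 1 < k * π := by rwa [div_lt_iff₀ pi_pos] at hk
  have hlog := Real.log_pos hkπ
  set b := √(log (k * π)) / π with hb
  have hb0 : 0 < b := div_pos (Real.sqrt_pos.2 hlog) pi_pos
  have hbπ : (b * π) ^ 2 = log (k * π) := by
    rw [hb, div_mul_cancel₀ _ pi_pos.ne', Real.sq_sqrt hlog.le]
  have h1 : 0 ≤ k * sinh (b * π) - b * cosh (b * π) := by
    have h2 : cosh (b * π) ≤ k * π := by
      refine (Real.cosh_le_exp_half_sq _).trans ?_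
      rw [hbπ, ← Real.exp_log (zero_lt_one.trans hkπ), Real.log_exp, Real.exp_le_exp]
      linarith
    have h3 : b * π ≤ sinh (b * π) := Real.self_le_sinh_iff.2 (by positivity)
    have h4 := mul_le_mul_of_nonneg_left h2 hb0.le
    have h5 := mul_le_mul_of_nonneg_left h3 hk0.le
    linarith
  have h2 : k * sinh (k * π) - k * cosh (k * π) ≤ 0 := by
    rw [← mul_sub]
    exact mul_nonpos_of_nonneg_of_nonpos hk0.le (sub_nonpos.2 (Real.sinh_lt_cosh _).le)
  have hc : Continuous fun a : ℝ => k * sinh (a * π) - a * cosh (a * π) := by fun_prop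
  obtain ⟨a, ha, ha'⟩ := intermediate_value_uIcc hc.continuousOn
    (show (0 : ℝ) ∈ uIcc (k * sinh (k * π) - k * cosh (k * π))
      (k * sinh (b * π) - b * cosh (b * π)) from mem_uIcc_of_le h2 h1)
  refine ⟨a, lt_of_lt_of_le (lt_min hk0 hb0) ha.1, ?_⟩
  exact (sub_eq_zero.1 ha').symm

/-- If `k ≥ 1/π`, the operator has a nonnegative eigenvalue. -/
lemma exists_heatGen_eigenvector {σ k : ℝ} (hσ : 0 < σ) (hk : 1 / π ≤ k) :
    ∃ μ : ℝ, 0 ≤ μ ∧ ∃ f : Lp ℝ 2 mu0pi, f ≠ 0 ∧ HeatGen σ k f (μ • f) := by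
  rcases hk.eq_or_lt with rfl | hk
  · refine ⟨σ * 0, by simp, exists_heatGen_eigenvector_of_smooth hσ (F := fun x => π - x)
      (F₁ := fun _ => -1) (fun x => (hasDerivAt_id x).const_sub π) (fun x => ?_) ?_ ?_ ?_⟩
    · simpa using hasDerivAt_const x (-1 : ℝ)
    · simp [pi_pos.ne']
    · simp
    · simp [pi_pos.ne']
  · obtain ⟨a, ha, haπ⟩ := exists_mul_cosh_eq_mul_sinh hk
    have hlin : ∀ x, HasDerivAt (fun x => a * (π - x)) (a * -1) x := fun x =>
      ((hasDerivAt_id x).const_sub π).const_mul a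
    refine ⟨σ * a ^ 2, by positivity, exists_heatGen_eigenvector_of_smooth hσ
      (F := fun x => sinh (a * (π - x))) (F₁ := fun x => -(a * cosh (a * (π - x))))
      (fun x => (hlin x).sinh.congr_deriv (by ring))
      (fun x => ((hlin x).cosh.const_mul a).neg.congr_deriv (by ring)) ?_ ?_ ?_⟩
    · simp [haπ]
    · simp
    · simp [ha.ne', pi_pos.ne']

/-- A semigroup acts on an eigenvector of its generator by the scalar exponential. -/
lemma semigroup_apply_eigenvector {E : Type*} [NormedAddCommGroup E] [NormedSpace ℝ E]
    {T : ℝ → E →L[ℝ] E} (h0 : T 0 = 1)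
    (hadd : ∀ t s, 0 ≤ t → 0 ≤ s → T (t + s) = (T t).comp (T s)) {f : E}
    (hcont : ContinuousOn (fun t => T t f) (Ici 0)) {μ : ℝ}
    (hgen : Tendsto (fun t : ℝ => t⁻¹ • (T t f - f)) (nhdsWithin 0 (Ioi 0)) (nhds (μ • f)))
    {t : ℝ} (ht : 0 ≤ t) : T t f = Real.exp (μ * t) • f := by
  have hd0 : HasDerivWithinAt (fun s => T s f) (μ • f) (Ici 0) 0 := by
    rw [← hasDerivWithinAt_Ioi_iff_Ici, hasDerivWithinAt_iff_tendsto_slope' self_notMem_Ioi]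
    refine hgen.congr fun s => ?_
    simp [slope, h0]
  have hd : ∀ x, 0 ≤ x → HasDerivWithinAt (fun s => T s f) (μ • T x f) (Ici x) x := by
    intro x hx
    have h1 : HasDerivWithinAt (fun s => T x (T (s - x) f)) (T x (μ • f)) (Ici x) x := by
      have h2 : HasDerivWithinAt (fun s => T (s - x) f) (μ • f) (Ici x) x := by
        have h3 : HasDerivWithinAt (fun s => s - x) 1 (Ici x) x :=
          ((hasDerivAt_id x).sub_const x).hasDerivWithinAt
        have h4 := HasDerivWithinAt.scomp_of_eq (t' := Ici 0) x hd0 h3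
          (fun s hs => mem_Ici.2 (sub_nonneg.2 hs)) (sub_self x).symm
        simpa [Function.comp_def] using h4
      exact (T x).hasFDerivAt.comp_hasDerivWithinAt x h2
    rw [map_smul] at h1
    refine h1.congr_of_mem (fun s hs => ?_) self_mem_Ici
    have := hadd x (s - x) hx (sub_nonneg.2 hs)
    rw [add_sub_cancel] at this
    rw [this]
    rfl
  have hexp : ∀ x, HasDerivAt (fun s => Real.exp (-μ * s)) (Real.exp (-μ * x) * -μ) x := fun x => by
    simpa using ((hasDerivAt_id x).const_mul (-μ)).exp
  have h1 := constant_of_has_deriv_right_zero (f := fun s => Real.exp (-μ * s) • T s f)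
    (a := 0) (b := t)
    (ContinuousOn.smul (by fun_prop) (hcont.mono Icc_subset_Ici_self)) (fun x hx => by
      refine ((hexp x).hasDerivWithinAt.smul (hd x hx.1)).congr_deriv ?_
      module) t (right_mem_Icc.2 ht)
  simp only [mul_zero, Real.exp_zero, h0, one_smul, one_apply_eq_self] at h1
  have h2 := congrArg (fun v => Real.exp (μ * t) • v) h1
  simp only [smul_smul, ← Real.exp_add] at h2
  simpa using h2

end Eigenvector

section Rescaling

lemma Lp.posSMulMono_mu0pi : PosSMulMono ℝ (Lp ℝ 2 mu0pi) := by
  refine PosSMulMono.of_smul_nonneg fun c hc f hf => ?_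
  rw [← Lp.coeFn_nonneg] at hf ⊢
  filter_upwards [Lp.coeFn_smul c f, hf] with x h1 h2
  rw [h1]
  exact mul_nonneg hc h2

/-- The quotient of the rescaled semigroup `e^{ωt} T(t)` converges iff that of `T` does. -/
lemma tendsto_quotient_exp_smul_iff {E : Type*} [NormedAddCommGroup E] [NormedSpace ℝ E]
    {u : ℝ → E} {f g : E} (hu : Tendsto u (nhdsWithin 0 (Ioi 0)) (nhds f)) (ω : ℝ) :
    Tendsto (fun t : ℝ => t⁻¹ • (Real.exp (ω * t) • u t - f)) (nhdsWithin 0 (Ioi 0)) (nhds g) ↔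
      Tendsto (fun t : ℝ => t⁻¹ • (u t - f)) (nhdsWithin 0 (Ioi 0)) (nhds (g - ω • f)) := by
  have h1 : Tendsto (fun t : ℝ => t⁻¹ * (Real.exp (ω * t) - 1)) (nhdsWithin 0 (Ioi 0))
      (nhds ω) := by
    have h2 : HasDerivAt (fun t => Real.exp (ω * t)) ω 0 := by
      simpa using ((hasDerivAt_id (0 : ℝ)).const_mul ω).exp
    simpa using h2.tendsto_slope_zero_right
  have h2 := h1.smul hu
  have e : ∀ t : ℝ, t⁻¹ • (Real.exp (ω * t) • u t - f) =
      t⁻¹ • (u t - f) + (t⁻¹ * (Real.exp (ω * t) - 1)) • u t := fun t => by module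
  constructor <;> intro h
  · refine (h.sub h2).congr fun t => ?_
    rw [e, add_sub_cancel_right]
  · have h3 := h.add h2
    rw [sub_add_cancel] at h3
    exact h3.congr fun t => (e t).symm

end Rescaling

/-- The operator `𝒜 = σ d²/dx²` on `L²(0,π)` with Robin–Dirichlet
domain `{f ∈ H²(0,π) : f'(0) + k f(0) = 0, f(π) = 0}`, `σ > 0`, `k ≥ 0`,
generates a positive C₀-semigroup, which is uniformly exponentially stable if
and only if `k < 1/π` (equivalently `r(M D₀) = k π < 1`). -/
theorem heat_robin_dirichlet_positive_and_stable_iff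
    (σ k : ℝ) (hσ : 0 < σ) (hk : 0 ≤ k) :
    ∃ T : ℝ → Lp ℝ 2 mu0pi →L[ℝ] Lp ℝ 2 mu0pi,
      -- C₀-semigroup:
      T 0 = 1 ∧ (∀ t s : ℝ, 0 ≤ t → 0 ≤ s → T (t + s) = (T t).comp (T s)) ∧
      (∀ f : Lp ℝ 2 mu0pi, ContinuousOn (fun t => T t f) (Ici (0 : ℝ))) ∧
      -- `𝒜` is the generator:
      (∀ f g : Lp ℝ 2 mu0pi,
        Tendsto (fun t : ℝ => t⁻¹ • (T t f - f)) (nhdsWithin 0 (Ioi 0)) (nhds g) ↔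
          HeatGen σ k f g) ∧
      -- positivity:
      (∀ t : ℝ, 0 ≤ t → ∀ f : Lp ℝ 2 mu0pi, 0 ≤ f → 0 ≤ T t f) ∧
      -- uniform exponential stability iff `k π < 1`:
      ((∃ M ω : ℝ, 0 < M ∧ ω < 0 ∧ ∀ t : ℝ, 0 ≤ t → ‖T t‖ ≤ M * Real.exp (ω * t)) ↔
        k < 1 / π) := by
  obtain ⟨ω, hω, hωneg, hdis⟩ : ∃ ω : ℝ, ω ≤ σ * k ^ 2 ∧ (k < 1 / π → ω < 0) ∧
      ∀ f g : Lp ℝ 2 mu0pi, HeatGen σ k f g → inner ℝ g f ≤ ω * ‖f‖ ^ 2 := by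
    by_cases hkπ : k < 1 / π
    · have h1 : 0 < 1 - k * π := by rw [lt_div_iff₀ pi_pos] at hkπ; linarith
      have h2 : 0 < σ * (1 - k * π) / π ^ 2 := by positivity
      have h3 : 0 ≤ σ * k ^ 2 := by positivity
      exact ⟨-(σ * (1 - k * π) / π ^ 2), by linarith, fun _ => by linarith,
        fun f g h => h.inner_le_of_lt hσ hk hkπ⟩
    · exact ⟨σ * k ^ 2, le_rfl, fun h => absurd h hkπ, fun f g h => h.inner_le hσ⟩
  have := Lp.posSMulMono_mu0pi
  obtain ⟨S, hS0, hSadd, hScont, hSnorm, hSgen, hSpos⟩ :=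
    exists_contraction_semigroup_of_dissipative (heatGraph σ k ω)
      (fun f g h => by
        have h1 := hdis f _ (mem_heatGraph.1 h)
        rw [inner_add_left, real_inner_smul_left, real_inner_self_eq_norm_sq] at h1
        linarith)
      (fun g h => by
        have h1 := mem_heatGraph.1 h
        rw [smul_zero, add_zero] at h1
        exact h1.eq_zero hσ)
      (σ * k ^ 2 - ω) (sub_nonneg.2 hω) (PointedCone.positive ℝ (Lp ℝ 2 mu0pi))
      (isClosed_Ici (a := (0 : Lp ℝ 2 mu0pi)))
      (fun l hl h => by
        obtain ⟨f, h1, h2⟩ := exists_heatGen_resolvent hσ hk (sub_lt_iff_lt_add.1 hl) h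
        refine ⟨f, mem_heatGraph.2 ?_, h2⟩
        convert h1 using 1
        module)
  let T : ℝ → Lp ℝ 2 mu0pi →L[ℝ] Lp ℝ 2 mu0pi := fun t => Real.exp (ω * t) • S t
  have hT0 : T 0 = 1 := by simp [T, hS0]
  have hTadd : ∀ t s : ℝ, 0 ≤ t → 0 ≤ s → T (t + s) = (T t).comp (T s) := fun t s ht hs => by
    simp only [T]
    rw [hSadd t s ht hs, mul_add, Real.exp_add, ContinuousLinearMap.smul_comp,
      ContinuousLinearMap.comp_smul, smul_smul]
  have hTcont : ∀ f, ContinuousOn (fun t => T t f) (Ici 0) := fun f =>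
    ContinuousOn.smul (f := fun t => Real.exp (ω * t)) (by fun_prop) (hScont f)
  have hTgen : ∀ f g : Lp ℝ 2 mu0pi,
      Tendsto (fun t : ℝ => t⁻¹ • (T t f - f)) (nhdsWithin 0 (Ioi 0)) (nhds g) ↔
        HeatGen σ k f g := fun f g => by
    have h1 : Tendsto (fun t => S t f) (nhdsWithin 0 (Ioi 0)) (nhds f) := by
      have h2 := (hScont f 0 self_mem_Ici).mono Ioi_subset_Ici_self
      rwa [ContinuousWithinAt, hS0] at h2
    refine (tendsto_quotient_exp_smul_iff h1 ω).trans ?_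
    rw [hSgen, mem_heatGraph, sub_add_cancel]
  refine ⟨T, hT0, hTadd, hTcont, hTgen, fun t ht f hf =>
    smul_nonneg (Real.exp_nonneg _) (hSpos t ht f hf), fun ⟨M, w, hM, hw, h⟩ => ?_, fun hkπ => ?_⟩
  · by_contra! hkπ
    obtain ⟨μ, hμ, f, hf, hfμ⟩ := exists_heatGen_eigenvector hσ hkπ
    have hle : ∀ t, 0 ≤ t → 1 ≤ M * Real.exp (w * t) := fun t ht => by
      have h1 := ((T t).le_opNorm f).trans (mul_le_mul_of_nonneg_right (h t ht) (norm_nonneg f))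
      rw [semigroup_apply_eigenvector hT0 hTadd (hTcont f) ((hTgen f _).2 hfμ) ht, norm_smul,
        Real.norm_of_nonneg (Real.exp_nonneg _)] at h1
      exact (Real.one_le_exp (by positivity)).trans (le_of_mul_le_mul_right h1 (norm_pos_iff.2 hf))
    have hlim : Tendsto (fun t => M * Real.exp (w * t)) atTop (nhds (M * 0)) :=
      (Real.tendsto_exp_atBot.comp (tendsto_id.const_mul_atTop_of_neg hw)).const_mul M
    have h1 := ge_of_tendsto hlim ((eventually_ge_atTop 0).mono hle)
    linarith
  · refine ⟨1, ω, one_pos, hωneg hkπ, fun t ht => ?_⟩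
    rw [one_mul, norm_smul, Real.norm_of_nonneg (Real.exp_nonneg _)]
    refine mul_le_of_le_one_right (Real.exp_nonneg _) ?_
    exact (S t).opNorm_le_bound zero_le_one fun f => by simpa using hSnorm t ht f
end

section
/- Let D = diag(d_i) with d_i > 0 and K ∈ ℝ_+^{n×n} a nonnegative matrix. The semigroup on L²([0,1], ℝⁿ) solving the hyperbolic system ∂_t y + D ∂_x y = 0, y(0,t) = K y(1,t) is positive, and it is uniformly exponentially stable if and only if the spectral radius r(K) < 1. -/
open Filter MeasureTheory Set

/-- Lebesgue measure on `[0,1]`. -/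
noncomputable def mu01 : Measure ℝ := volume.restrict (Icc (0 : ℝ) 1)

/-- `HypGen d K f g` says `f ∈ D(Q_r^{cl})` and `Q_r^{cl} f = g` for the
closed-loop operator `Q_r^{cl} = -D d/dx` on `(L²[0,1])ⁿ` with domain
`{f ∈ (H¹[0,1])ⁿ : f(0) = K f(1)}`. -/
def HypGen {n : ℕ} (d : Fin n → ℝ) (K : Matrix (Fin n) (Fin n) ℝ)
    (f g : Lp (α := ℝ) (Fin n → ℝ) 2 mu01) : Prop :=
  ∃ F G : ℝ → Fin n → ℝ, (f : ℝ → Fin n → ℝ) =ᵐ[mu01] F ∧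
    (g : ℝ → Fin n → ℝ) =ᵐ[mu01] G ∧
    (∀ i : Fin n, ∀ x ∈ Icc (0 : ℝ) 1,
      F x i = F 0 i + ∫ s in (0 : ℝ)..x, -(d i)⁻¹ * G s i) ∧
    (∀ i : Fin n, F 0 i = ∑ j : Fin n, K i j * F 1 j)

section MatrixLemmas

attribute [local instance] Matrix.linftyOpNormedRing Matrix.linftyOpNormedAlgebra

/-- Powers of an element of spectral radius less than one tend to zero. -/
theorem tendsto_pow_zero_of_spectrum_lt_one {A : Type*} [NormedRing A] [NormedAlgebra ℂ A]
    [CompleteSpace A] [Nontrivial A] (a : A) (ha : ∀ μ ∈ spectrum ℂ a, ‖μ‖ < 1) :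
    Tendsto (fun k : ℕ => a ^ k) atTop (nhds 0) := by
  have h1 : spectralRadius ℂ a < ((1 : NNReal) : ENNReal) :=
    spectrum.spectralRadius_lt_of_forall_lt a (fun μ hμ => by
      have := ha μ hμ
      exact_mod_cast this)
  obtain ⟨r, hr1, hr2⟩ := ENNReal.lt_iff_exists_nnreal_btwn.1 h1
  have hr2' : r < 1 := by exact_mod_cast hr2
  have h2 := (spectrum.pow_nnnorm_pow_one_div_tendsto_nhds_spectralRadius a).eventually_lt_const hr1
  have h3 : ∀ᶠ k : ℕ in atTop, ‖a ^ k‖ ≤ (r : ℝ) ^ k := by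
    filter_upwards [h2, eventually_gt_atTop 0] with k hk hk0
    have hk' : (0 : ℝ) < k := by exact_mod_cast hk0
    rw [one_div, ENNReal.rpow_inv_lt_iff hk', ENNReal.rpow_natCast] at hk
    have : ‖a ^ k‖₊ < r ^ k := by exact_mod_cast hk
    exact_mod_cast this.le
  exact squeeze_zero_norm' h3 (tendsto_pow_atTop_nhds_zero_of_lt_one r.2 hr2')

/-- If all eigenvalues of a real matrix lie in the open unit disc, some power has small entries. -/
theorem exists_pow_entries_le {n : ℕ} (K : Matrix (Fin n) (Fin n) ℝ)
    (h : ∀ μ ∈ spectrum ℂ (K.map (fun x : ℝ => (x : ℂ))), ‖μ‖ < 1) {ε : ℝ} (hε : 0 < ε) :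
    ∃ m : ℕ, ∀ i j, (K ^ m) i j ≤ ε := by
  rcases Nat.eq_zero_or_pos n with rfl | hn
  · exact ⟨0, fun i => i.elim0⟩
  have : Nonempty (Fin n) := ⟨⟨0, hn⟩⟩
  have ht := tendsto_pow_zero_of_spectrum_lt_one _ h
  have hev : ∀ᶠ k : ℕ in atTop, ∀ i j, (K ^ k) i j ≤ ε := by
    rw [eventually_all]; intro i
    rw [eventually_all]; intro j
    have hc : Continuous (fun M : Matrix (Fin n) (Fin n) ℂ => M i j) :=
      (continuous_apply j).comp (continuous_apply i)
    have h1 := (hc.tendsto 0).comp ht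
    have h2 : Tendsto (fun k : ℕ => ‖((K.map (fun x : ℝ => (x : ℂ))) ^ k) i j‖) atTop (nhds 0) := by
      simpa using h1.norm
    filter_upwards [h2.eventually_lt_const hε] with k hk
    have hp : (K.map (fun x : ℝ => (x : ℂ))) ^ k = (K ^ k).map (fun x : ℝ => (x : ℂ)) :=
      (Matrix.map_pow K Complex.ofRealHom k).symm
    rw [hp, Matrix.map_apply, Complex.norm_real] at hk
    exact (le_abs_self _).trans hk.le
  exact hev.exists

end MatrixLemmas

/-- A nonnegative matrix with a power of row sums at most `1/2` has a positive strict
subeigenvector. -/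
theorem exists_pos_mulVec_le {n : ℕ} (K : Matrix (Fin n) (Fin n) ℝ) (hK : ∀ i j, 0 ≤ K i j)
    (m : ℕ) (hm : ∀ i, ∑ j, (K ^ m) i j ≤ 1 / 2) :
    ∃ v : Fin n → ℝ, (∀ i, 0 < v i) ∧ ∃ q : ℝ, 0 ≤ q ∧ q < 1 ∧
      ∀ i, ∑ j, K i j * v j ≤ q * v i := by
  have hKp : ∀ k i j, 0 ≤ (K ^ k) i j := by
    intro k
    induction k with
    | zero => intro i j; rw [pow_zero, Matrix.one_apply]; split_ifs <;> norm_num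
    | succ k ih =>
      intro i j
      rw [pow_succ, Matrix.mul_apply]
      exact Finset.sum_nonneg fun l _ => mul_nonneg (ih i l) (hK l j)
  rcases Nat.eq_zero_or_pos m with rfl | hm0
  · refine ⟨fun _ => 1, fun _ => one_pos, 0, le_rfl, one_pos, fun i => ?_⟩
    have := hm i
    simp [Matrix.one_apply] at this
    norm_num at this
  set s : ℕ → Fin n → ℝ := fun k i => ∑ j, (K ^ k) i j with hs
  have hs0 : ∀ k i, 0 ≤ s k i := fun k i => Finset.sum_nonneg fun j _ => hKp k i j
  have hsK : ∀ k i, ∑ j, K i j * s k j = s (k + 1) i := by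
    intro k i
    simp only [hs, pow_succ', Matrix.mul_apply, Finset.mul_sum]
    exact Finset.sum_comm
  have hs00 : ∀ i, s 0 i = 1 := fun i => by simp [hs, Matrix.one_apply]
  set v : Fin n → ℝ := fun i => ∑ k ∈ Finset.range m, s k i with hv
  have hv1 : ∀ i, 1 ≤ v i := by
    intro i
    rw [← hs00 i]
    exact Finset.single_le_sum (f := fun k => s k i) (fun k _ => hs0 k i)
      (Finset.mem_range.2 hm0)
  have hKv : ∀ i, ∑ j, K i j * v j ≤ v i - 1 / 2 := by
    intro i
    have h1 : ∑ j, K i j * v j = ∑ k ∈ Finset.range m, s (k + 1) i := by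
      simp only [hv, Finset.mul_sum]
      rw [Finset.sum_comm]
      exact Finset.sum_congr rfl fun k _ => hsK k i
    have h2 := Finset.sum_range_succ (fun k => s k i) m
    have h3 := Finset.sum_range_succ' (fun k => s k i) m
    have h4 := hm i
    have h5 := hs00 i
    simp only [hv]
    rw [h1]
    have h6 : s m i ≤ 1 / 2 := h4
    linarith
  set W : ℝ := 1 + ∑ i, v i with hW
  have hvW : ∀ i, v i ≤ W := fun i => by
    have := Finset.single_le_sum (f := v) (fun k _ => zero_le_one.trans (hv1 k))
      (Finset.mem_univ i)
    linarith
  have hW1 : 1 ≤ W := by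
    have : 0 ≤ ∑ i, v i := Finset.sum_nonneg fun k _ => zero_le_one.trans (hv1 k)
    linarith
  refine ⟨v, fun i => one_pos.trans_le (hv1 i), 1 - 1 / (2 * W), ?_, ?_, fun i => ?_⟩
  · have : 1 / (2 * W) ≤ 1 := by
      rw [div_le_one (by positivity)]; linarith
    linarith
  · have : 0 < 1 / (2 * W) := by positivity
    linarith
  · refine (hKv i).trans ?_
    have : 1 / (2 * W) * v i ≤ 1 / 2 := by
      rw [div_mul_eq_mul_div, div_le_div_iff₀ (by positivity) (by norm_num)]
      linarith [hvW i]
    linarith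

/-- Diagonal Lyapunov inequality for a nonnegative matrix of spectral radius less than one. -/
theorem exists_diagonal_lyapunov {n : ℕ} (K : Matrix (Fin n) (Fin n) ℝ) (hK : ∀ i j, 0 ≤ K i j)
    (h : ∀ μ ∈ spectrum ℂ (K.map (fun x : ℝ => (x : ℂ))), ‖μ‖ < 1) :
    ∃ P : Fin n → ℝ, (∀ i, 0 < P i) ∧ ∃ q : ℝ, 0 < q ∧ q < 1 ∧
      ∀ y : Fin n → ℝ, ∑ i, P i * (∑ j, K i j * y j) ^ 2 ≤ q * ∑ i, P i * y i ^ 2 := by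
  obtain ⟨m, hm⟩ := exists_pow_entries_le K h (ε := 1 / (2 * (n + 1))) (by positivity)
  have hn : (n : ℝ) * (1 / (2 * (n + 1))) ≤ 1 / 2 := by
    rw [mul_one_div, div_le_div_iff₀ (by positivity) (by norm_num)]
    linarith
  obtain ⟨v, hv, p, hp0, hp1, hvp⟩ := exists_pos_mulVec_le K hK m (fun i => by
    refine (Finset.sum_le_sum fun j _ => hm i j).trans ?_
    simpa using hn)
  obtain ⟨u, hu, r, hr0, hr1, hur⟩ := exists_pos_mulVec_le K.transpose (fun i j => hK j i) m
    (fun i => by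
      rw [← Matrix.transpose_pow]
      refine (Finset.sum_le_sum fun j _ => hm j i).trans ?_
      simpa using hn)
  simp only [Matrix.transpose_apply] at hur
  have key : ∀ y : Fin n → ℝ,
      ∑ i, u i / v i * (∑ j, K i j * y j) ^ 2 ≤ p * r * ∑ i, u i / v i * y i ^ 2 := by
    intro y
    have h1 : ∀ i, u i / v i * (∑ j, K i j * y j) ^ 2
        ≤ p * ∑ j, u i * (K i j * (y j ^ 2 / v j)) := by
      intro i
      have hcs : (∑ j, K i j * y j) ^ 2
          ≤ (∑ j, K i j * v j) * ∑ j, K i j * (y j ^ 2 / v j) := by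
        refine Finset.sum_sq_le_sum_mul_sum_of_sq_le_mul _ (fun j _ => ?_) (fun j _ => ?_)
          (fun j _ => ?_)
        · exact mul_nonneg (hK i j) (hv j).le
        · exact mul_nonneg (hK i j) (div_nonneg (sq_nonneg _) (hv j).le)
        · have := (hv j).ne'
          apply le_of_eq
          field_simp
      have hnn : 0 ≤ ∑ j, K i j * (y j ^ 2 / v j) :=
        Finset.sum_nonneg fun j _ => mul_nonneg (hK i j) (div_nonneg (sq_nonneg _) (hv j).le)
      have h2 : (∑ j, K i j * y j) ^ 2 ≤ p * v i * ∑ j, K i j * (y j ^ 2 / v j) :=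
        hcs.trans (mul_le_mul_of_nonneg_right (hvp i) hnn)
      have h3 := mul_le_mul_of_nonneg_left h2 (div_pos (hu i) (hv i)).le
      refine h3.trans (le_of_eq ?_)
      rw [← Finset.mul_sum]
      have := (hv i).ne'
      field_simp
    calc ∑ i, u i / v i * (∑ j, K i j * y j) ^ 2
        ≤ ∑ i, p * ∑ j, u i * (K i j * (y j ^ 2 / v j)) := Finset.sum_le_sum fun i _ => h1 i
      _ = p * ∑ j, (∑ i, K i j * u i) * (y j ^ 2 / v j) := by
          rw [← Finset.mul_sum, Finset.sum_comm]
          congr 1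
          refine Finset.sum_congr rfl fun j _ => ?_
          rw [Finset.sum_mul]
          exact Finset.sum_congr rfl fun i _ => by ring
      _ ≤ p * ∑ j, (r * u j) * (y j ^ 2 / v j) := by
          refine mul_le_mul_of_nonneg_left (Finset.sum_le_sum fun j _ => ?_) hp0
          exact mul_le_mul_of_nonneg_right (hur j) (div_nonneg (sq_nonneg _) (hv j).le)
      _ = p * r * ∑ i, u i / v i * y i ^ 2 := by
          rw [mul_assoc, Finset.mul_sum (a := r)]
          congr 1
          exact Finset.sum_congr rfl fun j _ => by ring
  refine ⟨fun i => u i / v i, fun i => div_pos (hu i) (hv i), max (p * r) (1 / 2), ?_, ?_,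
    fun y => (key y).trans ?_⟩
  · exact lt_of_lt_of_le (by norm_num) (le_max_right _ _)
  · exact max_lt (by nlinarith) (by norm_num)
  · refine mul_le_mul_of_nonneg_right (le_max_left _ _) (Finset.sum_nonneg fun i _ => ?_)
    exact mul_nonneg (div_pos (hu i) (hv i)).le (sq_nonneg _)

/-- An eigenvalue of modulus at least one yields a nonzero nonnegative vector `a ≤ K a`. -/
theorem exists_nonneg_le_mulVec {n : ℕ} (K : Matrix (Fin n) (Fin n) ℝ) (hK : ∀ i j, 0 ≤ K i j)
    {μ : ℂ} (hμ : μ ∈ spectrum ℂ (K.map (fun x : ℝ => (x : ℂ)))) (h1 : 1 ≤ ‖μ‖) :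
    ∃ a : Fin n → ℝ, a ≠ 0 ∧ (∀ i, 0 ≤ a i) ∧ ∀ i, a i ≤ ∑ j, K i j * a j := by
  rw [← Matrix.spectrum_toLin', ← Module.End.hasEigenvalue_iff_mem_spectrum] at hμ
  obtain ⟨z, hz⟩ := hμ.exists_hasEigenvector
  have hz1 := hz.apply_eq_smul
  refine ⟨fun i => ‖z i‖, fun h0 => hz.2 (funext fun i => ?_), fun i => norm_nonneg _, fun i => ?_⟩
  · simpa using congrFun h0 i
  · have h2 := congrFun hz1 i
    simp only [Matrix.toLin'_apply, Matrix.mulVec, dotProduct, Matrix.map_apply, Pi.smul_apply,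
      smul_eq_mul] at h2
    calc ‖z i‖ ≤ ‖μ‖ * ‖z i‖ := le_mul_of_one_le_left (norm_nonneg _) h1
      _ = ‖∑ j, (K i j : ℂ) * z j‖ := by rw [h2, norm_mul]
      _ ≤ ∑ j, ‖(K i j : ℂ) * z j‖ := norm_sum_le _ _
      _ = ∑ j, K i j * ‖z j‖ := by
          refine Finset.sum_congr rfl fun j _ => ?_
          rw [norm_mul, Complex.norm_real, Real.norm_of_nonneg (hK i j)]

section LocalSemigroup

/-- A local one-parameter semigroup in a monoid extends to a global one. -/
theorem exists_semigroup_of_local {E : Type*} [Monoid E] (S : ℝ → E) {δ : ℝ} (hδ : 0 < δ)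
    (h0 : S 0 = 1) (hadd : ∀ t s, 0 ≤ t → 0 ≤ s → t + s ≤ δ → S (t + s) = S t * S s) :
    ∃ T : ℝ → E, T 0 = 1 ∧ (∀ t s, 0 ≤ t → 0 ≤ s → T (t + s) = T t * T s) ∧
      ∀ t, 0 ≤ t → ∀ N : ℕ, 0 < N → t / N ≤ δ → T t = S (t / N) ^ N := by
  have hpow : ∀ (k : ℕ) (t : ℝ), 0 ≤ t → k * t ≤ δ → S (k * t) = S t ^ k := by
    intro k
    induction k with
    | zero => intro t _ _; simp [h0]
    | succ k ih =>
      intro t ht hk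
      push_cast at hk ⊢
      have hkt : 0 ≤ (k : ℝ) * t := by positivity
      rw [add_mul, one_mul, hadd _ _ hkt ht (by linarith), ih t ht (by linarith), pow_succ]
  have hind : ∀ t, 0 ≤ t → ∀ N M : ℕ, 0 < N → 0 < M → t / N ≤ δ →
      S (t / (N * M : ℕ)) ^ (N * M) = S (t / N) ^ N := by
    intro t ht N M hN hM h
    have hM' : (0 : ℝ) < M := by exact_mod_cast hM
    have hN' : (0 : ℝ) < N := by exact_mod_cast hN
    have e : t / N = M * (t / (N * M : ℕ)) := by push_cast; field_simp
    rw [e, hpow M _ (by positivity) (e ▸ h), ← pow_mul, mul_comm M N]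
  have hex : ∀ t : ℝ, ∃ N : ℕ, 0 < N ∧ t / N ≤ δ := by
    intro t
    obtain ⟨N, hN⟩ := exists_nat_ge (t / δ)
    refine ⟨N + 1, N.succ_pos, ?_⟩
    rw [div_le_iff₀ (by positivity)]
    rw [div_le_iff₀ hδ] at hN
    push_cast
    nlinarith
  choose N hN hNδ using hex
  have hT : ∀ t, 0 ≤ t → ∀ M : ℕ, 0 < M → t / M ≤ δ → S (t / N t) ^ N t = S (t / M) ^ M := by
    intro t ht M hM h
    rw [← hind t ht (N t) M (hN t) hM (hNδ t), ← hind t ht M (N t) hM (hN t) h, mul_comm]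
  refine ⟨fun t => S (t / N t) ^ N t, by simp [h0], fun t s ht hs => ?_, hT⟩
  set M := N (t + s) with hMdef
  have hM' : (0 : ℝ) < M := by exact_mod_cast hN (t + s)
  have hle := hNδ (t + s)
  rw [← hMdef] at hle
  have ht' : 0 ≤ t / M := by positivity
  have hs' : 0 ≤ s / M := by positivity
  rw [add_div] at hle
  have e1 : S (t / M + s / M) = S (t / M) * S (s / M) := hadd _ _ ht' hs' hle
  have e2 : S (s / M + t / M) = S (s / M) * S (t / M) := hadd _ _ hs' ht' (by linarith)
  have hcomm : Commute (S (t / M)) (S (s / M)) := by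
    rw [commute_iff_eq, ← e1, ← e2, add_comm]
  change S ((t + s) / M) ^ M = S (t / N t) ^ N t * S (s / N s) ^ N s
  rw [hT t ht M (hN _) (by linarith), hT s hs M (hN _) (by linarith), add_div, e1,
    hcomm.mul_pow]

/-- Strong right continuity at `0` and an exponential bound give strong continuity. -/
theorem continuousOn_of_semigroup {X : Type*} [NormedAddCommGroup X] [NormedSpace ℝ X]
    (T : ℝ → X →L[ℝ] X) (h0 : T 0 = 1)
    (hadd : ∀ t s, 0 ≤ t → 0 ≤ s → T (t + s) = T t * T s)
    {C ω : ℝ} (hC : 0 ≤ C)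
    (hT : ∀ t, 0 ≤ t → ∀ f, ‖T t f‖ ≤ C * Real.exp (ω * t) * ‖f‖)
    (hlim : ∀ f, Tendsto (fun t => T t f) (nhdsWithin 0 (Ioi 0)) (nhds f)) (f : X) :
    ContinuousOn (fun t => T t f) (Ici 0) := by
  have hlim0 : Tendsto (fun t => T t f) (nhdsWithin 0 (Ici 0)) (nhds f) := by
    rw [← Ioi_insert, nhdsWithin_insert, tendsto_sup]
    refine ⟨?_, hlim f⟩
    have h := tendsto_pure_nhds (fun t => T t f) 0
    simpa [h0] using h
  have hest : ∀ R t s : ℝ, 0 ≤ s → s ≤ t → t ≤ R →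
      ‖T t f - T s f‖ ≤ C * Real.exp (|ω| * R) * ‖T (t - s) f - f‖ := by
    intro R t s hs hst htR
    have e : T t f - T s f = T s (T (t - s) f - f) := by
      have := hadd s (t - s) hs (sub_nonneg.2 hst)
      rw [add_sub_cancel] at this
      rw [this, map_sub]; rfl
    rw [e]
    refine (hT s hs _).trans ?_
    gcongr
    · exact le_abs_self ω
    · linarith
  intro t₀ ht₀
  rw [ContinuousWithinAt, tendsto_iff_norm_sub_tendsto_zero]
  have habs : Tendsto (fun t : ℝ => |t - t₀|) (nhdsWithin t₀ (Ici 0)) (nhdsWithin 0 (Ici 0)) := by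
    refine tendsto_nhdsWithin_iff.2 ⟨?_, Eventually.of_forall fun t => mem_Ici.2 (abs_nonneg _)⟩
    have hc : Continuous (fun t : ℝ => |t - t₀|) := by fun_prop
    have := hc.tendsto t₀
    simp only [sub_self, abs_zero] at this
    exact this.mono_left nhdsWithin_le_nhds
  have h1 := (tendsto_iff_norm_sub_tendsto_zero.1 hlim0).comp habs
  have h2 := h1.const_mul (C * Real.exp (|ω| * (t₀ + 1)))
  rw [mul_zero] at h2
  refine squeeze_zero' (Eventually.of_forall fun t => norm_nonneg _) ?_ h2
  have hev : ∀ᶠ t in nhdsWithin t₀ (Ici 0), t < t₀ + 1 :=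
    nhdsWithin_le_nhds (Iio_mem_nhds (by linarith))
  filter_upwards [hev, self_mem_nhdsWithin] with t ht htpos
  have htpos' : 0 ≤ t := htpos
  have ht₀' : 0 ≤ t₀ := ht₀
  rcases le_total t₀ t with hle | hle
  · simpa [abs_of_nonneg (sub_nonneg.2 hle)] using hest (t₀ + 1) t t₀ ht₀' hle ht.le
  · rw [norm_sub_rev]
    simpa [abs_of_nonpos (sub_nonpos.2 hle)] using
      hest (t₀ + 1) t₀ t htpos' hle (by linarith)

end LocalSemigroup

section Affine

theorem measurePreserving_affine {c : ℝ} (hc : c ≠ 0) (e : ℝ) :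
    MeasurePreserving (fun x : ℝ => e + c * x) volume (ENNReal.ofReal |c⁻¹| • volume) := by
  have h1 : MeasurePreserving (fun x : ℝ => c * x) volume (ENNReal.ofReal |c⁻¹| • volume) :=
    ⟨measurable_const_mul c, Real.map_volume_mul_left hc⟩
  have h2 := (measurePreserving_add_left (volume : Measure ℝ) e).smul_measure
    (ENNReal.ofReal |c⁻¹|)
  exact h2.comp h1

theorem ae_comp_affine {p : ℝ → Prop} (hp : ∀ᵐ x, p x) {c : ℝ} (hc : c ≠ 0) (e : ℝ) :
    ∀ᵐ x : ℝ, p (e + c * x) :=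
  (measurePreserving_affine hc e).quasiMeasurePreserving.ae (Measure.ae_smul_measure hp _)

theorem memLp_comp_affine {h : ℝ → ℝ} {a b a' b' c e : ℝ}
    (hh : MemLp h 2 (volume.restrict (Icc a b))) (hc : c ≠ 0)
    (hmaps : ∀ x ∈ Icc a' b', e + c * x ∈ Icc a b) :
    MemLp (fun x => h (e + c * x)) 2 (volume.restrict (Icc a' b')) := by
  have h1 := (measurePreserving_affine hc e).restrict_preimage (s := Icc a b) measurableSet_Icc
  rw [Measure.restrict_smul] at h1
  have h2 := (hh.smul_measure (c := ENNReal.ofReal |c⁻¹|)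
    ENNReal.ofReal_ne_top).comp_measurePreserving h1
  exact h2.mono_measure (Measure.restrict_mono_set _ hmaps)

theorem memLp_two_intervalIntegrable {h : ℝ → ℝ} {a b a' b' : ℝ}
    (hh : MemLp h 2 (volume.restrict (Icc a b))) (ha : a' ∈ Icc a b) (hb : b' ∈ Icc a b) :
    IntervalIntegrable h volume a' b' := by
  have h1 : IntegrableOn h (Icc a b) := hh.integrable (by norm_num)
  rw [intervalIntegrable_iff]
  exact h1.mono_set (uIoc_subset_uIcc.trans (uIcc_subset_Icc ha hb))

theorem memLp_two_intervalIntegrable_mul_sq {h w : ℝ → ℝ} {a b a' b' : ℝ}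
    (hh : MemLp h 2 (volume.restrict (Icc a b))) (hw : Continuous w)
    (ha : a' ∈ Icc a b) (hb : b' ∈ Icc a b) :
    IntervalIntegrable (fun x => w x * h x ^ 2) volume a' b' := by
  have h1 : IntegrableOn (fun x => h x ^ 2) (Icc a b) := hh.integrable_sq
  have h2 : IntervalIntegrable (fun x => h x ^ 2) volume a' b' := by
    rw [intervalIntegrable_iff]
    exact h1.mono_set (uIoc_subset_uIcc.trans (uIcc_subset_Icc ha hb))
  exact h2.continuousOn_mul hw.continuousOn

end Affine

/-- Extension of the state `f` to the left of `0` through the boundary condition. -/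
noncomputable def inflowExt {n : ℕ} (d : Fin n → ℝ) (K : Matrix (Fin n) (Fin n) ℝ)
    (f : ℝ → Fin n → ℝ) (i : Fin n) (x : ℝ) : ℝ :=
  if 0 ≤ x then f x i else ∑ j, K i j * f (1 + d j / d i * x) j

/-- The solution at a small time `t` with initial state `f`. -/
noncomputable def transport {n : ℕ} (d : Fin n → ℝ) (K : Matrix (Fin n) (Fin n) ℝ) (t : ℝ)
    (f : ℝ → Fin n → ℝ) (x : ℝ) (i : Fin n) : ℝ :=
  inflowExt d K f i (x - d i * t)

section Transport

variable {n : ℕ} {d : Fin n → ℝ} {K : Matrix (Fin n) (Fin n) ℝ} {δ : ℝ}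

theorem memLp_component {f : ℝ → Fin n → ℝ} (hf : MemLp f 2 mu01) (i : Fin n) :
    MemLp (fun x => f x i) 2 (volume.restrict (Icc 0 1)) :=
  hf.eval i

theorem ae_mu01_iff {p : ℝ → Prop} :
    (∀ᵐ x ∂mu01, p x) ↔ ∀ᵐ x : ℝ, x ∈ Icc (0 : ℝ) 1 → p x :=
  ae_restrict_iff' measurableSet_Icc

theorem inflow_arg_mem (hd : ∀ i, 0 < d i) (hδ : ∀ i, d i * δ ≤ 1) (i j : Fin n) {x : ℝ}
    (hx : x ∈ Icc (-(d i * δ)) 0) : 1 + d j / d i * x ∈ Icc (0 : ℝ) 1 := by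
  have hi := hd i
  have hj := hd j
  have h1 := mul_le_mul_of_nonneg_left hx.1 (div_pos hj hi).le
  have h2 : d j / d i * -(d i * δ) = -(d j * δ) := by field_simp
  have h3 := mul_nonneg_of_nonpos_of_nonpos (neg_nonpos.2 (div_pos hj hi).le) hx.2
  have h4 := hδ j
  constructor <;> linarith

theorem inflowExt_ae_congr (hd : ∀ i, 0 < d i) (hδ : ∀ i, d i * δ ≤ 1) {f g : ℝ → Fin n → ℝ}
    (hfg : f =ᵐ[mu01] g) (i : Fin n) :
    ∀ᵐ x : ℝ, x ∈ Icc (-(d i * δ)) 1 → inflowExt d K f i x = inflowExt d K g i x := by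
  have h1 : ∀ᵐ x : ℝ, x ∈ Icc (0 : ℝ) 1 → f x = g x := ae_mu01_iff.1 hfg
  have h2 : ∀ᵐ x : ℝ, ∀ j, 1 + d j / d i * x ∈ Icc (0 : ℝ) 1 →
      f (1 + d j / d i * x) = g (1 + d j / d i * x) := by
    rw [ae_all_iff]
    exact fun j => ae_comp_affine h1 (div_pos (hd j) (hd i)).ne' 1
  filter_upwards [h1, h2] with x hx1 hx2 hx
  unfold inflowExt
  split_ifs with h0
  · rw [hx1 ⟨h0, hx.2⟩]
  · refine Finset.sum_congr rfl fun j _ => ?_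
    rw [hx2 j (inflow_arg_mem hd hδ i j ⟨hx.1, (not_le.1 h0).le⟩)]

theorem transport_arg_mem (hd : ∀ i, 0 < d i) {t : ℝ} (ht : 0 ≤ t) (htδ : t ≤ δ) (i : Fin n)
    {x : ℝ} (hx : x ∈ Icc (0 : ℝ) 1) : x - d i * t ∈ Icc (-(d i * δ)) 1 := by
  have hi := hd i
  have h1 := mul_le_mul_of_nonneg_left htδ hi.le
  have h2 := mul_nonneg hi.le ht
  have := hx.1
  have := hx.2
  constructor <;> linarith

theorem transport_ae_congr (hd : ∀ i, 0 < d i) (hδ : ∀ i, d i * δ ≤ 1) {t : ℝ} (ht : 0 ≤ t)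
    (htδ : t ≤ δ) {f g : ℝ → Fin n → ℝ} (hfg : f =ᵐ[mu01] g) :
    transport d K t f =ᵐ[mu01] transport d K t g := by
  have h1 : ∀ᵐ x : ℝ, ∀ i, -(d i * t) + 1 * x ∈ Icc (-(d i * δ)) 1 →
      inflowExt d K f i (-(d i * t) + 1 * x) = inflowExt d K g i (-(d i * t) + 1 * x) := by
    rw [ae_all_iff]
    exact fun i => ae_comp_affine (inflowExt_ae_congr hd hδ hfg i) one_ne_zero _
  refine ae_mu01_iff.2 ?_
  filter_upwards [h1] with x hx hx01
  funext i
  have e : -(d i * t) + 1 * x = x - d i * t := by ring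
  have := hx i
  rw [e] at this
  exact this (transport_arg_mem hd ht htδ i hx01)

theorem memLp_inflowExt (hd : ∀ i, 0 < d i) (hδ : ∀ i, d i * δ ≤ 1) {f : ℝ → Fin n → ℝ}
    (hf : MemLp f 2 mu01) (i : Fin n) :
    MemLp (inflowExt d K f i) 2 (volume.restrict (Icc (-(d i * δ)) 1)) := by
  have h1 : MemLp (fun x => f x i) 2
      ((volume.restrict (Icc (-(d i * δ)) 1)).restrict (Ici (0 : ℝ))) := by
    rw [Measure.restrict_restrict measurableSet_Ici]
    exact (memLp_component hf i).mono_measure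
      (Measure.restrict_mono_set _ fun x (hx : x ∈ Ici (0 : ℝ) ∩ _) =>
        (⟨hx.1, hx.2.2⟩ : x ∈ Icc (0 : ℝ) 1))
  have h2 : MemLp (fun x => ∑ j, K i j * f (1 + d j / d i * x) j) 2
      ((volume.restrict (Icc (-(d i * δ)) 1)).restrict (Ici (0 : ℝ))ᶜ) := by
    rw [Measure.restrict_restrict measurableSet_Ici.compl]
    refine MemLp.mono_measure (Measure.restrict_mono_set (t := Icc (-(d i * δ)) 0) _ fun x hx =>
      ⟨hx.2.1, (not_le.1 (fun h => hx.1 h)).le⟩) ?_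
    refine memLp_finsetSum _ fun j _ => MemLp.const_mul ?_ _
    exact memLp_comp_affine (memLp_component hf j) (div_pos (hd j) (hd i)).ne'
      fun x hx => inflow_arg_mem hd hδ i j hx
  classical
  have h3 := MemLp.piecewise measurableSet_Ici h1 h2
  exact h3

end Transport

section Transport

variable {n : ℕ} {d : Fin n → ℝ} {K : Matrix (Fin n) (Fin n) ℝ} {δ : ℝ}

theorem memLp_transport (hd : ∀ i, 0 < d i) (hδ : ∀ i, d i * δ ≤ 1) {t : ℝ} (ht : 0 ≤ t)
    (htδ : t ≤ δ) {f : ℝ → Fin n → ℝ} (hf : MemLp f 2 mu01) :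
    MemLp (transport d K t f) 2 mu01 := by
  refine MemLp.of_eval fun i => ?_
  have h := memLp_comp_affine (memLp_inflowExt (K := K) hd hδ hf i) (one_ne_zero)
    (a' := 0) (b' := 1) (e := -(d i * t)) (fun x hx => by
      have := transport_arg_mem hd ht htδ i hx
      rwa [show -(d i * t) + 1 * x = x - d i * t by ring])
  have e : (fun x => transport d K t f x i)
      = fun x => inflowExt d K f i (-(d i * t) + 1 * x) := by
    funext x
    rw [show -(d i * t) + 1 * x = x - d i * t by ring, transport]
  rw [e]
  exact h

theorem inflowExt_of_nonneg {f : ℝ → Fin n → ℝ} {i : Fin n} {x : ℝ} (hx : 0 ≤ x) :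
    inflowExt d K f i x = f x i := if_pos hx

theorem inflowExt_of_neg {f : ℝ → Fin n → ℝ} {i : Fin n} {x : ℝ} (hx : x < 0) :
    inflowExt d K f i x = ∑ j, K i j * f (1 + d j / d i * x) j := if_neg (not_le.2 hx)

theorem transport_add (t : ℝ) (f g : ℝ → Fin n → ℝ) :
    transport d K t (f + g) = transport d K t f + transport d K t g := by
  funext x i
  simp only [transport, inflowExt, Pi.add_apply]
  split_ifs
  · rfl
  · rw [← Finset.sum_add_distrib]
    exact Finset.sum_congr rfl fun j _ => mul_add _ _ _

theorem transport_smul (t c : ℝ) (f : ℝ → Fin n → ℝ) :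
    transport d K t (c • f) = c • transport d K t f := by
  funext x i
  simp only [transport, inflowExt, Pi.smul_apply, smul_eq_mul]
  split_ifs
  · rfl
  · rw [Finset.mul_sum]
    exact Finset.sum_congr rfl fun j _ => mul_left_comm _ _ _

theorem transport_mono (hd : ∀ i, 0 < d i) (hK : ∀ i j, 0 ≤ K i j) (hδ : ∀ i, d i * δ ≤ 1)
    {t : ℝ} (ht : 0 ≤ t) (htδ : t ≤ δ) {f g : ℝ → Fin n → ℝ}
    (hfg : ∀ x ∈ Icc (0 : ℝ) 1, f x ≤ g x) {x : ℝ} (hx : x ∈ Icc (0 : ℝ) 1) :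
    transport d K t f x ≤ transport d K t g x := by
  intro i
  have hm := transport_arg_mem hd ht htδ i hx
  simp only [transport, inflowExt]
  split_ifs with h0
  · exact hfg _ ⟨h0, hm.2⟩ i
  · refine Finset.sum_le_sum fun j _ => mul_le_mul_of_nonneg_left ?_ (hK i j)
    exact hfg _ (inflow_arg_mem hd hδ i j ⟨hm.1, (not_le.1 h0).le⟩) j

theorem transport_zero {f : ℝ → Fin n → ℝ} {x : ℝ} (hx : x ∈ Icc (0 : ℝ) 1) :
    transport d K 0 f x = f x := by
  funext i
  rw [transport, mul_zero, sub_zero, inflowExt_of_nonneg hx.1]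

theorem transport_transport (hd : ∀ i, 0 < d i) (hδ : ∀ i, d i * δ ≤ 1) {t s : ℝ}
    (hs : 0 ≤ s) (hts : t + s ≤ δ) (f : ℝ → Fin n → ℝ) {x : ℝ} (hx : 0 ≤ x) :
    transport d K (t + s) f x = transport d K t (transport d K s f) x := by
  funext i
  have hi := hd i
  rcases le_or_gt 0 (x - d i * t) with h0 | h0
  · rw [transport, transport, inflowExt_of_nonneg h0, transport]
    congr 1
    ring
  · have h1 : x - d i * (t + s) < 0 := by nlinarith
    rw [transport, transport, inflowExt_of_neg h0, inflowExt_of_neg h1]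
    refine Finset.sum_congr rfl fun j _ => ?_
    have hj := hd j
    have e : 1 + d j / d i * (x - d i * t) - d j * s = 1 + d j / d i * (x - d i * (t + s)) := by
      field_simp
      ring
    have e' : 1 + d j / d i * (x - d i * (t + s)) = 1 - d j * (t + s) + d j / d i * x := by
      field_simp
      ring
    have h2 : 0 ≤ 1 + d j / d i * (x - d i * (t + s)) := by
      have h3 := mul_le_mul_of_nonneg_left hts hj.le
      have h4 := hδ j
      have h5 : 0 ≤ d j / d i * x := by positivity
      linarith
    rw [transport, e, inflowExt_of_nonneg h2]

/-- Weighted energy of a state. -/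
noncomputable def energy (d P : Fin n → ℝ) (ε : ℝ) (f : ℝ → Fin n → ℝ) : ℝ :=
  ∑ i, P i * ∫ x in (0 : ℝ)..1, Real.exp (2 * ε * ((1 - x) / d i)) / d i * f x i ^ 2

theorem energy_congr_ae {P : Fin n → ℝ} {ε : ℝ} {f g : ℝ → Fin n → ℝ} (hfg : f =ᵐ[mu01] g) :
    energy d P ε f = energy d P ε g := by
  unfold energy
  refine Finset.sum_congr rfl fun i _ => ?_
  congr 1
  refine intervalIntegral.integral_congr_ae ?_
  filter_upwards [ae_mu01_iff.1 hfg] with x hx hx'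
  rw [uIoc_of_le zero_le_one] at hx'
  rw [hx ⟨hx'.1.le, hx'.2⟩]

theorem memLp_outflow (hd : ∀ i, 0 < d i) (hδ : ∀ i, d i * δ ≤ 1) {f : ℝ → Fin n → ℝ}
    (hf : MemLp f 2 mu01) (j : Fin n) :
    MemLp (fun s => f (1 - d j * s) j) 2 (volume.restrict (Icc 0 δ)) := by
  have h := memLp_comp_affine (memLp_component hf j) (neg_ne_zero.2 (hd j).ne')
    (a' := 0) (b' := δ) (e := 1) (fun s hs => by
      have h1 := mul_le_mul_of_nonneg_left hs.2 (hd j).le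
      have h2 := mul_nonneg (hd j).le hs.1
      have h3 := hδ j
      constructor <;> linarith)
  have e : (fun s => f (1 - d j * s) j) = fun s => f (1 + -d j * s) j := by
    funext s
    rw [neg_mul, sub_eq_add_neg]
  rw [e]
  exact h

theorem energy_transport_le (hd : ∀ i, 0 < d i) (hδ : ∀ i, d i * δ ≤ 1) {t : ℝ} (ht : 0 ≤ t)
    (htδ : t ≤ δ) {P : Fin n → ℝ} {ε : ℝ}
    (hP : ∀ y : Fin n → ℝ, ∑ i, P i * (Real.exp (2 * ε / d i) * (∑ j, K i j * y j) ^ 2)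
      ≤ ∑ i, P i * y i ^ 2)
    {f : ℝ → Fin n → ℝ} (hf : MemLp f 2 mu01) :
    energy d P ε (transport d K t f) ≤ Real.exp (-(2 * ε * t)) * energy d P ε f := by
  set y : ℝ → Fin n → ℝ := fun s j => f (1 - d j * s) j with hy
  set w : Fin n → ℝ → ℝ := fun i x => Real.exp (2 * ε * ((1 - x) / d i)) / d i with hw
  have hwc : ∀ i, Continuous (w i) := fun i => by simp only [hw]; fun_prop
  have hyL : ∀ j, MemLp (fun s => y s j) 2 (volume.restrict (Icc 0 δ)) :=
    fun j => memLp_outflow hd hδ hf j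
  have hsumL : ∀ i, MemLp (fun s => ∑ j, K i j * y s j) 2 (volume.restrict (Icc 0 δ)) :=
    fun i => memLp_finsetSum _ fun j _ => (hyL j).const_mul _
  have h0m : (0 : ℝ) ∈ Icc 0 δ := ⟨le_rfl, ht.trans htδ⟩
  have htm : t ∈ Icc 0 δ := ⟨ht, htδ⟩
  have hexp : Continuous fun s : ℝ => Real.exp (2 * ε * s) := by fun_prop
  have hI1 : ∀ i, IntervalIntegrable (fun s => Real.exp (2 * ε * s) * y s i ^ 2) volume 0 t :=
    fun i => memLp_two_intervalIntegrable_mul_sq (hyL i) hexp h0m htm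
  have hI2 : ∀ i, IntervalIntegrable
      (fun s => Real.exp (2 * ε * s) * (∑ j, K i j * y s j) ^ 2) volume 0 t :=
    fun i => memLp_two_intervalIntegrable_mul_sq (hsumL i) hexp h0m htm
  have hmain : ∀ i, ∫ x in (0 : ℝ)..1, w i x * transport d K t f x i ^ 2
      = Real.exp (-(2 * ε * t)) * ((∫ x in (0 : ℝ)..1, w i x * f x i ^ 2)
        + Real.exp (2 * ε / d i) * (∫ s in (0 : ℝ)..t,
            Real.exp (2 * ε * s) * (∑ j, K i j * y s j) ^ 2)
        - ∫ s in (0 : ℝ)..t, Real.exp (2 * ε * s) * y s i ^ 2) := by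
    intro i
    have hi := hd i
    set φ := inflowExt d K f i with hφ
    have hdt : d i * t ≤ d i * δ := mul_le_mul_of_nonneg_left htδ hi.le
    have hdt0 : 0 ≤ d i * t := mul_nonneg hi.le ht
    have hdi := hδ i
    have hint : ∀ a b, a ∈ Icc (-(d i * δ)) 1 → b ∈ Icc (-(d i * δ)) 1 →
        IntervalIntegrable (fun x => w i x * φ x ^ 2) volume a b := fun a b ha hb =>
      memLp_two_intervalIntegrable_mul_sq (memLp_inflowExt hd hδ hf i) (hwc i) ha hb
    have m1 : -(d i * t) ∈ Icc (-(d i * δ)) 1 := ⟨by linarith, by linarith⟩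
    have m2 : (0 : ℝ) ∈ Icc (-(d i * δ)) 1 := ⟨by linarith, by linarith⟩
    have m3 : 1 - d i * t ∈ Icc (-(d i * δ)) 1 := ⟨by linarith, by linarith⟩
    have m4 : (1 : ℝ) ∈ Icc (-(d i * δ)) 1 := ⟨by linarith, by linarith⟩
    have e1 : ∫ x in (0 : ℝ)..1, w i x * transport d K t f x i ^ 2
        = Real.exp (-(2 * ε * t)) * ∫ x in -(d i * t)..(1 - d i * t), w i x * φ x ^ 2 := by
      have := intervalIntegral.integral_comp_sub_right (fun x => w i x * φ x ^ 2) (d i * t)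
        (a := 0) (b := 1)
      rw [zero_sub] at this
      rw [← this, ← intervalIntegral.integral_const_mul]
      refine intervalIntegral.integral_congr fun x _ => ?_
      simp only [hw, transport, ← hφ]
      have : Real.exp (2 * ε * ((1 - x) / d i))
          = Real.exp (-(2 * ε * t)) * Real.exp (2 * ε * ((1 - (x - d i * t)) / d i)) := by
        rw [← Real.exp_add]
        congr 1
        field_simp
        ring
      rw [this]
      ring
    have e2 : ∫ x in (0 : ℝ)..1, w i x * φ x ^ 2 = ∫ x in (0 : ℝ)..1, w i x * f x i ^ 2 := by
      refine intervalIntegral.integral_congr fun x hx => ?_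
      rw [uIcc_of_le zero_le_one] at hx
      simp only [hφ, inflowExt_of_nonneg hx.1]
    have e3 : ∫ x in (1 - d i * t)..1, w i x * φ x ^ 2
        = ∫ s in (0 : ℝ)..t, Real.exp (2 * ε * s) * y s i ^ 2 := by
      have := intervalIntegral.integral_comp_sub_mul (fun x => w i x * φ x ^ 2) hi.ne' 1
        (a := 0) (b := t)
      rw [mul_zero, sub_zero, smul_eq_mul, eq_inv_mul_iff_mul_eq₀ hi.ne',
        ← intervalIntegral.integral_const_mul] at this
      rw [← this]
      refine intervalIntegral.integral_congr fun s hs => ?_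
      rw [uIcc_of_le ht] at hs
      have hs' : 0 ≤ 1 - d i * s := by
        have := mul_le_mul_of_nonneg_left hs.2 hi.le
        linarith
      simp only [hφ, inflowExt_of_nonneg hs', hw, hy]
      rw [show (1 - (1 - d i * s)) / d i = s by field_simp; ring]
      field_simp
    have e4 : ∫ x in -(d i * t)..0, w i x * φ x ^ 2
        = Real.exp (2 * ε / d i) * ∫ s in (0 : ℝ)..t,
            Real.exp (2 * ε * s) * (∑ j, K i j * y s j) ^ 2 := by
      have := intervalIntegral.integral_comp_sub_mul (fun x => w i x * φ x ^ 2) hi.ne' 0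
        (a := 0) (b := t)
      rw [mul_zero, sub_zero, zero_sub, smul_eq_mul, eq_inv_mul_iff_mul_eq₀ hi.ne',
        ← intervalIntegral.integral_const_mul] at this
      rw [← this, ← intervalIntegral.integral_const_mul]
      refine intervalIntegral.integral_congr_ae (Eventually.of_forall fun s hs => ?_)
      rw [uIoc_of_le ht] at hs
      have hs' : 0 - d i * s < 0 := by
        have := mul_pos hi hs.1
        linarith
      simp only [hφ, inflowExt_of_neg hs', hw, hy]
      have e5 : ∀ j, 1 + d j / d i * (0 - d i * s) = 1 - d j * s := fun j => by
        field_simp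
        ring
      simp only [e5]
      have : Real.exp (2 * ε * ((1 - (0 - d i * s)) / d i))
          = Real.exp (2 * ε / d i) * Real.exp (2 * ε * s) := by
        rw [← Real.exp_add]
        congr 1
        field_simp
        ring
      rw [this]
      field_simp
    rw [e1]
    congr 1
    have a1 := intervalIntegral.integral_add_adjacent_intervals (hint _ _ m1 m2) (hint _ _ m2 m3)
    have a2 := intervalIntegral.integral_add_adjacent_intervals (hint _ _ m2 m3) (hint _ _ m3 m4)
    rw [← e2, ← e3, ← e4]
    linarith
  have hsum : ∑ i, P i * (Real.exp (2 * ε / d i) * ∫ s in (0 : ℝ)..t,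
        Real.exp (2 * ε * s) * (∑ j, K i j * y s j) ^ 2)
      ≤ ∑ i, P i * ∫ s in (0 : ℝ)..t, Real.exp (2 * ε * s) * y s i ^ 2 := by
    simp only [← intervalIntegral.integral_const_mul]
    rw [← intervalIntegral.integral_finsetSum fun i _ => ((hI2 i).const_mul _).const_mul _,
      ← intervalIntegral.integral_finsetSum fun i _ => (hI1 i).const_mul _]
    refine intervalIntegral.integral_mono_on ht ?_ ?_ fun s _ => ?_
    · simpa only [Finset.sum_fn] using
        IntervalIntegrable.sum _ fun i _ => ((hI2 i).const_mul _).const_mul _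
    · simpa only [Finset.sum_fn] using IntervalIntegrable.sum _ fun i _ => (hI1 i).const_mul _
    · have := mul_le_mul_of_nonneg_left (hP (y s)) (Real.exp_pos (2 * ε * s)).le
      rw [Finset.mul_sum, Finset.mul_sum] at this
      refine (le_of_eq ?_).trans (this.trans (le_of_eq ?_))
      · exact Finset.sum_congr rfl fun i _ => by ring
      · exact Finset.sum_congr rfl fun i _ => by ring
  calc energy d P ε (transport d K t f)
      = ∑ i, P i * ∫ x in (0 : ℝ)..1, w i x * transport d K t f x i ^ 2 := rfl
    _ = Real.exp (-(2 * ε * t)) * ((∑ i, P i * ∫ x in (0 : ℝ)..1, w i x * f x i ^ 2)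
        + (∑ i, P i * (Real.exp (2 * ε / d i) * ∫ s in (0 : ℝ)..t,
            Real.exp (2 * ε * s) * (∑ j, K i j * y s j) ^ 2))
        - ∑ i, P i * ∫ s in (0 : ℝ)..t, Real.exp (2 * ε * s) * y s i ^ 2) := by
      rw [← Finset.sum_add_distrib, ← Finset.sum_sub_distrib, Finset.mul_sum]
      refine Finset.sum_congr rfl fun i _ => ?_
      rw [hmain i]
      ring
    _ ≤ Real.exp (-(2 * ε * t)) * energy d P ε f := by
      refine mul_le_mul_of_nonneg_left ?_ (Real.exp_pos _).le
      change _ ≤ ∑ i, P i * ∫ x in (0 : ℝ)..1, w i x * f x i ^ 2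
      linarith

end Transport

section Transport

variable {n : ℕ} {d : Fin n → ℝ} {K : Matrix (Fin n) (Fin n) ℝ} {δ : ℝ}

instance isFiniteMeasure_mu01 : IsFiniteMeasure mu01 := by
  unfold mu01
  infer_instance

instance neZero_mu01 : NeZero mu01 := ⟨fun h0 => by
  have h1 : mu01 univ = 1 := by simp [mu01]
  simp [h0] at h1⟩

theorem norm_sq_eq_integral_mu01 (f : Lp (α := ℝ) (Fin n → ℝ) 2 mu01) :
    ‖f‖ ^ 2 = ∫ x, ‖(f : ℝ → Fin n → ℝ) x‖ ^ 2 ∂mu01 := by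
  have h := (Lp.memLp f).eLpNorm_eq_integral_rpow_norm two_ne_zero ENNReal.ofNat_ne_top
  have hnn : 0 ≤ ∫ x, ‖(f : ℝ → Fin n → ℝ) x‖ ^ 2 ∂mu01 :=
    integral_nonneg fun x => sq_nonneg _
  rw [Lp.norm_def, h]
  simp only [ENNReal.toReal_ofNat, Real.rpow_ofNat]
  rw [ENNReal.toReal_ofReal (by positivity), ← Real.rpow_natCast, ← Real.rpow_mul hnn]
  norm_num

theorem integrable_norm_sq_mu01 {f : ℝ → Fin n → ℝ} (hf : MemLp f 2 mu01) :
    Integrable (fun x => ‖f x‖ ^ 2) mu01 := hf.norm.integrable_sq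

theorem integral_mu01 (h : ℝ → ℝ) : ∫ x in (0 : ℝ)..1, h x = ∫ x, h x ∂mu01 := by
  rw [intervalIntegral.integral_of_le zero_le_one, mu01, integral_Icc_eq_integral_Ioc]

theorem integrable_mul_sq_mu01 {f : ℝ → Fin n → ℝ} (hf : MemLp f 2 mu01) (i : Fin n)
    {w : ℝ → ℝ} (hw : Continuous w) : Integrable (fun x => w x * f x i ^ 2) mu01 := by
  have h := memLp_two_intervalIntegrable_mul_sq (memLp_component hf i) hw
    (left_mem_Icc.2 zero_le_one) (right_mem_Icc.2 zero_le_one)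
  rw [intervalIntegrable_iff_integrableOn_Icc_of_le zero_le_one] at h
  exact h

theorem energy_weight_bounds (hd : ∀ i, 0 < d i) (ε : ℝ) (i : Fin n) {x : ℝ}
    (hx : x ∈ Icc (0 : ℝ) 1) :
    Real.exp (-(2 * |ε| / d i)) / d i ≤ Real.exp (2 * ε * ((1 - x) / d i)) / d i ∧
    Real.exp (2 * ε * ((1 - x) / d i)) / d i ≤ Real.exp (2 * |ε| / d i) / d i := by
  have hi := hd i
  have h1 : |2 * ε * ((1 - x) / d i)| ≤ 2 * |ε| / d i := by
    have hx1 : 0 ≤ 1 - x := by linarith [hx.2]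
    rw [abs_mul, abs_mul, abs_div, abs_of_pos hi, abs_of_nonneg hx1, abs_two, mul_div_assoc']
    have h3 : 2 * |ε| * (1 - x) ≤ 2 * |ε| :=
      mul_le_of_le_one_right (by positivity) (by linarith [hx.1])
    gcongr
  have h2 := abs_le.1 h1
  constructor
  · gcongr
    exact h2.1
  · gcongr
    exact h2.2

/-- The weighted energy is equivalent to the square of the norm. -/
theorem exists_energy_equiv (hd : ∀ i, 0 < d i) {P : Fin n → ℝ} (hP : ∀ i, 0 < P i) (ε : ℝ) :
    ∃ c C : ℝ, 0 < c ∧ 0 < C ∧ ∀ f : Lp (α := ℝ) (Fin n → ℝ) 2 mu01,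
      c * ‖f‖ ^ 2 ≤ energy d P ε f ∧ energy d P ε f ≤ C * ‖f‖ ^ 2 := by
  set m : Fin n → ℝ := fun i => P i * (Real.exp (-(2 * |ε| / d i)) / d i) with hm
  set M : Fin n → ℝ := fun i => P i * (Real.exp (2 * |ε| / d i) / d i) with hM
  have hm0 : ∀ i, 0 < m i := fun i => mul_pos (hP i) (div_pos (Real.exp_pos _) (hd i))
  have hM0 : ∀ i, 0 < M i := fun i => mul_pos (hP i) (div_pos (Real.exp_pos _) (hd i))
  have hS : 0 ≤ ∑ i, (m i)⁻¹ := Finset.sum_nonneg fun i _ => (inv_pos.2 (hm0 i)).le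
  have hc : ∀ i, (1 + ∑ i, (m i)⁻¹)⁻¹ ≤ m i := by
    intro i
    rw [inv_le_comm₀ (by positivity) (hm0 i)]
    have := Finset.single_le_sum (f := fun i => (m i)⁻¹) (fun i _ => (inv_pos.2 (hm0 i)).le)
      (Finset.mem_univ i)
    linarith
  have hM1 : 0 ≤ ∑ i, M i := Finset.sum_nonneg fun i _ => (hM0 i).le
  refine ⟨(1 + ∑ i, (m i)⁻¹)⁻¹, 1 + ∑ i, M i, by positivity, by positivity, fun f => ?_⟩
  have hf := Lp.memLp f
  have hw : ∀ i, Continuous fun x : ℝ => Real.exp (2 * ε * ((1 - x) / d i)) / d i :=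
    fun i => by fun_prop
  have hIn := integrable_norm_sq_mu01 hf
  have hIw := fun i => integrable_mul_sq_mu01 hf i (hw i)
  have hIc := fun (i : Fin n) => integrable_mul_sq_mu01 hf i (continuous_const (y := (1 : ℝ)))
  have hmem : ∀ᵐ x ∂mu01, x ∈ Icc (0 : ℝ) 1 := ae_restrict_mem measurableSet_Icc
  simp only [energy, integral_mu01]
  rw [norm_sq_eq_integral_mu01]
  constructor
  · have h1 : ∫ x, ‖(f : ℝ → Fin n → ℝ) x‖ ^ 2 ∂mu01
        ≤ ∑ i, ∫ x, 1 * (f : ℝ → Fin n → ℝ) x i ^ 2 ∂mu01 := by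
      rw [← integral_finsetSum _ fun i _ => hIc i]
      refine integral_mono hIn (integrable_finsetSum _ fun i _ => hIc i) fun x => ?_
      simp only [one_mul]
      have hs : 0 ≤ ∑ i, (f : ℝ → Fin n → ℝ) x i ^ 2 := Finset.sum_nonneg fun i _ => sq_nonneg _
      rw [← Real.le_sqrt (norm_nonneg _) hs, pi_norm_le_iff_of_nonneg (Real.sqrt_nonneg _)]
      intro i
      rw [Real.norm_eq_abs]
      refine Real.abs_le_sqrt ?_
      exact Finset.single_le_sum (f := fun i => (f : ℝ → Fin n → ℝ) x i ^ 2)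
        (fun i _ => sq_nonneg _) (Finset.mem_univ i)
    refine (mul_le_mul_of_nonneg_left h1 (by positivity)).trans ?_
    rw [Finset.mul_sum]
    refine Finset.sum_le_sum fun i _ => ?_
    have hnn : 0 ≤ ∫ x, 1 * (f : ℝ → Fin n → ℝ) x i ^ 2 ∂mu01 :=
      integral_nonneg fun x => by positivity
    refine (mul_le_mul_of_nonneg_right (hc i) hnn).trans ?_
    rw [hm, mul_assoc]
    refine mul_le_mul_of_nonneg_left ?_ (hP i).le
    rw [← integral_const_mul]
    refine integral_mono_ae ((hIc i).const_mul _) (hIw i) ?_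
    filter_upwards [hmem] with x hx
    rw [one_mul]
    exact mul_le_mul_of_nonneg_right (energy_weight_bounds hd ε i hx).1 (sq_nonneg _)
  · have hnn : 0 ≤ ∫ x, ‖(f : ℝ → Fin n → ℝ) x‖ ^ 2 ∂mu01 := integral_nonneg fun x => by positivity
    have h1 : ∀ i, P i * ∫ x, Real.exp (2 * ε * ((1 - x) / d i)) / d i
          * (f : ℝ → Fin n → ℝ) x i ^ 2 ∂mu01
        ≤ M i * ∫ x, ‖(f : ℝ → Fin n → ℝ) x‖ ^ 2 ∂mu01 := by
      intro i
      rw [hM, mul_assoc]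
      refine mul_le_mul_of_nonneg_left ?_ (hP i).le
      rw [← integral_const_mul]
      refine integral_mono_ae (hIw i) (hIn.const_mul _) ?_
      filter_upwards [hmem] with x hx
      have h2 : (f : ℝ → Fin n → ℝ) x i ^ 2 ≤ ‖(f : ℝ → Fin n → ℝ) x‖ ^ 2 := by
        rw [← sq_abs, ← Real.norm_eq_abs]
        gcongr
        exact norm_le_pi_norm _ i
      exact mul_le_mul (energy_weight_bounds hd ε i hx).2 h2 (sq_nonneg _)
        (div_nonneg (Real.exp_pos _).le (hd i).le)
    refine (Finset.sum_le_sum fun i _ => h1 i).trans ?_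
    rw [← Finset.sum_mul]
    nlinarith

/-- For sufficiently negative `ε` the boundary feedback does not increase the energy. -/
theorem exists_growth_rate (hd : ∀ i, 0 < d i) (hδ : ∀ i, d i * δ ≤ 1) (hδ0 : 0 < δ) :
    ∃ ε : ℝ, ∀ y : Fin n → ℝ,
      ∑ i, (1 : ℝ) * (Real.exp (2 * ε / d i) * (∑ j, K i j * y j) ^ 2) ≤ ∑ i, (1 : ℝ) * y i ^ 2 := by
  set Q : ℝ := 1 + ∑ i, ∑ j, K i j ^ 2 with hQ
  have hQ1 : 1 ≤ Q := by
    have : 0 ≤ ∑ i, ∑ j, K i j ^ 2 :=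
      Finset.sum_nonneg fun i _ => Finset.sum_nonneg fun j _ => sq_nonneg _
    linarith
  refine ⟨-(Real.log Q / (2 * δ)), fun y => ?_⟩
  have hlog := Real.log_nonneg hQ1
  have hexp : ∀ i, Real.exp (2 * -(Real.log Q / (2 * δ)) / d i) ≤ Q⁻¹ := by
    intro i
    rw [← Real.exp_log (inv_pos.2 (one_pos.trans_le hQ1)), Real.log_inv]
    refine Real.exp_le_exp.2 ?_
    have hi := hd i
    have e : 2 * -(Real.log Q / (2 * δ)) / d i = -(Real.log Q / (d i * δ)) := by field_simp
    rw [e, neg_le_neg_iff, le_div_iff₀ (by positivity)]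
    nlinarith [hδ i]
  have hy0 : 0 ≤ ∑ j, y j ^ 2 := Finset.sum_nonneg fun j _ => sq_nonneg _
  simp only [one_mul]
  calc ∑ i, Real.exp (2 * -(Real.log Q / (2 * δ)) / d i) * (∑ j, K i j * y j) ^ 2
      ≤ ∑ i, Q⁻¹ * ((∑ j, K i j ^ 2) * ∑ j, y j ^ 2) := by
        refine Finset.sum_le_sum fun i _ => ?_
        exact mul_le_mul (hexp i) (Finset.sum_mul_sq_le_sq_mul_sq _ _ _) (sq_nonneg _)
          (by positivity)
    _ = Q⁻¹ * (Q - 1) * ∑ j, y j ^ 2 := by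
        rw [← Finset.mul_sum, ← Finset.sum_mul, hQ]
        ring
    _ ≤ 1 * ∑ j, y j ^ 2 := by
        refine mul_le_mul_of_nonneg_right ?_ hy0
        rw [inv_mul_le_iff₀ (by positivity)]
        linarith
    _ = ∑ j, y j ^ 2 := one_mul _

/-- The transport map as a bounded operator. -/
theorem exists_transportCLM (hd : ∀ i, 0 < d i) (hδ : ∀ i, d i * δ ≤ 1) (hδ0 : 0 < δ) {t : ℝ}
    (ht : 0 ≤ t) (htδ : t ≤ δ) :
    ∃ S : Lp (α := ℝ) (Fin n → ℝ) 2 mu01 →L[ℝ] Lp (α := ℝ) (Fin n → ℝ) 2 mu01,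
      ∀ f, (S f : ℝ → Fin n → ℝ) =ᵐ[mu01] transport d K t f := by
  obtain ⟨ε, hε⟩ := exists_growth_rate (K := K) hd hδ hδ0
  obtain ⟨c, C, hc, hC, hcC⟩ := exists_energy_equiv hd (P := fun _ => 1) (fun _ => one_pos) ε
  let L : Lp (α := ℝ) (Fin n → ℝ) 2 mu01 →ₗ[ℝ] Lp (α := ℝ) (Fin n → ℝ) 2 mu01 :=
    { toFun := fun f => (memLp_transport (K := K) hd hδ ht htδ (Lp.memLp f)).toLp _
      map_add' := fun f g => by
        rw [← MemLp.toLp_add]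
        refine MemLp.toLp_congr _ _ ?_
        rw [← transport_add]
        exact transport_ae_congr hd hδ ht htδ (Lp.coeFn_add f g)
      map_smul' := fun a f => by
        rw [RingHom.id_apply, ← MemLp.toLp_const_smul]
        refine MemLp.toLp_congr _ _ ?_
        rw [← transport_smul]
        exact transport_ae_congr hd hδ ht htδ (Lp.coeFn_smul a f) }
  have hL : ∀ f, (L f : ℝ → Fin n → ℝ) =ᵐ[mu01] transport d K t f := fun f =>
    MemLp.coeFn_toLp (memLp_transport (K := K) hd hδ ht htδ (Lp.memLp f))
  refine ⟨L.mkContinuous (Real.sqrt (Real.exp (-(2 * ε * t)) * C / c)) fun f => ?_, hL⟩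
  have h1 := (hcC (L f)).1
  rw [energy_congr_ae (hL f)] at h1
  have h2 := energy_transport_le hd hδ ht htδ hε (Lp.memLp f)
  have h3 := mul_le_mul_of_nonneg_left (hcC f).2 (Real.exp_pos (-(2 * ε * t))).le
  rw [← Real.sqrt_sq (norm_nonneg f), ← Real.sqrt_mul (by positivity)]
  refine Real.le_sqrt_of_sq_le ?_
  rw [div_mul_eq_mul_div, le_div_iff₀ hc]
  linarith

end Transport

theorem tendsto_inv_smul_integral {E : Type*} [NormedAddCommGroup E] [NormedSpace ℝ E]
    [CompleteSpace E] {h : ℝ → E} {δ : ℝ} (hδ : 0 < δ) (hh : ContinuousOn h (Icc 0 δ)) :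
    Tendsto (fun t : ℝ => t⁻¹ • ∫ s in (0 : ℝ)..t, h s) (nhdsWithin 0 (Ioi 0)) (nhds (h 0)) := by
  set H : ℝ → E := IccExtend hδ.le ((Icc 0 δ).domRestrict h) with hH
  have hHc : Continuous H := (continuousOn_iff_continuous_domRestrict.1 hh).Icc_extend'
  have hHh : ∀ s ∈ Icc 0 δ, H s = h s := fun s hs => by
    rw [hH, IccExtend_of_mem _ _ hs, domRestrict_apply]
  have h1 := (hHc.integral_hasStrictDerivAt 0 0).hasDerivAt.tendsto_slope_zero_right
  rw [hHh 0 ⟨le_rfl, hδ.le⟩] at h1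
  refine h1.congr' ?_
  filter_upwards [Ioo_mem_nhdsGT hδ] with t ht
  rw [zero_add, intervalIntegral.integral_same, sub_zero]
  congr 1
  refine intervalIntegral.integral_congr fun s hs => ?_
  rw [uIcc_of_le ht.1.le] at hs
  exact hHh s ⟨hs.1, hs.2.trans ht.2.le⟩

section Functionals

variable {n : ℕ}

theorem exists_integralCLM (i : Fin n) {b : ℝ} (hb : b ∈ Icc (0 : ℝ) 1) :
    ∃ ℓ : Lp (α := ℝ) (Fin n → ℝ) 2 mu01 →L[ℝ] ℝ,
      ∀ f : Lp (α := ℝ) (Fin n → ℝ) 2 mu01,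
        ℓ f = ∫ x in (0 : ℝ)..b, (f : ℝ → Fin n → ℝ) x i := by
  have hfin : mu01 (Ioc 0 b) ≠ ⊤ := measure_ne_top _ _
  refine ⟨(innerSL ℝ (indicatorConstLp 2 (measurableSet_Ioc (a := (0 : ℝ)) (b := b)) hfin
    (1 : ℝ))).comp ((ContinuousLinearMap.proj (R := ℝ) (φ := fun _ : Fin n => ℝ) i).compLpL 2 mu01),
    fun f => ?_⟩
  rw [ContinuousLinearMap.comp_apply, innerSL_apply_apply, L2.inner_indicatorConstLp_one,
    intervalIntegral.integral_of_le hb.1]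
  have e : mu01.restrict (Ioc 0 b) = volume.restrict (Ioc 0 b) := by
    rw [mu01, Measure.restrict_restrict measurableSet_Ioc]
    congr 1
    exact inter_eq_left.2 fun x hx => ⟨hx.1.le, hx.2.trans hb.2⟩
  rw [← e]
  refine integral_congr_ae (ae_restrict_of_ae ?_)
  exact ContinuousLinearMap.coeFn_compLpL _ f

theorem eq_zero_of_forall_integral_eq_zero (f : Lp (α := ℝ) (Fin n → ℝ) 2 mu01)
    (h : ∀ i, ∀ b ∈ Icc (0 : ℝ) 1, ∫ x in (0 : ℝ)..b, (f : ℝ → Fin n → ℝ) x i = 0) : f = 0 := by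
  rw [Lp.eq_zero_iff_ae_eq_zero]
  have hne : ∀ᵐ x : ℝ, x ≠ 0 ∧ x ≠ 1 := by
    rw [eventually_and]
    exact ⟨Measure.ae_ne volume 0, Measure.ae_ne volume 1⟩
  have h1 : ∀ᵐ x : ℝ, ∀ i, x ∈ Icc (0 : ℝ) 1 → (f : ℝ → Fin n → ℝ) x i = 0 := by
    rw [ae_all_iff]
    intro i
    have hint := memLp_two_intervalIntegrable (memLp_component (Lp.memLp f) i)
      (left_mem_Icc.2 zero_le_one) (right_mem_Icc.2 zero_le_one)
    filter_upwards [hint.ae_hasDerivAt_integral, hne] with x hx hx0 hx01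
    have hx' := hx (by rwa [uIcc_of_le zero_le_one]) 0
      (by rw [uIcc_of_le zero_le_one]; exact left_mem_Icc.2 zero_le_one)
    have hnhds : Icc (0 : ℝ) 1 ∈ nhds x :=
      Icc_mem_nhds (lt_of_le_of_ne hx01.1 hx0.1.symm) (lt_of_le_of_ne hx01.2 hx0.2)
    have h2 : HasDerivAt (fun b => ∫ y in (0 : ℝ)..b, (f : ℝ → Fin n → ℝ) y i) 0 x := by
      refine (hasDerivAt_const x (0 : ℝ)).congr_of_eventuallyEq ?_
      filter_upwards [hnhds] with b hb using h i b hb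
    exact hx'.unique h2
  refine ae_mu01_iff.2 ?_
  filter_upwards [h1] with x hx hx01
  funext i
  exact hx i hx01

end Functionals

section Transport

variable {n : ℕ} {d : Fin n → ℝ} {K : Matrix (Fin n) (Fin n) ℝ} {δ : ℝ}

theorem integral_transport {h : ℝ → Fin n → ℝ} {f : ℝ → Fin n → ℝ} {t : ℝ}
    (hh : h =ᵐ[mu01] transport d K t f) (i : Fin n) {b : ℝ} (hb : b ∈ Icc (0 : ℝ) 1) :
    ∫ x in (0 : ℝ)..b, h x i = ∫ x in (-(d i * t))..(b - d i * t), inflowExt d K f i x := by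
  rw [← zero_sub (d i * t), ← intervalIntegral.integral_comp_sub_right]
  refine intervalIntegral.integral_congr_ae ?_
  filter_upwards [ae_mu01_iff.1 hh] with x hx hx'
  rw [uIoc_of_le hb.1] at hx'
  rw [hx ⟨hx'.1.le, hx'.2.trans hb.2⟩]
  rfl

/-- For a state `F` in the domain of the generator with image `G`, the extension of `F` is, up to
the factor `-(d i)⁻¹`, a primitive of the extension of `G`. -/
theorem inflowExt_eq_integral (hd : ∀ i, 0 < d i) (hδ : ∀ i, d i * δ ≤ 1)
    {F G : ℝ → Fin n → ℝ} (hG : MemLp G 2 mu01)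
    (hFG : ∀ i : Fin n, ∀ x ∈ Icc (0 : ℝ) 1,
      F x i = F 0 i + ∫ s in (0 : ℝ)..x, -(d i)⁻¹ * G s i)
    (hbc : ∀ i : Fin n, F 0 i = ∑ j : Fin n, K i j * F 1 j) (i : Fin n) {x : ℝ}
    (hx : x ∈ Icc (-(d i * δ)) 1) :
    inflowExt d K F i x = F 0 i - (d i)⁻¹ * ∫ s in (0 : ℝ)..x, inflowExt d K G i s := by
  rcases le_or_gt 0 x with h0 | h0
  · rw [inflowExt_of_nonneg h0, hFG i x ⟨h0, hx.2⟩, intervalIntegral.integral_const_mul,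
      sub_eq_add_neg, neg_mul]
    congr 3
    refine intervalIntegral.integral_congr fun s hs => ?_
    rw [uIcc_of_le h0] at hs
    exact (inflowExt_of_nonneg hs.1).symm
  · have hi := hd i
    have hstep : ∀ j, F (1 + d j / d i * x) j
        = F 1 j + (d i)⁻¹ * ∫ s in x..0, G (1 + d j / d i * s) j := by
      intro j
      have hj := hd j
      have hm := inflow_arg_mem hd hδ i j ⟨hx.1, h0.le⟩
      have hI : ∀ u v, u ∈ Icc (0 : ℝ) 1 → v ∈ Icc (0 : ℝ) 1 →
          IntervalIntegrable (fun s => G s j) volume u v := fun u v hu hv =>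
        memLp_two_intervalIntegrable (memLp_component hG j) hu hv
      have h01 : (0 : ℝ) ∈ Icc (0 : ℝ) 1 := left_mem_Icc.2 zero_le_one
      have h11 : (1 : ℝ) ∈ Icc (0 : ℝ) 1 := right_mem_Icc.2 zero_le_one
      have e1 := intervalIntegral.integral_comp_add_mul (fun s => G s j)
        (div_pos hj hi).ne' 1 (a := x) (b := 0)
      rw [mul_zero, add_zero, smul_eq_mul] at e1
      have e2 := intervalIntegral.integral_add_adjacent_intervals (hI _ _ h01 hm) (hI _ _ hm h11)
      rw [e1, hFG j _ hm, hFG j 1 h11, intervalIntegral.integral_const_mul,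
        intervalIntegral.integral_const_mul, ← e2]
      field_simp
      ring
    rw [inflowExt_of_neg h0, intervalIntegral.integral_symm, mul_neg, sub_neg_eq_add, hbc i]
    simp only [hstep, mul_add, Finset.sum_add_distrib]
    congr 1
    have e3 : ∫ s in x..0, inflowExt d K G i s
        = ∫ s in x..0, ∑ j, K i j * G (1 + d j / d i * s) j := by
      refine intervalIntegral.integral_congr_ae ?_
      filter_upwards [Measure.ae_ne volume 0] with s hs0 hs
      rw [uIoc_of_le h0.le] at hs
      exact inflowExt_of_neg (lt_of_le_of_ne hs.2 hs0)
    have hI2 : ∀ j, IntervalIntegrable (fun s => G (1 + d j / d i * s) j) volume x 0 := fun j =>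
      memLp_two_intervalIntegrable (memLp_comp_affine (memLp_component hG j)
        (div_pos (hd j) hi).ne' fun s hs => inflow_arg_mem hd hδ i j hs)
        ⟨hx.1, h0.le⟩ ⟨hx.1.trans h0.le, le_rfl⟩
    rw [e3, intervalIntegral.integral_finsetSum fun j _ => (hI2 j).const_mul _, Finset.mul_sum]
    refine Finset.sum_congr rfl fun j _ => ?_
    rw [intervalIntegral.integral_const_mul]
    ring

end Transport

/-- A one-parameter semigroup that acts on times up to `δ` as the transport with inflow `K`. -/
structure IsTransportSemigroup {n : ℕ} (d : Fin n → ℝ) (K : Matrix (Fin n) (Fin n) ℝ) (δ : ℝ)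
    (T : ℝ → Lp (α := ℝ) (Fin n → ℝ) 2 mu01 →L[ℝ] Lp (α := ℝ) (Fin n → ℝ) 2 mu01) : Prop where
  zero : T 0 = 1
  add : ∀ t s, 0 ≤ t → 0 ≤ s → T (t + s) = T t * T s
  ae_eq : ∀ t, 0 ≤ t → t ≤ δ → ∀ f, (T t f : ℝ → Fin n → ℝ) =ᵐ[mu01] transport d K t f

section Semigroup

variable {n : ℕ} {d : Fin n → ℝ} {K : Matrix (Fin n) (Fin n) ℝ} {δ : ℝ}
  {T : ℝ → Lp (α := ℝ) (Fin n → ℝ) 2 mu01 →L[ℝ] Lp (α := ℝ) (Fin n → ℝ) 2 mu01}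

theorem exists_isTransportSemigroup (hd : ∀ i, 0 < d i) (hδ : ∀ i, d i * δ ≤ 1) (hδ0 : 0 < δ) :
    ∃ T, IsTransportSemigroup d K δ T := by
  have hex : ∀ t : ℝ, ∃ S : Lp (α := ℝ) (Fin n → ℝ) 2 mu01 →L[ℝ] Lp (α := ℝ) (Fin n → ℝ) 2 mu01,
      0 ≤ t → t ≤ δ → ∀ f, (S f : ℝ → Fin n → ℝ) =ᵐ[mu01] transport d K t f := by
    intro t
    by_cases h : 0 ≤ t ∧ t ≤ δ
    · obtain ⟨S, hS⟩ := exists_transportCLM (K := K) hd hδ hδ0 h.1 h.2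
      exact ⟨S, fun _ _ => hS⟩
    · exact ⟨0, fun h1 h2 => absurd ⟨h1, h2⟩ h⟩
  choose S hS using hex
  have hS0 : S 0 = 1 := by
    ext1 f
    refine Lp.ext ((hS 0 le_rfl hδ0.le f).trans ?_)
    exact ae_mu01_iff.2 (.of_forall fun x hx => transport_zero hx)
  have hSadd : ∀ t s, 0 ≤ t → 0 ≤ s → t + s ≤ δ → S (t + s) = S t * S s := by
    intro t s ht hs hts
    ext1 f
    refine Lp.ext ((hS (t + s) (by positivity) hts f).trans ?_)
    have h1 := hS t ht (by linarith) (S s f)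
    have h2 := transport_ae_congr (K := K) hd hδ ht (by linarith) (hS s hs (by linarith) f)
    refine EventuallyEq.trans ?_ (h1.trans h2).symm
    exact ae_mu01_iff.2 (.of_forall fun x hx => transport_transport hd hδ hs hts _ hx.1)
  obtain ⟨T, hT0, hTadd, hTS⟩ := exists_semigroup_of_local S hδ0 hS0 hSadd
  refine ⟨T, hT0, hTadd, fun t ht htδ f => ?_⟩
  have h := hTS t ht 1 one_pos (by simpa using htδ)
  rw [Nat.cast_one, div_one, pow_one] at h
  rw [h]
  exact hS t ht htδ f

namespace IsTransportSemigroup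

theorem exists_eq_pow (hT : IsTransportSemigroup d K δ T) (hδ0 : 0 < δ) {t : ℝ} (ht : 0 ≤ t) :
    ∃ (N : ℕ) (s : ℝ), 0 ≤ s ∧ s ≤ δ ∧ N * s = t ∧ T t = T s ^ N := by
  obtain ⟨N, hN⟩ := exists_nat_gt (t / δ)
  have hN0 : (0 : ℝ) < N := lt_of_le_of_lt (by positivity) hN
  have hmul : ∀ k : ℕ, T (k * (t / N)) = T (t / N) ^ k := by
    intro k
    induction k with
    | zero => simp [hT.zero]
    | succ k ih =>
      rw [Nat.cast_succ, add_one_mul, hT.add _ _ (by positivity) (by positivity), ih, pow_succ]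
  refine ⟨N, t / N, by positivity, ?_, mul_div_cancel₀ _ hN0.ne', ?_⟩
  · rw [div_le_iff₀ hN0]
    rw [div_lt_iff₀ hδ0] at hN
    linarith
  · rw [← hmul, mul_div_cancel₀ _ hN0.ne']

theorem nonneg (hT : IsTransportSemigroup d K δ T) (hd : ∀ i, 0 < d i) (hK : ∀ i j, 0 ≤ K i j)
    (hδ : ∀ i, d i * δ ≤ 1) (hδ0 : 0 < δ) {t : ℝ} (ht : 0 ≤ t)
    (f : Lp (α := ℝ) (Fin n → ℝ) 2 mu01)
    (hf : ∀ᵐ x ∂mu01, ∀ i, 0 ≤ (f : ℝ → Fin n → ℝ) x i) :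
    ∀ᵐ x ∂mu01, ∀ i, 0 ≤ (T t f : ℝ → Fin n → ℝ) x i := by
  obtain ⟨N, s, hs, hsδ, -, hpow⟩ := hT.exists_eq_pow hδ0 ht
  rw [hpow]
  clear hpow
  induction N with
  | zero => simpa using hf
  | succ N ih =>
    rw [pow_succ', mul_apply_eq_comp]
    set g := (T s ^ N) f
    have hg : (g : ℝ → Fin n → ℝ) =ᵐ[mu01] fun x => (g : ℝ → Fin n → ℝ) x ⊔ 0 := by
      filter_upwards [ih] with x hx
      exact (sup_eq_left.2 hx).symm
    have h1 := (hT.ae_eq s hs hsδ g).trans (transport_ae_congr hd hδ hs hsδ hg)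
    filter_upwards [h1, ae_mu01_iff.2 (.of_forall fun x hx => hx)] with x hx hx01 i
    rw [hx]
    refine le_trans (le_of_eq ?_) (transport_mono hd hK hδ hs hsδ (f := 0)
      (fun y _ => le_sup_right) hx01 i)
    simp [transport, inflowExt]

theorem energy_le (hT : IsTransportSemigroup d K δ T) (hd : ∀ i, 0 < d i)
    (hδ : ∀ i, d i * δ ≤ 1) (hδ0 : 0 < δ) {P : Fin n → ℝ} {ε : ℝ}
    (hP : ∀ y : Fin n → ℝ, ∑ i, P i * (Real.exp (2 * ε / d i) * (∑ j, K i j * y j) ^ 2)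
      ≤ ∑ i, P i * y i ^ 2) {t : ℝ} (ht : 0 ≤ t) (f : Lp (α := ℝ) (Fin n → ℝ) 2 mu01) :
    energy d P ε (T t f) ≤ Real.exp (-(2 * ε * t)) * energy d P ε f := by
  obtain ⟨N, s, hs, hsδ, hNs, hpow⟩ := hT.exists_eq_pow hδ0 ht
  rw [hpow, ← hNs]
  clear hpow hNs
  induction N with
  | zero => simp
  | succ N ih =>
    rw [pow_succ', mul_apply_eq_comp, energy_congr_ae (hT.ae_eq s hs hsδ _)]
    refine (energy_transport_le hd hδ hs hsδ hP (Lp.memLp _)).trans ?_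
    refine (mul_le_mul_of_nonneg_left ih (Real.exp_pos _).le).trans (le_of_eq ?_)
    rw [← mul_assoc, ← Real.exp_add]
    congr 2
    push_cast
    ring

theorem exists_norm_le (hT : IsTransportSemigroup d K δ T) (hd : ∀ i, 0 < d i)
    (hδ : ∀ i, d i * δ ≤ 1) (hδ0 : 0 < δ) {P : Fin n → ℝ} (hP0 : ∀ i, 0 < P i) {ε : ℝ}
    (hP : ∀ y : Fin n → ℝ, ∑ i, P i * (Real.exp (2 * ε / d i) * (∑ j, K i j * y j) ^ 2)
      ≤ ∑ i, P i * y i ^ 2) :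
    ∃ A : ℝ, 0 < A ∧ ∀ t, 0 ≤ t → ∀ f, ‖T t f‖ ≤ A * Real.exp (-ε * t) * ‖f‖ := by
  obtain ⟨c, C, hc, hC, hcC⟩ := exists_energy_equiv hd hP0 ε
  refine ⟨√(C / c), by positivity, fun t ht f => ?_⟩
  refine abs_le_of_sq_le_sq' ?_ (by positivity) |>.2
  rw [mul_pow, mul_pow, Real.sq_sqrt (by positivity), ← Real.exp_nat_mul]
  have h1 := (hcC (T t f)).1.trans ((hT.energy_le hd hδ hδ0 hP ht f).trans
    (mul_le_mul_of_nonneg_left (hcC f).2 (Real.exp_pos _).le))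
  have h2 : Real.exp (-(2 * ε * t)) = Real.exp ((2 : ℕ) * (-ε * t)) := by
    congr 1
    push_cast
    ring
  rw [h2] at h1
  rw [div_mul_eq_mul_div, div_mul_eq_mul_div, le_div_iff₀ hc]
  linarith

theorem exists_stable_bound (hT : IsTransportSemigroup d K δ T) (hd : ∀ i, 0 < d i)
    (hK : ∀ i j, 0 ≤ K i j) (hδ : ∀ i, d i * δ ≤ 1) (hδ0 : 0 < δ)
    (h : ∀ μ ∈ spectrum ℂ (K.map (fun x : ℝ => (x : ℂ))), ‖μ‖ < 1) :
    ∃ M ω : ℝ, 0 < M ∧ ω < 0 ∧ ∀ t : ℝ, 0 ≤ t → ‖T t‖ ≤ M * Real.exp (ω * t) := by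
  obtain ⟨P, hP0, q, hq0, hq1, hPq⟩ := exists_diagonal_lyapunov K hK h
  set C : ℝ := 1 + ∑ i, (d i)⁻¹ with hC
  have hCi : ∀ i, (d i)⁻¹ ≤ C := fun i => by
    have := Finset.single_le_sum (f := fun i => (d i)⁻¹) (fun i _ => (inv_pos.2 (hd i)).le)
      (Finset.mem_univ i)
    linarith
  have hC0 : 0 < C := by
    have : 0 ≤ ∑ i, (d i)⁻¹ := Finset.sum_nonneg fun i _ => (inv_pos.2 (hd i)).le
    linarith
  have hlog := Real.log_neg hq0 hq1
  set ε : ℝ := -Real.log q / (2 * C) with hε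
  have hε0 : 0 < ε := div_pos (by linarith) (by positivity)
  have hexp : ∀ i, Real.exp (2 * ε / d i) ≤ q⁻¹ := fun i => by
    rw [← Real.exp_log (inv_pos.2 hq0), Real.log_inv]
    refine Real.exp_le_exp.2 ?_
    rw [div_eq_mul_inv]
    refine (mul_le_mul_of_nonneg_left (hCi i) (by positivity)).trans (le_of_eq ?_)
    rw [hε]
    field_simp
  obtain ⟨A, hA, hTA⟩ := hT.exists_norm_le hd hδ hδ0 hP0 (ε := ε) fun y => by
    have h1 : ∑ i, P i * (Real.exp (2 * ε / d i) * (∑ j, K i j * y j) ^ 2)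
        ≤ ∑ i, q⁻¹ * (P i * (∑ j, K i j * y j) ^ 2) := by
      refine Finset.sum_le_sum fun i _ => ?_
      rw [mul_left_comm]
      exact mul_le_mul_of_nonneg_right (hexp i) (mul_nonneg (hP0 i).le (sq_nonneg _))
    rw [← Finset.mul_sum] at h1
    refine h1.trans ?_
    rw [inv_mul_le_iff₀ hq0]
    exact hPq y
  exact ⟨A, -ε, hA, by linarith, fun t ht =>
    ContinuousLinearMap.opNorm_le_bound _ (by positivity) (hTA t ht)⟩

theorem const_le (hT : IsTransportSemigroup d K δ T) (hd : ∀ i, 0 < d i)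
    (hK : ∀ i j, 0 ≤ K i j) (hδ : ∀ i, d i * δ ≤ 1) (hδ0 : 0 < δ) {a : Fin n → ℝ}
    (ha : ∀ i, a i ≤ ∑ j, K i j * a j) {t : ℝ} (ht : 0 ≤ t) :
    ∀ᵐ x ∂mu01, a ≤ (T t (Lp.const 2 mu01 a) : ℝ → Fin n → ℝ) x := by
  have hconst := Lp.coeFn_const (p := 2) (μ := mu01) a
  obtain ⟨N, s, hs, hsδ, -, hpow⟩ := hT.exists_eq_pow hδ0 ht
  rw [hpow]
  clear hpow
  induction N with
  | zero =>
    filter_upwards [hconst] with x hx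
    rw [pow_zero, one_apply_eq_self, hx, Function.const_apply]
  | succ N ih =>
    rw [pow_succ', mul_apply_eq_comp]
    set g := (T s ^ N) (Lp.const 2 mu01 a)
    have hg : (g : ℝ → Fin n → ℝ) =ᵐ[mu01] fun x => (g : ℝ → Fin n → ℝ) x ⊔ a := by
      filter_upwards [ih] with x hx
      exact (sup_eq_left.2 hx).symm
    have h1 := (hT.ae_eq s hs hsδ g).trans (transport_ae_congr hd hδ hs hsδ hg)
    filter_upwards [h1, ae_mu01_iff.2 (.of_forall fun x hx => hx)] with x hx hx01
    rw [hx]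
    refine le_trans (fun i => ?_) (transport_mono hd hK hδ hs hsδ (f := fun _ => a)
      (fun y _ => le_sup_right) hx01)
    simp only [transport, inflowExt]
    split_ifs
    · exact le_rfl
    · exact ha i

theorem spectrum_lt_one (hT : IsTransportSemigroup d K δ T) (hd : ∀ i, 0 < d i)
    (hK : ∀ i j, 0 ≤ K i j) (hδ : ∀ i, d i * δ ≤ 1) (hδ0 : 0 < δ)
    (h : ∃ M ω : ℝ, 0 < M ∧ ω < 0 ∧ ∀ t : ℝ, 0 ≤ t → ‖T t‖ ≤ M * Real.exp (ω * t)) :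
    ∀ μ ∈ spectrum ℂ (K.map (fun x : ℝ => (x : ℂ))), ‖μ‖ < 1 := by
  obtain ⟨M, ω, hM, hω, hTM⟩ := h
  intro μ hμ
  by_contra! h1
  obtain ⟨a, ha, ha0, haK⟩ := exists_nonneg_le_mulVec K hK hμ h1
  set f := Lp.const 2 mu01 a with hf
  have hfpos : 0 < ‖f‖ := by
    refine norm_pos_iff.2 fun hf0 => ha ?_
    obtain ⟨x, hx, hx0⟩ := ((Lp.coeFn_const (p := 2) (μ := mu01) a).and
      (Lp.eq_zero_iff_ae_eq_zero.1 hf0)).exists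
    exact hx.symm.trans hx0
  have hle : ∀ t, 0 ≤ t → ‖f‖ ≤ M * Real.exp (ω * t) * ‖f‖ := fun t ht => by
    refine le_trans (Lp.norm_le_norm_of_ae_le ?_) ((T t).le_of_opNorm_le (hTM t ht) f)
    filter_upwards [hT.const_le hd hK hδ hδ0 haK ht, Lp.coeFn_const (p := 2) (μ := mu01) a]
      with x hx hfx
    rw [hf, hfx]
    refine pi_norm_le_iff_of_nonneg (norm_nonneg _) |>.2 fun i => ?_
    refine le_trans ?_ (norm_le_pi_norm _ i)
    rw [Function.const_apply, Real.norm_of_nonneg (ha0 i),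
      Real.norm_of_nonneg ((ha0 i).trans (hx i))]
    exact hx i
  have hlim : Tendsto (fun t : ℝ => M * Real.exp (ω * t) * ‖f‖) atTop (nhds (M * 0 * ‖f‖)) :=
    ((Real.tendsto_exp_atBot.comp (tendsto_id.const_mul_atTop_of_neg hω)).const_mul M).mul_const _
  have h2 := ge_of_tendsto hlim ((eventually_ge_atTop 0).mono hle)
  simp only [mul_zero, zero_mul] at h2
  linarith

end IsTransportSemigroup

end Semigroup

section StrongContinuity

variable {n : ℕ} {d : Fin n → ℝ} {K : Matrix (Fin n) (Fin n) ℝ} {δ : ℝ}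
  {T : ℝ → Lp (α := ℝ) (Fin n → ℝ) 2 mu01 →L[ℝ] Lp (α := ℝ) (Fin n → ℝ) 2 mu01}

theorem norm_transport_le {g : ℝ → Fin n → ℝ} {B : ℝ} (hB : ∀ x, ‖g x‖ ≤ B) (t x : ℝ) :
    ‖transport d K t g x‖ ≤ B * (1 + ∑ i, ∑ j, |K i j|) := by
  have hB0 : 0 ≤ B := (norm_nonneg _).trans (hB 0)
  have hK0 : ∀ i, 0 ≤ ∑ j, |K i j| := fun i => Finset.sum_nonneg fun j _ => abs_nonneg _
  have hS : 0 ≤ ∑ i, ∑ j, |K i j| := Finset.sum_nonneg fun i _ => hK0 i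
  refine (pi_norm_le_iff_of_nonneg (by positivity)).2 fun i => ?_
  have hgi : ∀ y j, |g y j| ≤ B := fun y j => (norm_le_pi_norm (g y) j).trans (hB y)
  rw [transport, Real.norm_eq_abs]
  unfold inflowExt
  split_ifs
  · exact (hgi _ i).trans (le_mul_of_one_le_right hB0 (by linarith))
  · calc |∑ j, K i j * g (1 + d j / d i * (x - d i * t)) j|
        ≤ ∑ j, |K i j| * B := (Finset.abs_sum_le_sum_abs _ _).trans <|
          Finset.sum_le_sum fun j _ => by
            rw [abs_mul]
            exact mul_le_mul_of_nonneg_left (hgi _ _) (abs_nonneg _)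
      _ = B * ∑ j, |K i j| := by rw [← Finset.sum_mul, mul_comm]
      _ ≤ B * (1 + ∑ i, ∑ j, |K i j|) := by
          refine mul_le_mul_of_nonneg_left ?_ hB0
          have := Finset.single_le_sum (f := fun i => ∑ j, |K i j|) (fun i _ => hK0 i)
            (Finset.mem_univ i)
          linarith

theorem tendsto_transport_of_continuous {g : ℝ → Fin n → ℝ} (hg : Continuous g) {x : ℝ}
    (hx : 0 < x) :
    Tendsto (fun t => transport d K t g x) (nhds 0) (nhds (g x)) := by
  refine tendsto_pi_nhds.2 fun i => ?_
  have h1 : Tendsto (fun t => x - d i * t) (nhds 0) (nhds x) := by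
    have : Continuous fun t => x - d i * t := by fun_prop
    simpa using this.tendsto 0
  have h2 : Tendsto (fun t => g (x - d i * t) i) (nhds 0) (nhds (g x i)) :=
    (((continuous_apply i).comp hg).tendsto x).comp h1
  refine h2.congr' ?_
  filter_upwards [h1.eventually_const_lt hx] with t ht
  exact (inflowExt_of_nonneg ht.le).symm

namespace IsTransportSemigroup

theorem tendsto_of_continuous (hT : IsTransportSemigroup d K δ T) (hd : ∀ i, 0 < d i)
    (hδ : ∀ i, d i * δ ≤ 1) (hδ0 : 0 < δ) {f : Lp (α := ℝ) (Fin n → ℝ) 2 mu01}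
    {g : ℝ → Fin n → ℝ} (hg : Continuous g) {B : ℝ} (hB : ∀ x, ‖g x‖ ≤ B)
    (hfg : (f : ℝ → Fin n → ℝ) =ᵐ[mu01] g) :
    Tendsto (fun t => T t f) (nhdsWithin 0 (Ioi 0)) (nhds f) := by
  have hgL : MemLp g 2 mu01 := (memLp_congr_ae hfg).1 (Lp.memLp f)
  have hev : ∀ᶠ t : ℝ in nhdsWithin 0 (Ioi 0), t ∈ Ioo 0 δ := Ioo_mem_nhdsGT hδ0
  have hlim : Tendsto (fun t => ∫ x, ‖transport d K t g x - g x‖ ^ 2 ∂mu01)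
      (nhdsWithin 0 (Ioi 0)) (nhds (∫ _, (0 : ℝ) ∂mu01)) := by
    refine tendsto_integral_filter_of_dominated_convergence
      (fun _ => (B * (1 + ∑ i, ∑ j, |K i j|) + B) ^ 2) ?_ ?_ (integrable_const _) ?_
    · filter_upwards [hev] with t ht
      exact (integrable_norm_sq_mu01
        ((memLp_transport hd hδ ht.1.le ht.2.le hgL).sub hgL)).aestronglyMeasurable
    · refine .of_forall fun t => .of_forall fun x => ?_
      rw [norm_pow, norm_norm]
      exact pow_le_pow_left₀ (norm_nonneg _) ((norm_sub_le _ _).trans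
        (add_le_add (norm_transport_le hB t x) (hB x))) 2
    · refine ae_mu01_iff.2 ?_
      filter_upwards [Measure.ae_ne volume 0] with x hx hx01
      have h := ((tendsto_transport_of_continuous (d := d) (K := K) hg
        (lt_of_le_of_ne hx01.1 hx.symm)).sub_const (g x)).norm.pow 2
      simp only [sub_self, norm_zero, ne_eq, OfNat.ofNat_ne_zero, not_false_eq_true, zero_pow] at h
      exact h.mono_left nhdsWithin_le_nhds
  rw [integral_zero] at hlim
  rw [tendsto_iff_norm_sub_tendsto_zero]
  have hsq := hlim.sqrt
  rw [Real.sqrt_zero] at hsq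
  refine hsq.congr' ?_
  filter_upwards [hev] with t ht
  rw [← Real.sqrt_sq (norm_nonneg (T t f - f)), norm_sq_eq_integral_mu01]
  congr 1
  refine integral_congr_ae ?_
  filter_upwards [Lp.coeFn_sub (T t f) f, hfg, hT.ae_eq t ht.1.le ht.2.le f,
    transport_ae_congr (K := K) hd hδ ht.1.le ht.2.le hfg] with x h1 h2 h3 h4
  rw [h1, Pi.sub_apply, h3, h4, h2]

theorem exists_growth_bound (hT : IsTransportSemigroup d K δ T) (hd : ∀ i, 0 < d i)
    (hδ : ∀ i, d i * δ ≤ 1) (hδ0 : 0 < δ) :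
    ∃ A ω : ℝ, 0 < A ∧ ∀ t, 0 ≤ t → ∀ f, ‖T t f‖ ≤ A * Real.exp (ω * t) * ‖f‖ := by
  obtain ⟨ε, hε⟩ := exists_growth_rate (K := K) hd hδ hδ0
  obtain ⟨A, hA, h⟩ := hT.exists_norm_le hd hδ hδ0 (P := fun _ => 1) (fun _ => one_pos) hε
  exact ⟨A, -ε, hA, h⟩

theorem tendsto_zero (hT : IsTransportSemigroup d K δ T) (hd : ∀ i, 0 < d i)
    (hδ : ∀ i, d i * δ ≤ 1) (hδ0 : 0 < δ) (f : Lp (α := ℝ) (Fin n → ℝ) 2 mu01) :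
    Tendsto (fun t => T t f) (nhdsWithin 0 (Ioi 0)) (nhds f) := by
  obtain ⟨A, ω, hA, hTA⟩ := hT.exists_growth_bound hd hδ hδ0
  set C : ℝ := A * Real.exp (|ω| * δ) with hC
  have hTC : ∀ t ∈ Ioo 0 δ, ∀ h, ‖T t h‖ ≤ C * ‖h‖ := fun t ht h => by
    refine (hTA t ht.1.le h).trans ?_
    have := mul_le_mul (le_abs_self ω) ht.2.le ht.1.le (abs_nonneg ω)
    rw [hC]
    gcongr
  rw [Metric.tendsto_nhds]
  intro η hη
  have hC0 : 0 < C := by positivity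
  obtain ⟨g, hg⟩ := Metric.denseRange_iff.1 (BoundedContinuousFunction.toLp_denseRange (p := 2)
    (Fin n → ℝ) ℝ (μ := mu01) ENNReal.ofNat_ne_top) f (η / (2 * (C + 1))) (by positivity)
  set u := BoundedContinuousFunction.toLp 2 mu01 ℝ g
  have hu := hT.tendsto_of_continuous hd hδ hδ0 (f := u) g.continuous g.norm_coe_le_norm
    (BoundedContinuousFunction.coeFn_toLp 2 mu01 ℝ g)
  filter_upwards [Metric.tendsto_nhds.1 hu (η / 2) (by positivity),
    Ioo_mem_nhdsGT hδ0] with t h1 ht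
  have h2 : dist (T t f) (T t u) ≤ C * dist f u := by
    rw [dist_eq_norm, dist_eq_norm, ← map_sub]
    exact hTC t ht _
  have h3 := dist_triangle4 (T t f) (T t u) u f
  rw [dist_comm u f] at h3
  rw [lt_div_iff₀ (by positivity)] at hg
  linarith

theorem continuousOn (hT : IsTransportSemigroup d K δ T) (hd : ∀ i, 0 < d i)
    (hδ : ∀ i, d i * δ ≤ 1) (hδ0 : 0 < δ) (f : Lp (α := ℝ) (Fin n → ℝ) 2 mu01) :
    ContinuousOn (fun t => T t f) (Ici 0) := by
  obtain ⟨A, ω, hA, hTA⟩ := hT.exists_growth_bound hd hδ hδ0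
  exact continuousOn_of_semigroup T hT.zero hT.add hA.le hTA (hT.tendsto_zero hd hδ hδ0) f

end IsTransportSemigroup

end StrongContinuity

section Generator

variable {n : ℕ} {d : Fin n → ℝ} {K : Matrix (Fin n) (Fin n) ℝ} {δ : ℝ}
  {T : ℝ → Lp (α := ℝ) (Fin n → ℝ) 2 mu01 →L[ℝ] Lp (α := ℝ) (Fin n → ℝ) 2 mu01}

theorem intervalIntegrable_inflowExt (hd : ∀ i, 0 < d i) (hδ : ∀ i, d i * δ ≤ 1)
    {F : ℝ → Fin n → ℝ} (hF : MemLp F 2 mu01) (i : Fin n) {a b : ℝ}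
    (ha : a ∈ Icc (-(d i * δ)) 1) (hb : b ∈ Icc (-(d i * δ)) 1) :
    IntervalIntegrable (inflowExt d K F i) volume a b :=
  memLp_two_intervalIntegrable (memLp_inflowExt hd hδ hF i) ha hb

theorem sub_mul_mem (hd : ∀ i, 0 < d i) (i : Fin n) {t b : ℝ} (ht : t ∈ Icc 0 δ)
    (hb : b ∈ Icc (0 : ℝ) 1) : b - d i * t ∈ Icc (-(d i * δ)) 1 :=
  transport_arg_mem hd ht.1 ht.2 i hb

namespace IsTransportSemigroup

theorem integral_sub (hT : IsTransportSemigroup d K δ T) (hd : ∀ i, 0 < d i)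
    (hδ : ∀ i, d i * δ ≤ 1) {f : Lp (α := ℝ) (Fin n → ℝ) 2 mu01}
    {F : ℝ → Fin n → ℝ} (hfF : (f : ℝ → Fin n → ℝ) =ᵐ[mu01] F) {t : ℝ} (ht : t ∈ Icc 0 δ)
    (i : Fin n) {b : ℝ} (hb : b ∈ Icc (0 : ℝ) 1) :
    ∫ x in (0 : ℝ)..b, (T t f - f : Lp (α := ℝ) (Fin n → ℝ) 2 mu01) x i
      = (∫ x in (-(d i * t))..0, inflowExt d K F i x)
        - ∫ x in (b - d i * t)..b, inflowExt d K F i x := by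
  have hF : MemLp F 2 mu01 := (memLp_congr_ae hfF).1 (Lp.memLp f)
  have h01 : (0 : ℝ) ∈ Icc (0 : ℝ) 1 := left_mem_Icc.2 zero_le_one
  have hδ0 : (0 : ℝ) ∈ Icc 0 δ := ⟨le_rfl, ht.1.trans ht.2⟩
  have m0 : (0 : ℝ) ∈ Icc (-(d i * δ)) 1 := by simpa using sub_mul_mem hd i hδ0 h01
  have mb : b ∈ Icc (-(d i * δ)) 1 := by simpa using sub_mul_mem hd i hδ0 hb
  have mt : -(d i * t) ∈ Icc (-(d i * δ)) 1 := by simpa using sub_mul_mem hd i ht h01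
  have mbt := sub_mul_mem hd i ht hb
  have hI := @intervalIntegrable_inflowExt n d K δ hd hδ F hF i
  obtain ⟨ℓ, hℓ⟩ := exists_integralCLM i hb
  rw [← hℓ, map_sub, hℓ, hℓ,
    integral_transport
      ((hT.ae_eq t ht.1 ht.2 f).trans (transport_ae_congr hd hδ ht.1 ht.2 hfF)) i hb]
  have h0 : ∫ x in (0 : ℝ)..b, (f : ℝ → Fin n → ℝ) x i
      = ∫ x in (0 : ℝ)..b, inflowExt d K F i x := by
    refine intervalIntegral.integral_congr_ae ?_
    filter_upwards [ae_mu01_iff.1 hfF] with x hx hx'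
    rw [uIoc_of_le hb.1] at hx'
    rw [hx ⟨hx'.1.le, hx'.2.trans hb.2⟩, inflowExt_of_nonneg hx'.1.le]
  rw [h0]
  have e1 := intervalIntegral.integral_add_adjacent_intervals (hI mt mbt) (hI mbt mb)
  have e2 := intervalIntegral.integral_add_adjacent_intervals (hI mt m0) (hI m0 mb)
  linarith

theorem sub_eq_integral (hT : IsTransportSemigroup d K δ T) (hd : ∀ i, 0 < d i)
    (hδ : ∀ i, d i * δ ≤ 1) (hδ0 : 0 < δ) {f g : Lp (α := ℝ) (Fin n → ℝ) 2 mu01}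
    (h : HypGen d K f g) {t : ℝ} (ht : t ∈ Icc 0 δ) :
    T t f - f = ∫ s in (0 : ℝ)..t, T s g := by
  obtain ⟨F, G, hfF, hgG, hFG, hbc⟩ := h
  have hF : MemLp F 2 mu01 := (memLp_congr_ae hfF).1 (Lp.memLp f)
  have hG : MemLp G 2 mu01 := (memLp_congr_ae hgG).1 (Lp.memLp g)
  have hTg : IntervalIntegrable (fun s => T s g) volume 0 t := by
    refine ContinuousOn.intervalIntegrable ((hT.continuousOn hd hδ hδ0 g).mono ?_)
    rw [uIcc_of_le ht.1]
    exact fun s hs => hs.1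
  rw [← sub_eq_zero]
  refine eq_zero_of_forall_integral_eq_zero _ fun i b hb => ?_
  obtain ⟨ℓ, hℓ⟩ := exists_integralCLM i hb
  have h01 : (0 : ℝ) ∈ Icc (0 : ℝ) 1 := left_mem_Icc.2 zero_le_one
  have m0 : (0 : ℝ) ∈ Icc (-(d i * δ)) 1 := by
    simpa using sub_mul_mem hd i ⟨le_rfl, hδ0.le⟩ h01
  have hi := hd i
  have hs : ∀ s ∈ Icc 0 t, ℓ (T s g)
      = d i * (inflowExt d K F i (0 - d i * s) - inflowExt d K F i (b - d i * s)) := by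
    intro s hs
    have hsδ : s ∈ Icc 0 δ := ⟨hs.1, hs.2.trans ht.2⟩
    have m1 := sub_mul_mem hd i hsδ h01
    have m2 := sub_mul_mem hd i hsδ hb
    rw [hℓ, integral_transport
      ((hT.ae_eq s hsδ.1 hsδ.2 g).trans (transport_ae_congr hd hδ hsδ.1 hsδ.2 hgG)) i hb,
      inflowExt_eq_integral hd hδ hG hFG hbc i m1, inflowExt_eq_integral hd hδ hG hFG hbc i m2,
      zero_sub, sub_sub_sub_cancel_left, ← mul_sub, mul_inv_cancel_left₀ hi.ne',
      intervalIntegral.integral_interval_sub_left]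
    · exact intervalIntegrable_inflowExt hd hδ hG i m0 m2
    · exact intervalIntegrable_inflowExt hd hδ hG i m0 (by simpa using m1)
  have hcomp : ∀ u ∈ Icc (0 : ℝ) 1,
      IntervalIntegrable (fun s => inflowExt d K F i (u - d i * s)) volume 0 t := by
    intro u hu
    have h1 := memLp_comp_affine (memLp_inflowExt (K := K) hd hδ hF i) (neg_ne_zero.2 hi.ne')
      (a' := 0) (b' := δ) (e := u) fun s hs => by
        rw [neg_mul, ← sub_eq_add_neg]
        exact sub_mul_mem hd i hs hu
    simpa only [neg_mul, ← sub_eq_add_neg] using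
      memLp_two_intervalIntegrable h1 ⟨le_rfl, hδ0.le⟩ ht
  rw [← hℓ, map_sub, hℓ, hT.integral_sub hd hδ hfF ht i hb,
    ← ContinuousLinearMap.intervalIntegral_comp_comm ℓ hTg,
    intervalIntegral.integral_congr (g := fun s => d i * (inflowExt d K F i (0 - d i * s)
      - inflowExt d K F i (b - d i * s))) (fun s h => hs s (by rwa [uIcc_of_le ht.1] at h)),
    intervalIntegral.integral_const_mul,
    intervalIntegral.integral_sub (hcomp 0 h01) (hcomp b hb), mul_sub,
    intervalIntegral.mul_integral_comp_sub_mul, intervalIntegral.mul_integral_comp_sub_mul]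
  simp

theorem tendsto_of_hypGen (hT : IsTransportSemigroup d K δ T) (hd : ∀ i, 0 < d i)
    (hδ : ∀ i, d i * δ ≤ 1) (hδ0 : 0 < δ) {f g : Lp (α := ℝ) (Fin n → ℝ) 2 mu01}
    (h : HypGen d K f g) :
    Tendsto (fun t : ℝ => t⁻¹ • (T t f - f)) (nhdsWithin 0 (Ioi 0)) (nhds g) := by
  have h1 := tendsto_inv_smul_integral hδ0
    ((hT.continuousOn hd hδ hδ0 g).mono fun s (hs : s ∈ Icc 0 δ) => hs.1)
  rw [hT.zero] at h1
  refine h1.congr' ?_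
  filter_upwards [Ioo_mem_nhdsGT hδ0] with t ht
  rw [hT.sub_eq_integral hd hδ hδ0 h ⟨ht.1.le, ht.2.le⟩]

end IsTransportSemigroup

theorem ae_tendsto_average_inflowExt (hd : ∀ i, 0 < d i) (hδ : ∀ i, d i * δ ≤ 1) (hδ0 : 0 < δ)
    {f : ℝ → Fin n → ℝ} (hf : MemLp f 2 mu01) (i : Fin n) :
    ∀ᵐ b ∂mu01, Tendsto (fun t => t⁻¹ * ∫ x in (b - d i * t)..b, inflowExt d K f i x)
      (nhdsWithin 0 (Ioi 0)) (nhds (d i * f b i)) := by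
  have h01 : (0 : ℝ) ∈ Icc (0 : ℝ) 1 := left_mem_Icc.2 zero_le_one
  have hδδ : (0 : ℝ) ∈ Icc 0 δ := ⟨le_rfl, hδ0.le⟩
  have m0 : (0 : ℝ) ∈ Icc (-(d i * δ)) 1 := by simpa using sub_mul_mem hd i hδδ h01
  have hle : -(d i * δ) ≤ 1 := m0.1.trans m0.2
  have hint := intervalIntegrable_inflowExt (K := K) hd hδ hf i (left_mem_Icc.2 hle)
    (right_mem_Icc.2 hle)
  refine ae_mu01_iff.2 ?_
  filter_upwards [hint.ae_hasDerivAt_integral] with b hb hb01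
  have mb : b ∈ Icc (-(d i * δ)) 1 := by simpa using sub_mul_mem hd i hδδ hb01
  rw [uIcc_of_le hle] at hb
  have h1 := hb mb 0 m0
  rw [inflowExt_of_nonneg hb01.1] at h1
  have h2 : HasDerivAt (fun t => b - d i * t) (-d i) 0 := by
    simpa using ((hasDerivAt_id (0 : ℝ)).const_mul (d i)).const_sub b
  have h1' : HasDerivAt (fun u => ∫ y in (0 : ℝ)..u, inflowExt d K f i y) (f b i)
      (b - d i * 0) := by simpa using h1
  have h3 := ((h1'.comp (0 : ℝ) h2).tendsto_slope_zero_right).neg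
  have e : -(f b i * -d i) = d i * f b i := by ring
  rw [e] at h3
  refine h3.congr' ?_
  filter_upwards [Ioo_mem_nhdsGT hδ0] with t ht
  have mbt := sub_mul_mem hd i ⟨ht.1.le, ht.2.le⟩ hb01
  simp only [Function.comp_apply, zero_add, mul_zero, sub_zero, smul_eq_mul]
  rw [← mul_neg, neg_sub, intervalIntegral.integral_interval_sub_left]
  · exact intervalIntegrable_inflowExt hd hδ hf i m0 mb
  · exact intervalIntegrable_inflowExt hd hδ hf i m0 mbt

theorem tendsto_boundary_average (hd : ∀ i, 0 < d i) (hδ : ∀ i, d i * δ ≤ 1) (hδ0 : 0 < δ)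
    {F : ℝ → Fin n → ℝ} (hF : ∀ j, ContinuousOn (fun x => F x j) (Icc 0 1)) (i : Fin n) :
    Tendsto (fun t => t⁻¹ * ∫ x in (-(d i * t))..0, inflowExt d K F i x)
      (nhdsWithin 0 (Ioi 0)) (nhds (d i * ∑ j, K i j * F 1 j)) := by
  have hc : ContinuousOn (fun s => d i * ∑ j, K i j * F (1 - d j * s) j) (Icc 0 δ) := by
    refine continuousOn_const.mul (continuousOn_finsetSum _ fun j _ => continuousOn_const.mul ?_)
    refine (hF j).comp (f := fun s => 1 - d j * s) (by fun_prop) fun s hs => ?_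
    have h1 := mul_le_mul_of_nonneg_left hs.2 (hd j).le
    have h2 := mul_nonneg (hd j).le hs.1
    have h3 := hδ j
    constructor <;> linarith
  have h := tendsto_inv_smul_integral hδ0 hc
  simp only [mul_zero, sub_zero, smul_eq_mul] at h
  refine h.congr' ?_
  filter_upwards [self_mem_nhdsWithin] with t ht
  have ht : 0 < t := ht
  have e := intervalIntegral.mul_integral_comp_sub_mul
    (f := inflowExt d K F i) (c := d i) (d := 0) (a := 0) (b := t)
  rw [mul_zero, sub_zero, zero_sub] at e
  rw [← e, intervalIntegral.integral_const_mul]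
  congr 2
  refine intervalIntegral.integral_congr_ae (.of_forall fun s hs => ?_)
  rw [uIoc_of_le ht.le] at hs
  have hi := hd i
  rw [inflowExt_of_neg (by nlinarith [hs.1])]
  refine Finset.sum_congr rfl fun j _ => ?_
  congr 2
  field_simp
  ring

theorem IsTransportSemigroup.hypGen_of_tendsto (hT : IsTransportSemigroup d K δ T)
    (hd : ∀ i, 0 < d i) (hδ : ∀ i, d i * δ ≤ 1) (hδ0 : 0 < δ)
    {f g : Lp (α := ℝ) (Fin n → ℝ) 2 mu01}
    (h : Tendsto (fun t : ℝ => t⁻¹ • (T t f - f)) (nhdsWithin 0 (Ioi 0)) (nhds g)) :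
    HypGen d K f g := by
  have hlim : ∀ i, ∀ᵐ b ∂mu01,
      Tendsto (fun t => t⁻¹ * ∫ x in (-(d i * t))..0, inflowExt d K f i x) (nhdsWithin 0 (Ioi 0))
        (nhds ((∫ x in (0 : ℝ)..b, (g : ℝ → Fin n → ℝ) x i) + d i * (f : ℝ → Fin n → ℝ) b i)) := by
    intro i
    filter_upwards [ae_tendsto_average_inflowExt (K := K) hd hδ hδ0 (Lp.memLp f) i,
      ae_mu01_iff.2 (.of_forall fun x hx => hx)] with b hb hb01
    obtain ⟨ℓ, hℓ⟩ := exists_integralCLM i hb01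
    have h1 := (ℓ.continuous.tendsto g).comp h
    rw [hℓ] at h1
    refine (h1.add hb).congr' ?_
    filter_upwards [Ioo_mem_nhdsGT hδ0] with t ht
    rw [Function.comp_apply, map_smul, hℓ,
      hT.integral_sub hd hδ (EventuallyEq.refl _ _) ⟨ht.1.le, ht.2.le⟩ i hb01, smul_eq_mul]
    ring
  have hex : ∀ i, ∃ c, Tendsto (fun t => t⁻¹ * ∫ x in (-(d i * t))..0, inflowExt d K f i x)
      (nhdsWithin 0 (Ioi 0)) (nhds c) := fun i => (hlim i).exists.elim fun b hb => ⟨_, hb⟩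
  choose c hc using hex
  set F : ℝ → Fin n → ℝ :=
    fun x i => (d i)⁻¹ * (c i - ∫ s in (0 : ℝ)..x, (g : ℝ → Fin n → ℝ) s i) with hF
  have hfF : (f : ℝ → Fin n → ℝ) =ᵐ[mu01] F := by
    filter_upwards [ae_all_iff.2 hlim] with b hb
    funext i
    have := tendsto_nhds_unique (hc i) (hb i)
    simp only [hF]
    rw [this, add_sub_cancel_left, inv_mul_cancel_left₀ (hd i).ne']
  have hF0 : ∀ i, F 0 i = (d i)⁻¹ * c i := fun i => by simp [hF]
  refine ⟨F, g, hfF, EventuallyEq.refl _ _, fun i x _ => ?_, fun i => ?_⟩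
  · rw [hF0, intervalIntegral.integral_const_mul]
    simp only [hF]
    ring
  · have hFc : ∀ j, ContinuousOn (fun x => F x j) (Icc 0 1) := fun j => by
      refine continuousOn_const.mul (continuousOn_const.sub ?_)
      have h1 : IntegrableOn (fun s => (g : ℝ → Fin n → ℝ) s j) (Icc 0 1) :=
        (memLp_component (Lp.memLp g) j).integrable (by norm_num)
      have := intervalIntegral.continuousOn_primitive_interval (a := 0) (b := 1)
        (by rwa [uIcc_of_le zero_le_one])
      rwa [uIcc_of_le zero_le_one] at this
    have h1 := tendsto_boundary_average (K := K) hd hδ hδ0 hFc i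
    have h2 : Tendsto (fun t => t⁻¹ * ∫ x in (-(d i * t))..0, inflowExt d K F i x)
        (nhdsWithin 0 (Ioi 0)) (nhds (c i)) := by
      refine (hc i).congr' ?_
      filter_upwards [Ioo_mem_nhdsGT hδ0] with t ht
      congr 1
      refine intervalIntegral.integral_congr_ae ?_
      filter_upwards [inflowExt_ae_congr (K := K) hd hδ hfF i] with x hx hx'
      have hi := hd i
      rw [uIoc_of_le (by nlinarith [ht.1])] at hx'
      exact hx ⟨by nlinarith [hx'.1, ht.2], by linarith [hx'.2]⟩
    rw [hF0, ← tendsto_nhds_unique h1 h2, inv_mul_cancel_left₀ (hd i).ne']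

end Generator

/-- The semigroup on `L²([0,1], ℝⁿ)` solving the hyperbolic
system `∂_t y + D ∂_x y = 0`, `y(0,t) = K y(1,t)`, `D = diag(d_i)` with
`d_i > 0` and `K ≥ 0`, is positive, and it is uniformly exponentially stable
iff the spectral radius `r(K) < 1`. -/
theorem hyperbolic_closed_loop_positive_and_stable_iff
    (n : ℕ) (d : Fin n → ℝ) (hd : ∀ i, 0 < d i)
    (K : Matrix (Fin n) (Fin n) ℝ) (hK : ∀ i j, 0 ≤ K i j) :
    ∃ T : ℝ → Lp (α := ℝ) (Fin n → ℝ) 2 mu01 →L[ℝ] Lp (α := ℝ) (Fin n → ℝ) 2 mu01,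
      -- C₀-semigroup:
      T 0 = 1 ∧ (∀ t s : ℝ, 0 ≤ t → 0 ≤ s → T (t + s) = (T t).comp (T s)) ∧
      (∀ f : Lp (α := ℝ) (Fin n → ℝ) 2 mu01, ContinuousOn (fun t => T t f) (Ici (0 : ℝ))) ∧
      -- `Q_r^{cl}` is the generator:
      (∀ f g : Lp (α := ℝ) (Fin n → ℝ) 2 mu01,
        Tendsto (fun t : ℝ => t⁻¹ • (T t f - f)) (nhdsWithin 0 (Ioi 0)) (nhds g) ↔
          HypGen d K f g) ∧
      -- positivity:
      (∀ t : ℝ, 0 ≤ t → ∀ f : Lp (α := ℝ) (Fin n → ℝ) 2 mu01,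
        (∀ᵐ s ∂mu01, ∀ i, 0 ≤ (f : ℝ → Fin n → ℝ) s i) →
        ∀ᵐ s ∂mu01, ∀ i, 0 ≤ (T t f : ℝ → Fin n → ℝ) s i) ∧
      -- uniform exponential stability iff `r(K) < 1`:
      ((∃ M ω : ℝ, 0 < M ∧ ω < 0 ∧ ∀ t : ℝ, 0 ≤ t → ‖T t‖ ≤ M * Real.exp (ω * t)) ↔
        (∀ μ ∈ spectrum ℂ (K.map (fun x : ℝ => (x : ℂ))), ‖μ‖ < 1)) := by
  have hsum : 0 ≤ ∑ i, d i := Finset.sum_nonneg fun i _ => (hd i).le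
  obtain ⟨δ, hδ0, hδ⟩ : ∃ δ : ℝ, 0 < δ ∧ ∀ i, d i * δ ≤ 1 := by
    refine ⟨(1 + ∑ i, d i)⁻¹, by positivity, fun i => ?_⟩
    have := Finset.single_le_sum (fun i _ => (hd i).le) (Finset.mem_univ i)
    rw [← div_eq_mul_inv, div_le_one (by positivity)]
    linarith
  obtain ⟨T, hT⟩ := exists_isTransportSemigroup (K := K) hd hδ hδ0
  exact ⟨T, hT.zero, hT.add, hT.continuousOn hd hδ hδ0,
    fun f g => ⟨hT.hypGen_of_tendsto hd hδ hδ0, hT.tendsto_of_hypGen hd hδ hδ0⟩,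
    fun t ht f => hT.nonneg hd hK hδ hδ0 ht f,
    hT.spectrum_lt_one hd hK hδ hδ0, hT.exists_stable_bound hd hK hδ hδ0⟩
end
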